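/- arXiv:2307.08534 — 3 statements merged into one kernel-verified Lean document; each statement's English description precedes it below -/
import Mathlib

section
/- Let G be a finite group and N ⊴ G a normal subgroup such that G/N ≅ S₁ × ... × S_k for some non-abelian simple groups S₁, ..., S_k. Let p be a prime such that p does not divide |M(S_i)| for each i ∈ {1, ..., k}. Suppose φ is an irreducible complex character of N that is G-invariant and φ(1)·o(φ) is a power of p. Then φ has an irreducible extension χ to G (i.e., χ ∈ Irr(G) with χ restricted to N equal to φ) such that o(χ) = o(φ). -/
open CategoryTheory

/-- The group of `2`-cocycles of `S` with values in `ℂˣ` (trivial action). -/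
def twoCocycles (S : Type*) [Group S] : Subgroup (S × S → ℂˣ) where
  carrier := {f | ∀ a b c : S, f (a, b) * f (a * b, c) = f (b, c) * f (a, b * c)}
  one_mem' := by intro a b c; simp
  mul_mem' := by
    intro f g hf hg a b c
    simp only [Pi.mul_apply]
    rw [mul_mul_mul_comm, hf a b c, hg a b c, mul_mul_mul_comm]
  inv_mem' := by
    intro f hf a b c
    simp only [Pi.inv_apply]
    rw [← mul_inv, hf a b c, mul_inv]

/-- The group of `2`-coboundaries of `S` with values in `ℂˣ` (trivial action). -/
def twoCoboundaries (S : Type*) [Group S] : Subgroup (S × S → ℂˣ) where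
  carrier := {f | ∃ g : S → ℂˣ, ∀ a b : S, f (a, b) = g a * g b * (g (a * b))⁻¹}
  one_mem' := ⟨1, by intro a b; simp⟩
  mul_mem' := by
    rintro f f' ⟨g, hg⟩ ⟨g', hg'⟩
    refine ⟨g * g', fun a b => ?_⟩
    simp only [Pi.mul_apply, mul_inv, hg a b, hg' a b]
    ac_rfl
  inv_mem' := by
    rintro f ⟨g, hg⟩
    refine ⟨g⁻¹, fun a b => ?_⟩
    simp only [Pi.inv_apply, hg a b, mul_inv, inv_inv]

/-- The Schur multiplier of `S`, identified with `H²(S, ℂˣ)` for the trivial action: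
`2`-cocycles modulo `2`-coboundaries. -/
def schurMultiplier (S : Type*) [Group S] : Type _ :=
  ↥(twoCocycles S) ⧸ (twoCoboundaries S).subgroupOf (twoCocycles S)

/-- The determinantal order `o(χ)` of the character of a representation `V` :
the order of the linear character `det ∘ ρ` in the group of linear characters. -/
noncomputable def charDetOrder {G : Type} [Group G] (V : FDRep ℂ G) : ℕ :=
  orderOf ((LinearMap.det : (V →ₗ[ℂ] V) →* ℂ).comp V.ρ)


/-- A homomorphism from `S` lifts along a central extension by `ℂˣ` whose class is killed by
an integer prime to the order of the Schur multiplier. -/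
lemma exists_lift_of_central {E Q S : Type} [Group E] [Group Q] [Group S]
    (π : E →* Q) (hπ : Function.Surjective π) (z : ℂˣ →* E) (hz : Function.Injective z)
    (hcen : ∀ c e, z c * e = e * z c) (hker : ∀ e, π e = 1 → ∃ c, z c = e)
    (hzπ : ∀ c, π (z c) = 1)
    (δ : E →* ℂˣ) (n : ℕ) (hδ : ∀ c, δ (z c) = c ^ n)
    (hn : Nat.Coprime n (Nat.card (schurMultiplier S))) (f : S →* Q) :
    ∃ s : S →* E, ∀ a, π (s a) = f a := by
  choose t ht using fun a : S => hπ (f a)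
  have h1 : ∀ x : S × S, ∃ c, z c = t x.1 * t x.2 * (t (x.1 * x.2))⁻¹ := by
    intro x
    apply hker
    simp [ht]
  choose α hα using h1
  have hα' : ∀ a b, t a * t b = z (α (a, b)) * t (a * b) := by
    intro a b
    rw [hα]; simp
  have hcoc : α ∈ twoCocycles S := by
    intro a b c
    apply hz
    rw [map_mul, map_mul]
    have e1 : z (α (a, b)) * z (α (a * b, c)) * t (a * b * c) = t a * t b * t c := by
      rw [mul_assoc, ← hα', ← mul_assoc, ← hα']
    have e2 : z (α (b, c)) * z (α (a, b * c)) * t (a * b * c) = t a * t b * t c := by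
      rw [mul_assoc, mul_assoc a b c, ← hα', ← mul_assoc, hcen, mul_assoc, ← hα', mul_assoc]
    exact mul_right_cancel (e1.trans e2.symm)
  let D := (twoCoboundaries S).subgroupOf (twoCocycles S)
  let cl : ↥(twoCocycles S) ⧸ D := QuotientGroup.mk ⟨α, hcoc⟩
  have hcl : cl ^ n = 1 := by
    change QuotientGroup.mk ((⟨α, hcoc⟩ : ↥(twoCocycles S)) ^ n) = _
    rw [QuotientGroup.eq_one_iff, Subgroup.mem_subgroupOf]
    refine ⟨fun a => δ (t a), fun a b => ?_⟩
    change α (a, b) ^ n = _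
    rw [← hδ, hα]; simp
  have hcl1 : cl = 1 := by
    rw [← orderOf_eq_one_iff]
    apply Nat.eq_one_of_dvd_coprimes hn (orderOf_dvd_of_pow_eq_one hcl)
    exact orderOf_dvd_natCard cl
  rw [QuotientGroup.eq_one_iff, Subgroup.mem_subgroupOf] at hcl1
  obtain ⟨g, hg⟩ := hcl1
  change ∀ a b, α (a, b) = _ at hg
  refine ⟨MonoidHom.mk' (fun a => z (g a)⁻¹ * t a) fun a b => ?_, fun a => ?_⟩
  · have : z (g a)⁻¹ * t a * (z (g b)⁻¹ * t b) = z ((g a)⁻¹ * (g b)⁻¹ * α (a, b)) * t (a * b) := by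
      rw [map_mul, mul_assoc _ _ (t (a * b)), ← hα', map_mul]
      rw [mul_assoc, ← mul_assoc (t a), ← hcen]; simp only [mul_assoc]
    rw [this, hg]
    congr 2
    rw [← mul_inv, inv_mul_cancel_left]
  · simp [hzπ, ht]

lemma hom_trivial_of_simple {S A : Type} [Group S] [CommGroup A] (hs : IsSimpleGroup S)
    (hna : ¬∀ a b : S, a * b = b * a) (f : S →* A) (a : S) : f a = 1 := by
  rcases hs.eq_bot_or_eq_top_of_normal f.ker inferInstance with h | h
  · exfalso
    apply hna
    intro a b
    apply (MonoidHom.ker_eq_bot_iff f).1 h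
    simp [mul_comm]
  · rw [← MonoidHom.mem_ker, h]; trivial

lemma hom_trivial_of_pi {k : ℕ} {S : Fin k → Type} [∀ i, Group (S i)] {A : Type} [CommGroup A]
    (hsimple : ∀ i, IsSimpleGroup (S i)) (hnonab : ∀ i, ¬∀ a b : S i, a * b = b * a)
    (f : (∀ i, S i) →* A) (a : ∀ i, S i) : f a = 1 := by
  have : f = 1 := by
    apply MonoidHom.pi_ext
    intro i x
    exact hom_trivial_of_simple (hsimple i) (hnonab i) (f.comp (MonoidHom.mulSingle S i)) x
  rw [this]; rfl

/-- The central extension of a product of nonabelian simple groups splits. -/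
lemma exists_splitting {E : Type} [Group E] {k : ℕ} {S : Fin k → Type} [∀ i, Group (S i)]
    (hsimple : ∀ i, IsSimpleGroup (S i)) (hnonab : ∀ i, ¬∀ a b : S i, a * b = b * a)
    (π : E →* ∀ i, S i) (hπ : Function.Surjective π) (z : ℂˣ →* E) (hz : Function.Injective z)
    (hcen : ∀ c e, z c * e = e * z c) (hker : ∀ e, π e = 1 → ∃ c, z c = e)
    (hzπ : ∀ c, π (z c) = 1)
    (δ : E →* ℂˣ) (n : ℕ) (hδ : ∀ c, δ (z c) = c ^ n)
    (hn : ∀ i, Nat.Coprime n (Nat.card (schurMultiplier (S i)))) :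
    ∃ s : (∀ i, S i) →* E, ∀ a, π (s a) = a := by
  choose s hs using fun i => exists_lift_of_central π hπ z hz hcen hker hzπ δ n hδ (hn i)
    (MonoidHom.mulSingle S i)
  have hcomm : Pairwise fun i j => ∀ x y, Commute (s i x) (s j y) := by
    intro i j hij x y
    have h1 : ∀ x : S i, ∃ c, z c = s i x * s j y * (s i x)⁻¹ * (s j y)⁻¹ := by
      intro x
      apply hker
      have := Pi.mulSingle_commute hij x y
      simp only [map_mul, map_inv, hs, MonoidHom.mulSingle_apply]
      rw [this.eq]; group
    choose c hc using h1
    have hc' : ∀ x, s i x * s j y * (s i x)⁻¹ = z (c x) * s j y := by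
      intro x; rw [hc]; group
    let F : S i →* ℂˣ := MonoidHom.mk' c (by
      intro a b
      apply hz
      apply mul_right_cancel (b := s j y)
      rw [← hc', map_mul, map_mul]
      calc s i a * s i b * s j y * (s i a * s i b)⁻¹
          = s i a * (s i b * s j y * (s i b)⁻¹) * (s i a)⁻¹ := by group
        _ = s i a * z (c b) * s j y * (s i a)⁻¹ := by rw [hc']; group
        _ = z (c b) * (s i a * s j y * (s i a)⁻¹) := by rw [← hcen]; group
        _ = z (c a) * z (c b) * s j y := by rw [hc', ← mul_assoc, hcen])
    have h2 : c x = 1 := hom_trivial_of_simple (hsimple i) (hnonab i) F x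
    have h3 := hc' x
    rw [h2, map_one, one_mul, mul_inv_eq_iff_eq_mul] at h3
    exact h3
  refine ⟨MonoidHom.noncommPiCoprod s hcomm, fun a => ?_⟩
  have : π.comp (MonoidHom.noncommPiCoprod s hcomm) = MonoidHom.id _ := by
    apply MonoidHom.pi_ext
    intro i x
    simp [hs]
  exact DFunLike.congr_fun this a

lemma fdrep_simple_iff {G : Type} [Group G] [Finite G] (V : FDRep ℂ G) :
    Simple V ↔ Nontrivial V ∧ ∀ T : V →ₗ[ℂ] V, (∀ g, T * V.ρ g = V.ρ g * T) →
      ∃ c : ℂ, T = c • 1 := by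
  have hmem : ∀ T : V →ₗ[ℂ] V, T ∈ (Representation.linHom V.ρ V.ρ).invariants ↔
      ∀ g, T * V.ρ g = V.ρ g * T := by
    intro T
    rw [Representation.mem_invariants]
    refine forall_congr' fun g => ?_
    rw [Representation.linHom_apply]
    change V.ρ g * (T * V.ρ g⁻¹) = T ↔ _
    have h1 : V.ρ g⁻¹ * V.ρ g = 1 := by rw [← map_mul]; simp
    have h2 : V.ρ g * V.ρ g⁻¹ = 1 := by rw [← map_mul]; simp
    constructor
    · intro h
      nth_rewrite 1 [← h]
      rw [mul_assoc, mul_assoc, h1, mul_one]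
    · intro h
      rw [← mul_assoc, ← h, mul_assoc, h2, mul_one]
  rw [FDRep.simple_iff_end_is_rank_one,
    ← LinearEquiv.finrank_eq (Representation.linHom.invariantsEquivFDRepHom V V)]
  have h1 : (1 : V →ₗ[ℂ] V) ∈ (Representation.linHom V.ρ V.ρ).invariants :=
    (hmem 1).2 (by simp)
  constructor
  · intro h
    have hne : Nontrivial V := by
      by_contra hc
      rw [not_nontrivial_iff_subsingleton] at hc
      have : Subsingleton (Representation.linHom V.ρ V.ρ).invariants :=
        ⟨fun a b => by ext x; exact Subsingleton.elim _ _⟩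
      rw [Module.finrank_zero_of_subsingleton] at h
      omega
    refine ⟨hne, fun T hT => ?_⟩
    have h1' : (⟨1, h1⟩ : (Representation.linHom V.ρ V.ρ).invariants) ≠ 0 := by
      intro h
      have := congrArg Subtype.val h
      exact one_ne_zero this
    obtain ⟨c, hc⟩ := (finrank_eq_one_iff_of_nonzero' _ h1').1 h ⟨T, (hmem T).2 hT⟩
    exact ⟨c, (congrArg Subtype.val hc).symm⟩
  · rintro ⟨hne, h⟩
    have h1' : (⟨1, h1⟩ : (Representation.linHom V.ρ V.ρ).invariants) ≠ 0 := by
      intro h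
      have := congrArg Subtype.val h
      exact one_ne_zero this
    rw [finrank_eq_one_iff_of_nonzero' _ h1']
    rintro ⟨T, hT⟩
    obtain ⟨c, hc⟩ := h T ((hmem T).1 hT)
    exact ⟨c, Subtype.ext hc.symm⟩

/-- Group-theoretic form of the extension theorem. -/
lemma exists_extension_hom {G U : Type} [Group G] [Group U] (N : Subgroup G) [N.Normal]
    {k : ℕ} {S : Fin k → Type} [∀ i, Group (S i)]
    (hsimple : ∀ i, IsSimpleGroup (S i)) (hnonab : ∀ i, ¬∀ a b : S i, a * b = b * a)
    (e : (G ⧸ N) ≃* ∀ i, S i) (R : ↥N →* U) (ζ : ℂˣ →* U) (hζ : Function.Injective ζ)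
    (hcen : ∀ c u, ζ c * u = u * ζ c)
    (hconj : ∀ g : G, ∃ T : U, ∀ n : ↥N, T * R n = R (MulAut.conjNormal g n) * T)
    (hsch : ∀ T : U, (∀ n : ↥N, T * R n = R n * T) → ∃ c, ζ c = T)
    (δ : U →* ℂˣ) (d : ℕ) (hδR : ∀ n, δ (R n) = 1) (hδ : ∀ c, δ (ζ c) = c ^ d)
    (hd : ∀ i, Nat.Coprime d (Nat.card (schurMultiplier (S i)))) :
    ∃ T : G →* U, ∀ n : ↥N, T ↑n = R n := by
  let H : Subgroup (G × U) :=
    { carrier := {x | ∀ n : ↥N, x.2 * R n = R (MulAut.conjNormal x.1 n) * x.2}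
      one_mem' := by intro n; simp
      mul_mem' := by
        intro a b ha hb n
        simp only [Prod.fst_mul, Prod.snd_mul, map_mul, MulAut.mul_apply]
        rw [mul_assoc, hb n, ← mul_assoc, ha, mul_assoc]
      inv_mem' := by
        intro a ha n
        have := ha (MulAut.conjNormal a.1⁻¹ n)
        simp only [map_inv, MulAut.apply_inv_self] at this
        simp only [Prod.fst_inv, Prod.snd_inv, map_inv]
        rw [inv_mul_eq_iff_eq_mul, ← mul_assoc, this, mul_assoc, mul_inv_cancel, mul_one] }
  have hH : ∀ g u, ((g, u) : G × U) ∈ H ↔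
    ∀ n : ↥N, u * R n = R (MulAut.conjNormal g n) * u := fun g u => Iff.rfl
  have hRmem : ∀ n : ↥N, ((n : G), R n) ∈ H := by
    intro n m
    have : MulAut.conjNormal (n : G) m = n * m * n⁻¹ := by ext; simp
    simp [this]
  let ι : ↥N →* ↥H :=
    { toFun := fun n => ⟨((n : G), R n), hRmem n⟩
      map_one' := by ext <;> simp
      map_mul' := by intro a b; ext <;> simp }
  let K : Subgroup ↥H := ι.range
  have hK : ∀ x : ↥H, x ∈ K ↔ ∃ n, ι n = x := fun x => Iff.rfl
  have hι : ∀ n, ((ι n : ↥H) : G × U) = ((n : G), R n) := fun n => rfl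
  have : K.Normal := by
    constructor
    rintro _ ⟨n, rfl⟩ x
    refine ⟨MulAut.conjNormal (x : G × U).1 n, ?_⟩
    have hx := x.2 n
    apply Subtype.ext
    apply Prod.ext
    · simp [hι]
    · simp only [hι, Subgroup.coe_mul, Prod.snd_mul, Subgroup.coe_inv, Prod.snd_inv]
      rw [hx]; simp
  let π₀ : ↥H →* ∀ i, S i :=
    (e.toMonoidHom.comp (QuotientGroup.mk' N)).comp ((MonoidHom.fst G U).comp H.subtype)
  have hπ₀ : ∀ x, π₀ x = e (QuotientGroup.mk (x : G × U).1) := fun x => rfl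
  have hπK : K ≤ π₀.ker := by
    rintro _ ⟨n, rfl⟩
    rw [MonoidHom.mem_ker, hπ₀, hι]
    have : (QuotientGroup.mk (n : G) : G ⧸ N) = 1 := by
      rw [QuotientGroup.eq_one_iff]; exact n.2
    rw [this, map_one]
  let π : ↥H ⧸ K →* ∀ i, S i := QuotientGroup.lift K π₀ hπK
  have hπ : ∀ x : ↥H, π (QuotientGroup.mk x) = e (QuotientGroup.mk (x : G × U).1) := fun x => rfl
  let z₀ : ℂˣ →* ↥H :=
    { toFun := fun c => ⟨(1, ζ c), fun n => by simp [hcen]⟩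
      map_one' := by ext <;> simp
      map_mul' := by intro a b; ext <;> simp }
  have hz₀ : ∀ c, ((z₀ c : ↥H) : G × U) = (1, ζ c) := fun n => rfl
  let z : ℂˣ →* ↥H ⧸ K := (QuotientGroup.mk' K).comp z₀
  have hz : ∀ c, z c = QuotientGroup.mk (z₀ c) := fun c => rfl
  let δ₀ : ↥H →* ℂˣ := δ.comp ((MonoidHom.snd G U).comp H.subtype)
  have hδ₀ : ∀ x, δ₀ x = δ (x : G × U).2 := fun x => rfl
  have hδK : K ≤ δ₀.ker := by
    rintro _ ⟨n, rfl⟩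
    rw [MonoidHom.mem_ker, hδ₀, hι, hδR]
  let Δ : ↥H ⧸ K →* ℂˣ := QuotientGroup.lift K δ₀ hδK
  have hΔ : ∀ x : ↥H, Δ (QuotientGroup.mk x) = δ (x : G × U).2 := fun x => rfl
  obtain ⟨s, hs⟩ := exists_splitting hsimple hnonab π (by
      intro q
      obtain ⟨q', rfl⟩ := e.surjective q
      obtain ⟨g, rfl⟩ := QuotientGroup.mk_surjective q'
      obtain ⟨T, hT⟩ := hconj g
      exact ⟨QuotientGroup.mk ⟨(g, T), hT⟩, rfl⟩)
    z (by
      rw [injective_iff_map_eq_one]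
      intro c hc
      rw [hz, QuotientGroup.eq_one_iff, hK] at hc
      obtain ⟨n, hn⟩ := hc
      have hn' := congrArg Subtype.val hn
      rw [hι, hz₀, Prod.mk.injEq] at hn'
      obtain ⟨h1, h2⟩ := hn'
      have : n = 1 := Subtype.ext h1
      rw [this, map_one] at h2
      apply hζ
      rw [← h2, map_one])
    (by
      intro c x
      obtain ⟨x, rfl⟩ := QuotientGroup.mk_surjective x
      rw [hz, ← QuotientGroup.mk_mul, ← QuotientGroup.mk_mul]
      congr 1
      apply Subtype.ext
      apply Prod.ext <;> simp [hz₀, hcen])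
    (by
      intro x hx
      obtain ⟨⟨⟨g, T⟩, hgT⟩, rfl⟩ := QuotientGroup.mk_surjective x
      rw [hπ, map_eq_one_iff e e.injective, QuotientGroup.eq_one_iff] at hx
      change g ∈ N at hx
      rw [hH] at hgT
      have hinv : ∀ m : ↥N, T * (R ⟨g, hx⟩)⁻¹ * R m = R m * (T * (R ⟨g, hx⟩)⁻¹) := by
        intro m
        have h1 := hgT (⟨g, hx⟩⁻¹ * m * ⟨g, hx⟩)
        have h2 : MulAut.conjNormal g (⟨g, hx⟩⁻¹ * m * ⟨g, hx⟩ : ↥N) = m := by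
          ext; simp [mul_assoc]
        rw [h2] at h1
        simp only [map_mul, map_inv] at h1
        rw [← mul_assoc (R m), ← h1]
        group
      obtain ⟨c, hc⟩ := hsch _ hinv
      refine ⟨c, ?_⟩
      rw [hz, QuotientGroup.eq, hK]
      refine ⟨⟨g, hx⟩, ?_⟩
      apply Subtype.ext
      apply Prod.ext
      · simp [hι, hz₀]
      · simp only [hι, hz₀, Subgroup.coe_mul, Subgroup.coe_inv, Prod.snd_mul, Prod.snd_inv]
        rw [eq_inv_mul_iff_mul_eq, hc]; simp)
    (by
      intro c
      rw [hz, hπ, hz₀, QuotientGroup.mk_one, map_one])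
    Δ d (by intro c; rw [hz, hΔ, hz₀]; exact hδ c) hd
  -- uniqueness of the lift of `g`
  have huniq : ∀ (x y : ↥H), (x : G × U).1 = (y : G × U).1 →
      (QuotientGroup.mk x : ↥H ⧸ K) = QuotientGroup.mk y → x = y := by
    intro x y h1 h2
    rw [QuotientGroup.eq, hK] at h2
    obtain ⟨n, hn⟩ := h2
    have h3 := congrArg (fun t : ↥H => (t : G × U).1) hn
    simp only [hι, Subgroup.coe_mul, Subgroup.coe_inv, Prod.fst_mul, Prod.fst_inv, h1,
      inv_mul_cancel] at h3
    have : n = 1 := Subtype.ext h3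
    rw [this, map_one, eq_inv_mul_iff_mul_eq, mul_one] at hn
    exact hn
  have hex : ∀ g : G, ∃ x : ↥H, (x : G × U).1 = g ∧
      (QuotientGroup.mk x : ↥H ⧸ K) = s (e (QuotientGroup.mk g)) := by
    intro g
    obtain ⟨x, hx⟩ := QuotientGroup.mk_surjective (s (e (QuotientGroup.mk g)))
    have h1 := hs (e (QuotientGroup.mk g))
    rw [← hx, hπ, e.injective.eq_iff, QuotientGroup.eq] at h1
    refine ⟨x * ι ⟨_, h1⟩, ?_, ?_⟩
    · simp [hι]
    · rw [← hx, QuotientGroup.eq, hK]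
      refine ⟨⟨_, h1⟩⁻¹, ?_⟩
      rw [map_inv]; group
  choose x hx1 hx2 using hex
  have hmul : ∀ a b, x (a * b) = x a * x b := by
    intro a b
    apply huniq
    · simp [hx1]
    · simp [hx2]
  refine ⟨MonoidHom.mk' (fun g => (x g : G × U).2) (fun a b => by simp [hmul]), fun n => ?_⟩
  have : x n = ι n := by
    apply huniq
    · rw [hx1, hι]
    · rw [hx2]
      have h1 : (QuotientGroup.mk (n : G) : G ⧸ N) = 1 := by
        rw [QuotientGroup.eq_one_iff]; exact n.2
      rw [h1, map_one, map_one, eq_comm, QuotientGroup.eq_one_iff, hK]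
      exact ⟨n, rfl⟩
  change (x n : G × U).2 = _
  rw [this, hι]

lemma exists_conjugator {G : Type} [Group G] [Finite G] (N : Subgroup G) [N.Normal]
    (φ : FDRep ℂ ↥N) (hφ : Simple φ)
    (hinv : ∀ g : G, ∀ n : ↥N, ∀ h : g⁻¹ * ↑n * g ∈ N,
      φ.character ⟨g⁻¹ * ↑n * g, h⟩ = φ.character n) (g : G) :
    ∃ T : (φ →ₗ[ℂ] φ)ˣ, ∀ n : ↥N, (T : φ →ₗ[ℂ] φ) * φ.ρ n = φ.ρ (MulAut.conjNormal g n) * T := by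
  classical
  have := Fintype.ofFinite ↥N
  have := invertibleOfNonzero (NeZero.ne (Nat.card ↥N : ℂ))
  let σ : ↥N →* φ →ₗ[ℂ] φ := φ.ρ.comp (MulAut.conjNormal g).toMonoidHom
  let W : FDRep ℂ ↥N := FDRep.of σ
  have hWρ : W.ρ = σ := rfl
  have hW : ∀ n, W.character n = φ.character n := by
    intro n
    have h0 : g⁻¹ * ↑(MulAut.conjNormal g n) * g = (n : G) := by simp [mul_assoc]
    have h1 := hinv g (MulAut.conjNormal g n) (by rw [h0]; exact n.2)
    have h2 : (⟨g⁻¹ * ↑(MulAut.conjNormal g n) * g, by rw [h0]; exact n.2⟩ : ↥N) = n :=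
      Subtype.ext h0
    rw [h2] at h1
    exact h1.symm
  have : Simple W := by
    rw [FDRep.simple_iff_char_is_norm_one] at hφ ⊢
    simpa only [hW] using hφ
  have h1 := FDRep.char_orthonormal φ φ
  have h2 := FDRep.char_orthonormal φ W
  simp only [hW] at h2
  rw [h1, if_pos ⟨Iso.refl _⟩] at h2
  have h3 : Nonempty (φ ≅ W) := by
    by_contra hc
    rw [if_neg hc] at h2
    simp at h2
  obtain ⟨i⟩ := h3
  obtain ⟨τ, hτ⟩ : ∃ τ : φ ≃ₗ[ℂ] φ, ∀ n, σ n = τ.conj (φ.ρ n) :=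
    ⟨FDRep.isoToLinearEquiv (V := φ) (W := W) i, fun n => FDRep.Iso.conj_ρ (V := φ) (W := W) i n⟩
  refine ⟨LinearMap.GeneralLinearGroup.ofLinearEquiv τ, fun n => ?_⟩
  have h4 : φ.ρ (MulAut.conjNormal g n) = τ.conj (φ.ρ n) := hτ n
  rw [h4]
  ext v
  change τ (φ.ρ n v) = τ.conj (φ.ρ n) (τ v)
  simp [LinearEquiv.conj_apply]

/-- A `G`-invariant irreducible character `φ` of `N ⊴ G` with `φ(1)·o(φ)` a power of `p`
extends, with the same determinantal order, to `G` when `G/N` is a direct product of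
non-abelian simple groups whose Schur multipliers have order prime to `p`. -/
theorem extends_of_product_of_simples {G : Type} [Group G] [Finite G]
    (N : Subgroup G) [N.Normal] (k : ℕ) (S : Fin k → Type) [∀ i, Group (S i)]
    [∀ i, Finite (S i)] (hsimple : ∀ i, IsSimpleGroup (S i))
    (hnonab : ∀ i, ¬∀ a b : S i, a * b = b * a)
    (hiso : Nonempty ((G ⧸ N) ≃* ∀ i, S i))
    (p : ℕ) (hp : p.Prime) (hpM : ∀ i, ¬ p ∣ Nat.card (schurMultiplier (S i)))
    (φ : FDRep ℂ ↥N) (hφ : Simple φ)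
    (hinv : ∀ g : G, ∀ n : ↥N, ∀ h : g⁻¹ * ↑n * g ∈ N,
      φ.character ⟨g⁻¹ * ↑n * g, h⟩ = φ.character n)
    (hpow : ∃ m : ℕ, Module.finrank ℂ φ * charDetOrder φ = p ^ m) :
    ∃ χ : FDRep ℂ G, Simple χ ∧ (∀ n : ↥N, χ.character ↑n = φ.character n) ∧
      charDetOrder χ = charDetOrder φ := by
  obtain ⟨e⟩ := hiso
  obtain ⟨m, hm⟩ := hpow
  obtain ⟨hnt, hsch⟩ := (fdrep_simple_iff φ).1 hφ
  set o := charDetOrder φ with ho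
  set d := Module.finrank ℂ φ with hd
  let R : ↥N →* (φ →ₗ[ℂ] φ)ˣ := φ.ρ.toHomUnits
  have hR : ∀ n, (R n : φ →ₗ[ℂ] φ) = φ.ρ n := fun n => rfl
  let ζ : ℂˣ →* (φ →ₗ[ℂ] φ)ˣ := Units.map (algebraMap ℂ (φ →ₗ[ℂ] φ)).toMonoidHom
  have hζ : ∀ c : ℂˣ, (ζ c : φ →ₗ[ℂ] φ) = (c : ℂ) • 1 := by
    intro c
    exact Algebra.algebraMap_eq_smul_one (c : ℂ)
  let δ : (φ →ₗ[ℂ] φ)ˣ →* ℂˣ := (powMonoidHom o).comp (Units.map LinearMap.det)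
  have hδ : ∀ u, ((δ u : ℂˣ) : ℂ) = LinearMap.det (u : φ →ₗ[ℂ] φ) ^ o := fun u => rfl
  have hpo : ((LinearMap.det : (φ →ₗ[ℂ] φ) →* ℂ).comp φ.ρ) ^ o = 1 := pow_orderOf_eq_one _
  obtain ⟨T, hT⟩ := exists_extension_hom N hsimple hnonab e R ζ
    (by
      intro a b hab
      have := congrArg Units.val hab
      rw [hζ, hζ] at this
      exact Units.ext (smul_left_injective ℂ (one_ne_zero (α := φ →ₗ[ℂ] φ)) this))
    (by
      intro c u
      apply Units.ext
      rw [Units.val_mul, Units.val_mul, hζ]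
      simp)
    (by
      intro g
      obtain ⟨T, hT⟩ := exists_conjugator N φ hφ hinv g
      exact ⟨T, fun n => Units.ext (hT n)⟩)
    (by
      intro T hT
      obtain ⟨c, hc⟩ := hsch T (fun n => congrArg Units.val (hT n))
      have hc0 : c ≠ 0 := by
        rintro rfl
        rw [zero_smul] at hc
        exact T.ne_zero hc
      refine ⟨Units.mk0 c hc0, Units.ext ?_⟩
      rw [hζ, hc, Units.val_mk0])
    δ (p ^ m)
    (by
      intro n
      apply Units.ext
      rw [hδ, hR]
      exact DFunLike.congr_fun hpo n)
    (by
      intro c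
      apply Units.ext
      rw [hδ, hζ, LinearMap.det_smul, map_one, mul_one, ← pow_mul, ← hm, Units.val_pow_eq_pow_val])
    (fun i => Nat.Coprime.pow_left m ((Nat.Prime.coprime_iff_not_dvd hp).2 (hpM i)))
  let ρ' : G →* (φ →ₗ[ℂ] φ) := (Units.coeHom _).comp T
  have hρ' : ∀ g, ρ' g = (T g : φ →ₗ[ℂ] φ) := fun g => rfl
  have hρN : ∀ n : ↥N, ρ' n = φ.ρ n := by
    intro n
    rw [hρ', hT, hR]
  let χ : FDRep ℂ G := FDRep.of ρ'
  refine ⟨χ, ?_, ?_, ?_⟩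
  · rw [fdrep_simple_iff]
    refine ⟨hnt, fun A hA => hsch A fun n => ?_⟩
    rw [← hρN]
    exact hA n
  · intro n
    change LinearMap.trace ℂ φ (ρ' n) = LinearMap.trace ℂ φ (φ.ρ n)
    rw [hρN]
  · apply Nat.dvd_antisymm
    · apply orderOf_dvd_of_pow_eq_one
      -- the `o`-th power of the determinant factors through the perfect group `G / N`
      have hker : N ≤ (δ.comp T).ker := by
        intro n hn
        rw [MonoidHom.mem_ker]
        apply Units.ext
        change ((δ (T n) : ℂˣ) : ℂ) = 1
        rw [hδ, hT ⟨n, hn⟩, hR]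
        exact DFunLike.congr_fun hpo ⟨n, hn⟩
      let F : (∀ i, S i) →* ℂˣ := (QuotientGroup.lift N (δ.comp T) hker).comp e.symm.toMonoidHom
      ext g
      have h1 := hom_trivial_of_pi hsimple hnonab F (e (QuotientGroup.mk g))
      have h2 : F (e (QuotientGroup.mk g)) = δ (T g) := by
        change (QuotientGroup.lift N (δ.comp T) hker) (e.symm (e (QuotientGroup.mk g))) = _
        rw [e.symm_apply_apply]
        rfl
      rw [h2] at h1
      have h3 := congrArg Units.val h1
      rw [hδ] at h3
      exact h3
    · apply orderOf_dvd_of_pow_eq_one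
      have h1 : ((LinearMap.det : (χ →ₗ[ℂ] χ) →* ℂ).comp χ.ρ) ^ charDetOrder χ = 1 :=
        pow_orderOf_eq_one _
      ext n
      have h2 := DFunLike.congr_fun h1 (n : G)
      change LinearMap.det (ρ' n) ^ charDetOrder χ = 1 at h2
      rw [hρN] at h2
      exact h2
end

section
/- Let G be a finite group, p an odd prime, and M ⊴ G a normal subgroup such that for every subgroup H with M ≤ H ≤ G and every non-abelian composition factor S of H/M, p does not divide |M(S)|. Let φ ∈ Irr(M), and suppose there exist U ≤ M and τ ∈ Irr(U) such that the induced character τ^M equals φ, and τ(1)·o(τ) is a power of p. Suppose moreover that for every automorphism b of M fixing φ, the pair (U,τ)^b = (U^b, τ^b) is conjugate to (U,τ) by an element of M. Then there exist a subgroup W with U ≤ W ≤ G and a character θ ∈ Irr(W) lying over τ such that: (i) χ := θ^G is irreducible and lies over φ; (ii) θ(1)·o(θ) is a power of p; and (iii) for every automorphism c of G that leaves M invariant and fixes χ, the pair (W,θ)^c is conjugate to (W,θ) by an element of G. -/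
open CategoryTheory

/-- `S` is a composition factor of `X` : some composition series of `X` has a factor
isomorphic to `S`. -/
def IsCompositionFactorOf (S : Type*) (X : Type*) [Group S] [Group X] : Prop :=
  ∃ (n : ℕ) (c : ℕ → Subgroup X),
    c 0 = ⊥ ∧ c n = ⊤ ∧
    (∀ i < n, c i ≤ c (i + 1) ∧ ((c i).subgroupOf (c (i + 1))).Normal ∧
      c i ≠ c (i + 1) ∧
      ∀ J : Subgroup X, c i ≤ J → J ≤ c (i + 1) →
        (J.subgroupOf (c (i + 1))).Normal → J = c i ∨ J = c (i + 1)) ∧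
    ∃ i < n, ∃ ψ : ↥(c (i + 1)) →* S, Function.Surjective ψ ∧
      ψ.ker = (c i).subgroupOf (c (i + 1))

open scoped Classical in
/-- The character of a representation of the subgroup `U`, extended by zero to a class
function on the whole group. -/
noncomputable def extChar {G : Type} [Group G] (U : Subgroup G) (T : FDRep ℂ ↥U) :
    G → ℂ :=
  fun x => if h : x ∈ U then T.character ⟨x, h⟩ else 0

open scoped Classical in
/-- The character of `H` induced from a function `f` vanishing off the subgroup `U ≤ H`,
extended by zero: `(indChar U H f) x = |U|⁻¹ ∑ g ∈ H, f (g⁻¹ x g)`. -/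
noncomputable def indChar {G : Type} [Group G] [Fintype G] (U H : Subgroup G)
    (f : G → ℂ) : G → ℂ :=
  fun x => (Nat.card U : ℂ)⁻¹ * ∑ g : ↥H, f ((g : G)⁻¹ * x * g)

/-- The character of `G` induced from a function `f` vanishing off the subgroup `W` :
`(indCharTop W f) x = |W|⁻¹ ∑ g ∈ G, f (g⁻¹ x g)`. -/
noncomputable def indCharTop {G : Type} [Group G] [Fintype G] (W : Subgroup G)
    (f : G → ℂ) : G → ℂ :=
  fun x => (Nat.card W : ℂ)⁻¹ * ∑ g : G, f (g⁻¹ * x * g)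

open scoped Classical in
/-- The usual inner product of class functions, computed on the subgroup `H`. -/
noncomputable def charInner {G : Type} [Group G] [Fintype G] (H : Subgroup G)
    (f g : G → ℂ) : ℂ :=
  (Nat.card H : ℂ)⁻¹ * ∑ x : ↥H, f x * (starRingEnd ℂ) (g x)


section PartA
open Representation

/-- Bilinear inner product. -/
noncomputable def bip {H : Type} [Group H] [Fintype H] (f g : H → ℂ) : ℂ :=
  (Nat.card H : ℂ)⁻¹ * ∑ x : H, f x * g x⁻¹

theorem rep_induction {H : Type} [Group H] [Fintype H]
    (P : ∀ (V : Type) [AddCommGroup V] [Module ℂ V] [FiniteDimensional ℂ V],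
      Representation ℂ H V → Prop)
    (h0 : ∀ (V : Type) [AddCommGroup V] [Module ℂ V] [FiniteDimensional ℂ V]
      (ρ : Representation ℂ H V), Module.finrank ℂ V = 0 → P V ρ)
    (h1 : ∀ (V : Type) [AddCommGroup V] [Module ℂ V] [FiniteDimensional ℂ V]
      (ρ : Representation ℂ H V), IsIrreducible ρ → P V ρ)
    (h2 : ∀ (V : Type) [AddCommGroup V] [Module ℂ V] [FiniteDimensional ℂ V]
      (ρ : Representation ℂ H V) (W W' : Subrepresentation ρ),
      IsCompl W.toSubmodule W'.toSubmodule → P _ W.toRepresentation → P _ W'.toRepresentation →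
      P V ρ)
    (V : Type) [AddCommGroup V] [Module ℂ V] [FiniteDimensional ℂ V]
      (ρ : Representation ℂ H V) : P V ρ := by
  induction hn : Module.finrank ℂ V using Nat.strong_induction_on generalizing V with
  | _ n ih =>
    by_cases hz : Module.finrank ℂ V = 0
    · exact h0 V ρ hz
    by_cases hi : IsIrreducible ρ
    · exact h1 V ρ hi
    have hnt : Nontrivial (Subrepresentation ρ) := by
      refine ⟨⊥, ⊤, fun h => hz ?_⟩
      have : (⊥ : Submodule ℂ V) = ⊤ := congrArg Subrepresentation.toSubmodule h
      rw [← finrank_top ℂ V, ← this, finrank_bot]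
    have : ∃ W : Subrepresentation ρ, W ≠ ⊥ ∧ W ≠ ⊤ := by
      by_contra! hc
      exact hi ⟨fun a => by by_cases h : a = ⊥; exact Or.inl h; exact Or.inr (hc a h)⟩
    obtain ⟨W, hW0, hW1⟩ := this
    have : NeZero (Nat.card H : ℂ) := ⟨by simp⟩
    have hs : IsSemisimpleRepresentation ρ := inferInstance
    obtain ⟨W', hW'⟩ := exists_isCompl W
    have hc : IsCompl W.toSubmodule W'.toSubmodule := by
      constructor
      · rw [disjoint_iff]
        exact congrArg Subrepresentation.toSubmodule hW'.inf_eq_bot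
      · rw [codisjoint_iff]
        have := congrArg Subrepresentation.toSubmodule hW'.sup_eq_top
        rwa [Subrepresentation.toSubmodule_sup] at this
    have hsum := Submodule.finrank_add_eq_of_isCompl hc
    have hp : ∀ X : Subrepresentation ρ, X ≠ ⊥ → Module.finrank ℂ X.toSubmodule ≠ 0 := by
      intro X hX h
      apply hX
      apply Subrepresentation.toSubmodule_injective
      exact Submodule.finrank_eq_zero.1 h
    have hW'0 : W' ≠ ⊥ := by
      rintro rfl
      exact hW1 (by simpa using hW'.sup_eq_top)
    have e1 := hp W hW0
    have e2 := hp W' hW'0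
    exact h2 V ρ W W' hc (ih _ (by omega) _ _ rfl) (ih _ (by omega) _ _ rfl)

theorem compl_conj {H : Type} [Group H]
    (V : Type) [AddCommGroup V] [Module ℂ V]
      (ρ : Representation ℂ H V) (W W' : Subrepresentation ρ)
      (h : IsCompl W.toSubmodule W'.toSubmodule) (g : H) :
      ρ g = (Submodule.prodEquivOfIsCompl _ _ h).conj
        ((W.toRepresentation g).prodMap (W'.toRepresentation g)) := by
  ext v
  obtain ⟨⟨w, w'⟩, rfl⟩ := (Submodule.prodEquivOfIsCompl _ _ h).surjective v
  simp [LinearEquiv.conj_apply, Subrepresentation.toRepresentation]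

theorem compl_char {H : Type} [Group H]
    (V : Type) [AddCommGroup V] [Module ℂ V] [FiniteDimensional ℂ V]
      (ρ : Representation ℂ H V) (W W' : Subrepresentation ρ)
      (h : IsCompl W.toSubmodule W'.toSubmodule) (g : H) :
      ρ.character g = W.toRepresentation.character g + W'.toRepresentation.character g := by
  simp only [character]
  rw [compl_conj V ρ W W' h g, LinearMap.trace_conj', LinearMap.trace_prodMap']

theorem compl_det {H : Type} [Group H]
    (V : Type) [AddCommGroup V] [Module ℂ V] [FiniteDimensional ℂ V]
      (ρ : Representation ℂ H V) (W W' : Subrepresentation ρ)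
      (h : IsCompl W.toSubmodule W'.toSubmodule) (g : H) :
      LinearMap.det (ρ g) = LinearMap.det (W.toRepresentation g) *
        LinearMap.det (W'.toRepresentation g) := by
  rw [compl_conj V ρ W W' h g, LinearEquiv.conj_apply, LinearMap.comp_assoc, LinearMap.det_conj, LinearMap.det_prodMap]

theorem simple_iff_bip {H : Type} [Group H] [Fintype H] (V : FDRep ℂ H) :
    Simple V ↔ bip V.character V.character = 1 := by
  rw [FDRep.simple_iff_char_is_norm_one, bip, inv_mul_eq_one₀ (by simp)]
  exact eq_comm

theorem irred_bip {H : Type} [Group H] [Fintype H]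
    (V : Type) [AddCommGroup V] [Module ℂ V] [FiniteDimensional ℂ V]
      (ρ : Representation ℂ H V) (h : IsIrreducible ρ) : bip ρ.character ρ.character = 1 := by
  have := invertibleOfNonzero (NeZero.ne (Nat.card H : ℂ))
  have := char_orthonormal ρ ρ
  rw [if_pos ⟨Representation.Equiv.refl _⟩] at this
  exact_mod_cast this

theorem simple_of_irred {H : Type} [Group H] [Fintype H]
    (V : Type) [AddCommGroup V] [Module ℂ V] [FiniteDimensional ℂ V]
      (ρ : Representation ℂ H V) (h : IsIrreducible ρ) : Simple (FDRep.of ρ) := by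
  rw [simple_iff_bip]
  exact irred_bip V ρ h

/-- determinant of a representation -/
noncomputable def rdet {H : Type} [Group H] {V : Type} [AddCommGroup V] [Module ℂ V]
    (ρ : Representation ℂ H V) : H →* ℂ := (LinearMap.det : (V →ₗ[ℂ] V) →* ℂ).comp ρ

theorem exists_decomp {H : Type} [Group H] [Fintype H]
    (V : Type) [AddCommGroup V] [Module ℂ V] [FiniteDimensional ℂ V]
      (ρ : Representation ℂ H V) :
    ∃ s : List (FDRep ℂ H), (∀ W ∈ s, Simple W ∧ IsIrreducible W.ρ) ∧
      (∀ g, ρ.character g = (s.map fun W => W.character g).sum) ∧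
      (∀ g, rdet ρ g = (s.map fun W => rdet W.ρ g).prod) := by
  refine rep_induction (P := fun V _ _ _ ρ => ∃ s : List (FDRep ℂ H), (∀ W ∈ s, Simple W ∧ IsIrreducible W.ρ) ∧
      (∀ g, ρ.character g = (s.map fun W => W.character g).sum) ∧
      (∀ g, rdet ρ g = (s.map fun W => rdet W.ρ g).prod)) ?_ ?_ ?_ V ρ
  · intro V _ _ _ ρ h
    refine ⟨[], by simp, fun g => ?_, fun g => ?_⟩
    · have : Subsingleton V := Module.finrank_zero_iff.1 h
      have : ρ g = 0 := Subsingleton.elim _ _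
      simp [character, this]
    · simp [rdet, LinearMap.det_eq_one_of_finrank_eq_zero h]
  · intro V _ _ _ ρ h
    exact ⟨[FDRep.of ρ], by simpa using ⟨simple_of_irred V ρ h, h⟩, fun g => by simp; rfl,
      fun g => by simp⟩
  · intro V _ _ _ ρ W W' hc h1 h2
    obtain ⟨s, hs, hs1, hs2⟩ := h1
    obtain ⟨t, ht, ht1, ht2⟩ := h2
    refine ⟨s ++ t, ?_, fun g => ?_, fun g => ?_⟩
    · intro W hW
      rcases List.mem_append.1 hW with h | h
      · exact hs W h
      · exact ht W h
    · rw [compl_char V ρ W W' hc, hs1, ht1]; simp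
    · rw [List.map_append, List.prod_append, ← hs2, ← ht2]
      exact compl_det V ρ W W' hc g
end PartA


section PartB
open Representation

theorem bip_comm {H : Type} [Group H] [Fintype H] (f g : H → ℂ) : bip f g = bip g f := by
  simp only [bip]
  congr 1
  rw [← Equiv.sum_comp (Equiv.inv H)]
  simp [mul_comm]

theorem bip_sum_left {H : Type} [Group H] [Fintype H] {ι : Type*} (s : Finset ι) (f : ι → H → ℂ)
    (g : H → ℂ) : bip (fun x => ∑ i ∈ s, f i x) g = ∑ i ∈ s, bip (f i) g := by
  simp only [bip, Finset.sum_mul]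
  rw [Finset.sum_comm, Finset.mul_sum]

theorem bip_smul_left {H : Type} [Group H] [Fintype H] (c : ℂ) (f : H → ℂ)
    (g : H → ℂ) : bip (fun x => c * f x) g = c * bip f g := by
  simp only [bip, mul_assoc, ← Finset.mul_sum]
  ring

theorem bip_sub_left {H : Type} [Group H] [Fintype H] (f f' : H → ℂ)
    (g : H → ℂ) : bip (fun x => f x - f' x) g = bip f g - bip f' g := by
  simp only [bip, sub_mul, Finset.sum_sub_distrib]
  ring

theorem bip_add_left {H : Type} [Group H] [Fintype H] (f f' : H → ℂ)
    (g : H → ℂ) : bip (fun x => f x + f' x) g = bip f g + bip f' g := by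
  simp only [bip, add_mul, Finset.sum_add_distrib]
  ring

theorem bip_list_left {H : Type} [Group H] [Fintype H] {ι : Type*} (s : List ι) (f : ι → H → ℂ)
    (g : H → ℂ) : bip (fun x => (s.map fun i => f i x).sum) g
      = (s.map fun i => bip (f i) g).sum := by
  induction s with
  | nil => simp [bip]
  | cons a s ih =>
    simp only [List.map_cons, List.sum_cons]
    rw [← ih, bip_add_left]

theorem bip_eq_finrank {H : Type} [Group H] [Fintype H]
    {V : Type} [AddCommGroup V] [Module ℂ V] [FiniteDimensional ℂ V]
    {W : Type} [AddCommGroup W] [Module ℂ W] [FiniteDimensional ℂ W]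
      (ρ : Representation ℂ H V) (σ : Representation ℂ H W) :
      bip σ.character ρ.character = Module.finrank ℂ (IntertwiningMap ρ σ) := by
  have := invertibleOfNonzero (NeZero.ne (Nat.card H : ℂ))
  exact card_inv_mul_sum_char_mul_char_eq_finrank ρ σ

theorem equiv_of_char_eq {H : Type} [Group H] [Fintype H]
    {V : Type} [AddCommGroup V] [Module ℂ V] [FiniteDimensional ℂ V]
    {W : Type} [AddCommGroup W] [Module ℂ W] [FiniteDimensional ℂ W]
      (ρ : Representation ℂ H V) (σ : Representation ℂ H W) (hρ : IsIrreducible ρ)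
      (h : ρ.character = σ.character) : Nonempty (Representation.Equiv ρ σ) := by
  have h1 := bip_eq_finrank ρ σ
  rw [← h, irred_bip V ρ hρ] at h1
  have h2 : Module.finrank ℂ (IntertwiningMap ρ σ) = 1 := by exact_mod_cast h1.symm
  obtain ⟨f, hf, -⟩ := finrank_eq_one_iff'.1 h2
  have hinj := (IsIrreducible.injective_or_eq_zero f).resolve_right hf
  have hd : Module.finrank ℂ V = Module.finrank ℂ W := by
    have := congrFun h 1
    simpa using this
  have hb : Function.Bijective f.toLinearMap :=
    ⟨hinj, (LinearMap.injective_iff_surjective_of_finrank_eq_finrank hd).1 hinj⟩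
  exact ⟨Representation.Equiv.mk (LinearEquiv.ofBijective f.toLinearMap hb) f.2⟩

theorem irred_of_equiv {H : Type} [Group H]
    {V : Type} [AddCommGroup V] [Module ℂ V]
    {W : Type} [AddCommGroup W] [Module ℂ W]
      (ρ : Representation ℂ H V) (σ : Representation ℂ H W) (hρ : IsIrreducible ρ)
      (e : Representation.Equiv ρ σ) : IsIrreducible σ := by
  let F : Subrepresentation σ → Subrepresentation ρ := fun X =>
    ⟨X.toSubmodule.comap e.toLinearEquiv.toLinearMap, fun g v hv => by
      have : e.toLinearEquiv.toLinearMap (ρ g v) = σ g (e.toLinearEquiv.toLinearMap v) :=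
        congrArg (fun t => t v) (e.1.2 g)
      rw [Submodule.mem_comap, this]
      exact X.apply_mem_toSubmodule g hv⟩
  have hF : Function.Injective F := by
    intro X Y h
    apply Subrepresentation.toSubmodule_injective
    have := congrArg Subrepresentation.toSubmodule h
    exact Submodule.comap_injective_of_surjective e.toLinearEquiv.surjective this
  have hF0 : F ⊥ = ⊥ := by
    apply Subrepresentation.toSubmodule_injective
    exact LinearMap.ker_eq_bot.2 e.toLinearEquiv.injective
  have hF1 : F ⊤ = ⊤ := by
    apply Subrepresentation.toSubmodule_injective
    exact Submodule.comap_top _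
  refine { exists_pair_ne := ⟨⊥, ⊤, fun h => ?_⟩, eq_bot_or_eq_top := fun X => ?_ }
  · have := congrArg F h
    rw [hF0, hF1] at this
    exact bot_ne_top this
  · rcases eq_bot_or_eq_top (F X) with h | h
    · exact Or.inl (hF (h.trans hF0.symm))
    · exact Or.inr (hF (h.trans hF1.symm))

theorem bip_nat {H : Type} [Group H] [Fintype H] (V W : FDRep ℂ H) :
    ∃ n : ℕ, bip V.character W.character = n := ⟨_, bip_eq_finrank W.ρ V.ρ⟩

theorem irred_of_bip {H : Type} [Group H] [Fintype H]
    {V : Type} [AddCommGroup V] [Module ℂ V] [FiniteDimensional ℂ V]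
      (ρ : Representation ℂ H V) (h : bip ρ.character ρ.character = 1) : IsIrreducible ρ := by
  obtain ⟨s, hs, hc, -⟩ := exists_decomp V ρ
  have key : ∃ n : ℕ, bip ρ.character ρ.character = s.length + n := by
    have h1 : ρ.character = fun g => (s.map fun W => W.character g).sum := funext hc
    have h2 : ∀ W ∈ s, ∃ n : ℕ, bip W.character ρ.character = 1 + n := by
      intro W hW
      rw [bip_comm, h1, bip_list_left (f := fun W : FDRep ℂ H => W.character)]
      obtain ⟨t, u, rfl⟩ := List.append_of_mem hW
      have : ∀ t : List (FDRep ℂ H), ∃ n : ℕ, (t.map fun i => bip i.character W.character).sum = n := by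
        intro t
        induction t with
        | nil => exact ⟨0, by simp⟩
        | cons a t ih =>
          obtain ⟨n, hn⟩ := ih
          obtain ⟨m, hm⟩ := bip_nat a W
          exact ⟨m + n, by simp [hn, hm]⟩
      obtain ⟨a, ha⟩ := this t
      obtain ⟨b, hb⟩ := this u
      refine ⟨a + b, ?_⟩
      simp only [List.map_append, List.map_cons, List.sum_append, List.sum_cons]
      rw [ha, hb, (simple_iff_bip W).1 (hs W hW).1]
      push_cast; ring
    have h3 : bip ρ.character ρ.character = (s.map fun W => bip W.character ρ.character).sum := by
      conv_lhs => rw [h1]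
      rw [bip_list_left (f := fun W : FDRep ℂ H => W.character), ← h1]
    rw [h3]
    clear hs hc h1 h3
    induction s with
    | nil => exact ⟨0, by simp⟩
    | cons a t ih =>
      obtain ⟨n, hn⟩ := ih (fun W hW => h2 W (List.mem_cons_of_mem _ hW))
      obtain ⟨m, hm⟩ := h2 a List.mem_cons_self
      exact ⟨m + n, by simp [hn, hm]; ring⟩
  obtain ⟨n, hn⟩ := key
  rw [h] at hn
  have hn' : 1 = s.length + n := by exact_mod_cast hn
  match s, hs, hc with
  | [], _, hc =>
    have : ρ.character = fun _ => 0 := by funext g; simpa using hc g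
    rw [this] at h
    simp [bip] at h
  | [W], hs, hc =>
    have : Representation.character W.ρ = ρ.character := by funext g; rw [hc g]; simp; rfl
    obtain ⟨e⟩ := equiv_of_char_eq W.ρ ρ (hs W (by simp)).2 this
    exact irred_of_equiv _ _ (hs W (by simp)).2 e
  | a :: b :: t, _, _ => simp at hn'; omega

theorem simple_iff_irred {H : Type} [Group H] [Fintype H] (V : FDRep ℂ H) :
    Simple V ↔ IsIrreducible V.ρ :=
  ⟨fun h => irred_of_bip V.ρ ((simple_iff_bip V).1 h), fun h => (simple_iff_bip V).2 (irred_bip _ V.ρ h)⟩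

theorem trace_eq_det_of_finrank_one {V : Type} [AddCommGroup V] [Module ℂ V] [FiniteDimensional ℂ V]
    (h : Module.finrank ℂ V = 1) (f : V →ₗ[ℂ] V) : LinearMap.trace ℂ V f = LinearMap.det f := by
  obtain ⟨c, hc, -⟩ := LinearMap.existsUnique_eq_smul_id_of_finrank_eq_one h f
  rw [hc]
  simp [h]

theorem rdet_pow {H : Type} [Group H] [Fintype H] {V : Type} [AddCommGroup V] [Module ℂ V]
    (ρ : Representation ℂ H V) (g : H) : rdet ρ g ^ Nat.card H = 1 := by
  rw [← map_pow, pow_card_eq_one', map_one]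

theorem rdet_inv {H : Type} [Group H] [Fintype H] {V : Type} [AddCommGroup V] [Module ℂ V]
    (ρ : Representation ℂ H V) (g : H) : rdet ρ g⁻¹ = starRingEnd ℂ (rdet ρ g) := by
  rw [← Complex.inv_eq_conj (Complex.norm_eq_one_of_pow_eq_one (rdet_pow ρ g) (by simp))]
  symm
  apply inv_eq_of_mul_eq_one_right
  rw [← map_mul, mul_inv_cancel, map_one]

theorem char_inv {H : Type} [Group H] [Fintype H] (V : FDRep ℂ H) (g : H) :
    V.character g⁻¹ = starRingEnd ℂ (V.character g) := by
  classical
  let ρ : Representation ℂ (Subgroup.zpowers g) V := V.ρ.comp (Subgroup.zpowers g).subtype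
  obtain ⟨s, hs, hc, -⟩ := exists_decomp V ρ
  let g' : Subgroup.zpowers g := ⟨g, Subgroup.mem_zpowers g⟩
  have e1 : V.character g = ρ.character g' := rfl
  have e2 : V.character g⁻¹ = ρ.character g'⁻¹ := rfl
  rw [e1, e2, hc, hc]
  clear hc
  have key : ∀ W ∈ s, W.character g'⁻¹ = starRingEnd ℂ (W.character g') := by
    intro W hW
    have := (hs W hW).2
    have : IsMulCommutative (Subgroup.zpowers g) := inferInstance
    have h1 := IsIrreducible.finrank_eq_one_of_isMulCommutative W.ρ
    have h2 : ∀ x, W.character x = rdet W.ρ x := fun x => trace_eq_det_of_finrank_one h1 _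
    rw [h2, h2, rdet_inv]
  clear hs
  induction s with
  | nil => simp
  | cons a t ih =>
    simp only [List.map_cons, List.sum_cons, map_add]
    rw [ih (fun W hW => key W (List.mem_cons_of_mem _ hW)), key a List.mem_cons_self]

theorem schur_scalar {H : Type} [Group H]
    {V : Type} [AddCommGroup V] [Module ℂ V] [FiniteDimensional ℂ V]
      (ρ : Representation ℂ H V) (hρ : IsIrreducible ρ) (T : V →ₗ[ℂ] V)
      (hT : ∀ g, T ∘ₗ ρ g = ρ g ∘ₗ T) : ∃ c : ℂ, T = c • LinearMap.id := by
  let f : IntertwiningMap ρ ρ := ⟨T, hT⟩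
  obtain ⟨c, hc⟩ := (IsIrreducible.algebraMap_intertwiningMap_bijective_of_isAlgClosed (ρ := ρ)).2 f
  refine ⟨c, ?_⟩
  have : f = c • (1 : IntertwiningMap ρ ρ) := by rw [← hc, Algebra.algebraMap_eq_smul_one]
  have h2 := congrArg IntertwiningMap.toLinearMap this
  exact h2

theorem complete_aux {H : Type} [Group H] [Fintype H] (f : H → ℂ)
    (hf : ∀ g x, f (g * x * g⁻¹) = f x)
    (h : ∀ V : FDRep ℂ H, Simple V → bip f V.character = 0)
    (V : Type) [AddCommGroup V] [Module ℂ V] [FiniteDimensional ℂ V] (ρ : Representation ℂ H V) :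
    ∀ v, ∑ x : H, f x • ρ x⁻¹ v = 0 := by
  refine rep_induction (P := fun V _ _ _ ρ => ∀ v, ∑ x : H, f x • ρ x⁻¹ v = 0) ?_ ?_ ?_ V ρ
  · intro V _ _ _ ρ h v
    have : Subsingleton V := Module.finrank_zero_iff.1 h
    exact Subsingleton.elim _ _
  · intro V _ _ _ ρ hρ v
    let T : V →ₗ[ℂ] V := ∑ x : H, f x • ρ x⁻¹
    obtain ⟨c, hc⟩ := schur_scalar ρ hρ T (fun g => by
      show T * ρ g = ρ g * T
      simp only [T, Finset.sum_mul, Finset.mul_sum, smul_mul_assoc, mul_smul_comm, ← map_mul]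
      rw [← Equiv.sum_comp (MulAut.conj g).toEquiv]
      refine Finset.sum_congr rfl fun x _ => ?_
      have := hf g x
      simp [MulAut.conj_apply, this, mul_assoc] at this ⊢
      rw [this])
    have h1 : LinearMap.trace ℂ V T = Nat.card H * bip f (FDRep.of ρ).character := by
      rw [bip, ← mul_assoc, mul_inv_cancel₀ (by simp), one_mul]
      simp only [T, map_sum, map_smul, smul_eq_mul]
      rfl
    rw [h _ (simple_of_irred V ρ hρ), hc] at h1
    have hpos : Module.finrank ℂ V ≠ 0 := by
      intro h0
      have : Subsingleton V := Module.finrank_zero_iff.1 h0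
      obtain ⟨X, Y, hXY⟩ := hρ.toNontrivial
      exact hXY (Subrepresentation.toSubmodule_injective (Subsingleton.elim _ _))
    simp [hpos] at h1
    have : T v = 0 := by rw [hc, h1]; simp
    simpa [T] using this
  · intro V _ _ _ ρ W W' hc h1 h2 v
    obtain ⟨⟨w, w'⟩, rfl⟩ := (Submodule.prodEquivOfIsCompl _ _ hc).surjective v
    have h1 := congrArg Subtype.val (h1 w)
    have h2 := congrArg Subtype.val (h2 w')
    simp only [Subrepresentation.toRepresentation] at h1 h2
    simp at h1 h2
    simp [Finset.sum_add_distrib, h1, h2]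

theorem complete {H : Type} [Group H] [Fintype H] (f : H → ℂ)
    (hf : ∀ g x, f (g * x * g⁻¹) = f x)
    (h : ∀ V : FDRep ℂ H, Simple V → bip f V.character = 0) : f = 0 := by
  classical
  let ρ : Representation ℂ H (H → ℂ) :=
    { toFun := fun g => LinearMap.funLeft ℂ ℂ (fun x => g⁻¹ * x)
      map_one' := by ext; simp [LinearMap.funLeft]
      map_mul' := by intro a b; ext; simp [LinearMap.funLeft, mul_assoc] }
  have := complete_aux f hf h (H → ℂ) ρ (Pi.single 1 1)
  funext y
  have h2 := congrFun this y⁻¹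
  simp only [Finset.sum_apply, Pi.smul_apply] at h2
  rw [Finset.sum_eq_single y] at h2
  · simpa [ρ, LinearMap.funLeft] using h2
  · intro x _ hx
    have : x * y⁻¹ ≠ 1 := fun h => hx (mul_inv_eq_one.1 h)
    simp [ρ, LinearMap.funLeft, Pi.single_apply, this]
  · simp

end PartB


section PartC
open Representation

variable {Γ : Type} [Group Γ] [Fintype Γ]

/-- The irreducible characters of a subgroup (extended by zero). -/
def irr (H : Subgroup Γ) : Set (Γ → ℂ) := {f | ∃ V : FDRep ℂ H, Simple V ∧ extChar H V = f}

open scoped Classical in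
/-- bilinear inner product on the subgroup `H`. -/
noncomputable def ip (H : Subgroup Γ) (f g : Γ → ℂ) : ℂ :=
  (Nat.card H : ℂ)⁻¹ * ∑ x : H, f x * g (x : Γ)⁻¹

/-- class functions of `H`, extended by zero -/
structure CF (H : Subgroup Γ) (f : Γ → ℂ) : Prop where
  supp : ∀ x, x ∉ H → f x = 0
  conj : ∀ h ∈ H, ∀ x, f (h * x * h⁻¹) = f x

theorem extChar_mem {H : Subgroup Γ} (V : FDRep ℂ H) (x : H) :
    extChar H V (x : Γ) = V.character x := by
  simp [extChar]

theorem ip_eq_bip (H : Subgroup Γ) [Fintype H] (f g : Γ → ℂ) :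
    ip H f g = bip (fun x : H => f x) (fun x : H => g x) := by
  simp only [ip, bip]
  congr 1
  refine Finset.sum_congr (by ext; simp) fun x _ => ?_
  simp

theorem ip_extChar (H : Subgroup Γ) [Fintype H] (V W : FDRep ℂ H) :
    ip H (extChar H V) (extChar H W) = bip V.character W.character := by
  rw [ip_eq_bip]
  simp only [extChar_mem]

theorem ip_comm (H : Subgroup Γ) (f g : Γ → ℂ) : ip H f g = ip H g f := by
  classical
  rw [ip_eq_bip, ip_eq_bip, bip_comm]

theorem ip_sum_left (H : Subgroup Γ) {ι : Type*} (s : Finset ι) (f : ι → Γ → ℂ)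
    (g : Γ → ℂ) : ip H (fun x => ∑ i ∈ s, f i x) g = ∑ i ∈ s, ip H (f i) g := by
  simp only [ip, Finset.sum_mul]
  rw [Finset.sum_comm, Finset.mul_sum]

theorem ip_smul_left (H : Subgroup Γ) (c : ℂ) (f : Γ → ℂ)
    (g : Γ → ℂ) : ip H (fun x => c * f x) g = c * ip H f g := by
  simp only [ip, mul_assoc, ← Finset.mul_sum]
  ring

theorem ip_sub_left (H : Subgroup Γ) (f f' : Γ → ℂ)
    (g : Γ → ℂ) : ip H (fun x => f x - f' x) g = ip H f g - ip H f' g := by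
  simp only [ip, sub_mul, Finset.sum_sub_distrib]
  ring

theorem ip_congr_left (H : Subgroup Γ) {f f' : Γ → ℂ} (g : Γ → ℂ) (h : ∀ x ∈ H, f x = f' x) :
    ip H f g = ip H f' g := by
  simp only [ip]
  congr 1
  exact Finset.sum_congr rfl fun x _ => by rw [h x x.2]

theorem extChar_CF {H : Subgroup Γ} (V : FDRep ℂ H) : CF H (extChar H V) where
  supp := fun x hx => by simp [extChar, hx]
  conj := fun h hh x => by
    by_cases hx : x ∈ H
    · have e : h * x * h⁻¹ = ((⟨h, hh⟩ * ⟨x, hx⟩ * ⟨h, hh⟩⁻¹ : H) : Γ) := rfl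
      rw [e, extChar_mem, FDRep.char_conj, ← extChar_mem]
    · have : h * x * h⁻¹ ∉ H := fun h' => hx (by
        have := H.mul_mem (H.mul_mem (H.inv_mem hh) h') hh
        simpa [mul_assoc] using this)
      simp [extChar, hx, this]

theorem irr_CF {H : Subgroup Γ} {f : Γ → ℂ} (hf : f ∈ irr H) : CF H f := by
  obtain ⟨V, -, rfl⟩ := hf
  exact extChar_CF V

theorem extChar_inj {H : Subgroup Γ} {V W : FDRep ℂ H} (h : extChar H V = extChar H W) :
    V.character = W.character := by
  funext x
  rw [← extChar_mem, h, extChar_mem]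

open scoped Classical in
theorem irr_orth {H : Subgroup Γ} {f g : Γ → ℂ} (hf : f ∈ irr H) (hg : g ∈ irr H) :
    ip H f g = if f = g then 1 else 0 := by
  obtain ⟨V, hV, rfl⟩ := hf
  obtain ⟨W, hW, rfl⟩ := hg
  split_ifs with h
  · rw [h, ip_extChar]
    exact (simple_iff_bip W).1 hW
  · rw [ip_extChar]
    have := invertibleOfNonzero (NeZero.ne (Nat.card H : ℂ))
    have := FDRep.char_orthonormal V W
    rw [if_neg] at this
    · exact_mod_cast this
    · rintro ⟨e⟩
      apply h
      have := FDRep.char_iso e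
      funext x
      simp [extChar, this]

theorem irr_self {H : Subgroup Γ} {f : Γ → ℂ} (hf : f ∈ irr H) : ip H f f = 1 := by
  classical
  simp [irr_orth hf hf]

theorem irr_ne {H : Subgroup Γ} {f g : Γ → ℂ} (hf : f ∈ irr H) (hg : g ∈ irr H)
    (h : ip H f g ≠ 0) : f = g := by
  classical
  by_contra hne
  rw [irr_orth hf hg, if_neg hne] at h
  exact h rfl

theorem irr_finite (H : Subgroup Γ) : (irr H).Finite := by
  classical
  apply LinearIndependent.setFinite (R := ℂ)
  rw [linearIndependent_iff']
  intro s g hs i hi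
  have h1 : ip H (fun x => ∑ j ∈ s, (g j * (j : Γ → ℂ) x)) i = 0 := by
    have : (fun x => ∑ j ∈ s, (g j * (j : Γ → ℂ) x)) = fun x => 0 := by
      funext x
      have := congrFun hs x
      simpa using this
    rw [this]
    simp [ip]
  rw [ip_sum_left H s (fun j x => g j * (j : Γ → ℂ) x)] at h1
  simp only [ip_smul_left, irr_orth (Subtype.prop _) (Subtype.prop _)] at h1
  rw [Finset.sum_eq_single i (fun b _ hb => by rw [if_neg (fun h => hb (Subtype.ext h)), mul_zero])
    (fun h => absurd hi h), if_pos rfl, mul_one] at h1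
  exact h1

/-- finset of irreducible characters. -/
noncomputable def irrF (H : Subgroup Γ) : Finset (Γ → ℂ) := (irr_finite H).toFinset

theorem mem_irrF {H : Subgroup Γ} {f : Γ → ℂ} : f ∈ irrF H ↔ f ∈ irr H := by simp [irrF]

theorem CF_irr_sum {H : Subgroup Γ} (c : (Γ → ℂ) → ℂ) :
    CF H (fun x => ∑ ψ ∈ irrF H, c ψ * ψ x) where
  supp := fun x hx => Finset.sum_eq_zero fun ψ hψ => by
    rw [(irr_CF (mem_irrF.1 hψ)).supp x hx, mul_zero]
  conj := fun h hh x => Finset.sum_congr rfl fun ψ hψ => by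
    rw [(irr_CF (mem_irrF.1 hψ)).conj h hh x]

theorem ip_irr_sum {H : Subgroup Γ} (c : (Γ → ℂ) → ℂ) {ψ : Γ → ℂ} (hψ : ψ ∈ irr H) :
    ip H (fun x => ∑ ψ ∈ irrF H, c ψ * ψ x) ψ = c ψ := by
  classical
  rw [ip_sum_left H (irrF H) (fun ψ x => c ψ * ψ x), Finset.sum_eq_single ψ]
  · rw [ip_smul_left, irr_self hψ, mul_one]
  · intro b hb hne
    rw [ip_smul_left, irr_orth (mem_irrF.1 hb) hψ, if_neg hne, mul_zero]
  · intro h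
    exact absurd (mem_irrF.2 hψ) h

theorem CF_ext {H : Subgroup Γ} {f g : Γ → ℂ} (hf : CF H f) (hg : CF H g)
    (h : ∀ ψ ∈ irr H, ip H f ψ = ip H g ψ) : f = g := by
  classical
  have := complete (fun x : H => f x - g x) (fun h x => by
    have h1 := hf.conj h h.2 x
    have h2 := hg.conj h h.2 x
    simp [h1, h2]) (fun V hV => by
    have h1 := h (extChar H V) ⟨V, hV, rfl⟩
    rw [← sub_eq_zero, ← ip_sub_left, ip_eq_bip] at h1
    simpa only [extChar_mem] using h1)
  funext x
  by_cases hx : x ∈ H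
  · exact sub_eq_zero.1 (congrFun this ⟨x, hx⟩)
  · rw [hf.supp x hx, hg.supp x hx]

theorem CF_expand {H : Subgroup Γ} {f : Γ → ℂ} (hf : CF H f) :
    f = fun x => ∑ ψ ∈ irrF H, ip H f ψ * ψ x :=
  CF_ext hf (CF_irr_sum _) fun ψ hψ => by rw [ip_irr_sum _ hψ]

open scoped Classical in
/-- restriction -/
noncomputable def res (K : Subgroup Γ) (f : Γ → ℂ) : Γ → ℂ := fun x => if x ∈ K then f x else 0

theorem res_CF {H K : Subgroup Γ} (h : K ≤ H) {f : Γ → ℂ} (hf : CF H f) : CF K (res K f) where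
  supp := fun x hx => by simp [res, hx]
  conj := fun k hk x => by
    have : k * x * k⁻¹ ∈ K ↔ x ∈ K := by
      rw [Subgroup.mul_mem_cancel_right _ (K.inv_mem hk), Subgroup.mul_mem_cancel_left _ hk]
    simp only [res]
    by_cases hx : x ∈ K
    · rw [if_pos (this.2 hx), if_pos hx, hf.conj k (h hk)]
    · rw [if_neg (fun h' => hx (this.1 h')), if_neg hx]

theorem ip_res (K : Subgroup Γ) (f g : Γ → ℂ) : ip K (res K f) g = ip K f g :=
  ip_congr_left K g fun x hx => by simp [res, hx]

theorem irr_expand {H K : Subgroup Γ} (h : K ≤ H) {f : Γ → ℂ} (hf : CF H f) {x : Γ} (hx : x ∈ K) :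
    f x = ∑ ψ ∈ irrF K, ip K f ψ * ψ x := by
  have := congrFun (CF_expand (res_CF h hf)) x
  simp only [ip_res] at this
  rw [← this]
  simp [res, hx]

theorem ip_trans {H K L : Subgroup Γ} (h : K ≤ H) (h' : L ≤ K) {f : Γ → ℂ} (hf : CF H f)
    (g : Γ → ℂ) : ip L f g = ∑ ψ ∈ irrF K, ip K f ψ * ip L ψ g := by
  rw [ip_congr_left L g (f' := fun x => ∑ ψ ∈ irrF K, ip K f ψ * ψ x)
    (fun x hx => irr_expand h hf (h' hx)), ip_sum_left L (irrF K) (fun ψ x => ip K f ψ * ψ x)]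
  simp only [ip_smul_left]

/-- restriction of representations along a homomorphism -/
noncomputable def repComp {H K : Type} [Group H] [Group K] (V : FDRep ℂ H) (e : K →* H) :
    FDRep ℂ K := FDRep.of (V := V) (V.ρ.comp e)

theorem repComp_char {H K : Type} [Group H] [Group K] (V : FDRep ℂ H) (e : K →* H) (x : K) :
    (repComp V e).character x = V.character (e x) := rfl

theorem repComp_det {H K : Type} [Group H] [Group K] (V : FDRep ℂ H) (e : K →* H) (x : K) :
    rdet (repComp V e).ρ x = rdet V.ρ (e x) := rfl

theorem repComp_finrank {H K : Type} [Group H] [Group K] (V : FDRep ℂ H) (e : K →* H) :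
    Module.finrank ℂ (repComp V e) = Module.finrank ℂ V := rfl

theorem repComp_simple {H K : Type} [Group H] [Group K] [Fintype H] [Fintype K]
    (V : FDRep ℂ H) (hV : Simple V) (e : K ≃* H) : Simple (repComp V e.toMonoidHom) := by
  rw [simple_iff_bip] at hV ⊢
  rw [← hV, bip, bip, Nat.card_congr e.toEquiv]
  congr 1
  refine Fintype.sum_equiv e.toEquiv _ _ fun x => ?_
  simp [repComp_char]

theorem ip_nat {H K : Subgroup Γ} (h : K ≤ H) {f g : Γ → ℂ} (hf : f ∈ irr H) (hg : g ∈ irr K) :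
    ∃ n : ℕ, ip K f g = n := by
  classical
  obtain ⟨V, hV, rfl⟩ := hf
  obtain ⟨W, hW, rfl⟩ := hg
  obtain ⟨n, hn⟩ := bip_nat (repComp V (Subgroup.inclusion h)) W
  refine ⟨n, ?_⟩
  rw [← hn, ip_eq_bip]
  congr 1
  · funext x
    exact extChar_mem V (Subgroup.inclusion h x)
  · funext x
    exact extChar_mem W x

theorem irr_one {H : Subgroup Γ} {f : Γ → ℂ} (hf : f ∈ irr H) : ∃ n : ℕ, 0 < n ∧ f 1 = n := by
  classical
  obtain ⟨V, hV, rfl⟩ := hf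
  refine ⟨Module.finrank ℂ V, ?_, ?_⟩
  · rw [Nat.pos_iff_ne_zero]
    intro h0
    have h1 := (simple_iff_bip V).1 hV
    have : ∀ x, V.character x = 0 := by
      intro x
      have : Subsingleton V := Module.finrank_zero_iff.1 h0
      have : V.ρ x = 0 := Subsingleton.elim _ _
      simp [FDRep.character, this]
    simp [bip, this] at h1
  · rw [← FDRep.char_one, ← extChar_mem]
    rfl

/-- `p`-power representations -/
def PPV (p : ℕ) {H : Type} [Group H] (V : FDRep ℂ H) : Prop :=
  (∃ i : ℕ, Module.finrank ℂ V = p ^ i) ∧ ∃ j : ℕ, ∀ g, rdet V.ρ g ^ (p ^ j) = 1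

theorem PPV_iff (p : ℕ) (hp : p.Prime) {H : Type} [Group H] (V : FDRep ℂ H) :
    PPV p V ↔ ∃ k : ℕ, Module.finrank ℂ V * charDetOrder V = p ^ k := by
  have e : charDetOrder V = orderOf (rdet V.ρ) := rfl
  constructor
  · rintro ⟨⟨i, hi⟩, j, hj⟩
    have : orderOf (rdet V.ρ) ∣ p ^ j := orderOf_dvd_of_pow_eq_one (by ext g; exact hj g)
    obtain ⟨k, -, hk⟩ := (Nat.dvd_prime_pow hp).1 this
    exact ⟨i + k, by rw [e, hi, hk, pow_add]⟩
  · rintro ⟨k, hk⟩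
    constructor
    · obtain ⟨i, -, hi⟩ := (Nat.dvd_prime_pow hp).1 (Dvd.intro _ hk)
      exact ⟨i, hi⟩
    · obtain ⟨i, -, hi⟩ := (Nat.dvd_prime_pow hp).1 (Dvd.intro_left _ hk)
      refine ⟨i, fun g => ?_⟩
      rw [← hi, e]
      have := pow_orderOf_eq_one (rdet V.ρ)
      exact congrArg (fun f => f g) this

theorem rdet_eq_of_char {H : Type} [Group H] [Fintype H] (V W : FDRep ℂ H) (hV : Simple V)
    (h : V.character = W.character) (g : H) : rdet V.ρ g = rdet W.ρ g := by
  obtain ⟨e⟩ := equiv_of_char_eq V.ρ W.ρ ((simple_iff_irred V).1 hV) h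
  have := Representation.Equiv.conj_apply_self g e
  show LinearMap.det (V.ρ g) = LinearMap.det (W.ρ g)
  rw [← this]
  exact (LinearMap.det_conj (V.ρ g) e.toLinearEquiv).symm

theorem PPV_congr (p : ℕ) {H : Type} [Group H] [Fintype H] (V W : FDRep ℂ H) (hV : Simple V)
    (h : V.character = W.character) (hp : PPV p V) : PPV p W := by
  obtain ⟨⟨i, hi⟩, j, hj⟩ := hp
  refine ⟨⟨i, ?_⟩, j, fun g => ?_⟩
  · have := congrFun h 1
    simp only [FDRep.char_one] at this
    rw [← hi]
    exact_mod_cast this.symm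
  · rw [← rdet_eq_of_char V W hV h, hj]

/-- irreducible characters of `p`-power degree and determinantal order -/
def pirr (p : ℕ) (H : Subgroup Γ) : Set (Γ → ℂ) :=
  {f | ∃ V : FDRep ℂ H, Simple V ∧ extChar H V = f ∧ PPV p V}

theorem pirr_irr {p : ℕ} {H : Subgroup Γ} {f : Γ → ℂ} (h : f ∈ pirr p H) : f ∈ irr H := by
  obtain ⟨V, hV, hf, -⟩ := h
  exact ⟨V, hV, hf⟩

/-- the restriction of an automorphism -/
def autRes (a : MulAut Γ) (H K : Subgroup Γ) (h : ∀ x, a x ∈ H ↔ x ∈ K) : K ≃* H where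
  toFun x := ⟨a x, (h x).2 x.2⟩
  invFun y := ⟨a⁻¹ y, (h _).1 (by simp)⟩
  left_inv x := by simp
  right_inv y := by simp
  map_mul' x y := by ext; simp

theorem aut_extChar (a : MulAut Γ) (H K : Subgroup Γ) (h : ∀ x, a x ∈ H ↔ x ∈ K)
    (V : FDRep ℂ H) : extChar K (repComp V (autRes a H K h).toMonoidHom) =
      fun y => extChar H V (a y) := by
  funext y
  by_cases hy : y ∈ K
  · have h1 := extChar_mem (repComp V (autRes a H K h).toMonoidHom) ⟨y, hy⟩
    have h2 := extChar_mem V (autRes a H K h ⟨y, hy⟩)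
    exact h1.trans h2.symm
  · have hy' : a y ∉ H := fun h' => hy ((h y).1 h')
    simp [extChar, hy, hy']

theorem aut_irr (a : MulAut Γ) (H K : Subgroup Γ) (h : ∀ x, a x ∈ H ↔ x ∈ K) {f : Γ → ℂ}
    (hf : f ∈ irr H) : (fun y => f (a y)) ∈ irr K := by
  classical
  obtain ⟨V, hV, rfl⟩ := hf
  exact ⟨_, repComp_simple V hV (autRes a H K h), aut_extChar a H K h V⟩

theorem aut_pirr (p : ℕ) (a : MulAut Γ) (H K : Subgroup Γ) (h : ∀ x, a x ∈ H ↔ x ∈ K) {f : Γ → ℂ}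
    (hf : f ∈ pirr p H) : (fun y => f (a y)) ∈ pirr p K := by
  classical
  obtain ⟨V, hV, rfl, hi, j, hj⟩ := hf
  exact ⟨_, repComp_simple V hV (autRes a H K h), aut_extChar a H K h V, hi, j,
    fun g => hj _⟩

theorem ip_aut (a : MulAut Γ) (H K : Subgroup Γ) (h : ∀ x, a x ∈ H ↔ x ∈ K) (f g : Γ → ℂ) :
    ip K (fun y => f (a y)) (fun y => g (a y)) = ip H f g := by
  classical
  simp only [ip]
  rw [Nat.card_congr (autRes a H K h).toEquiv]
  congr 1
  refine Fintype.sum_equiv (autRes a H K h).toEquiv _ _ fun x => ?_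
  simp [autRes]

theorem charInner_eq_ip (H : Subgroup Γ) (f : Γ → ℂ) (V : FDRep ℂ H) :
    charInner H f (extChar H V) = ip H f (extChar H V) := by
  classical
  simp only [charInner, ip]
  congr 1
  refine Finset.sum_congr rfl fun x _ => ?_
  rw [extChar_mem, ← char_inv, ← extChar_mem]
  rfl

end PartC


section PartD
open Representation
open scoped ComplexOrder

variable {Γ : Type} [Group Γ] [Fintype Γ]

theorem ip_univ (H : Subgroup Γ) (f g : Γ → ℂ) (hf : ∀ x, x ∉ H → f x = 0) :
    ip H f g = (Nat.card H : ℂ)⁻¹ * ∑ x : Γ, f x * g x⁻¹ := by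
  classical
  simp only [ip]
  congr 1
  rw [← Finset.sum_filter_of_ne (p := (· ∈ H)) (s := Finset.univ)]
  · exact (Finset.sum_subtype (Finset.univ.filter (· ∈ H)) (by simp) (fun x => f x * g x⁻¹)).symm
  · intro x _ hne
    by_contra hx
    exact hne (by rw [hf x hx, zero_mul])

theorem card_ne (H : Subgroup Γ) : (Nat.card H : ℂ) ≠ 0 := by
  exact_mod_cast Nat.card_pos.ne'

theorem card_pos' (H : Subgroup Γ) : (0 : ℂ) < Nat.card H := by
  exact_mod_cast Nat.card_pos

theorem ind_CF {K H : Subgroup Γ} (h : K ≤ H) {f : Γ → ℂ} (hf : ∀ x, x ∉ K → f x = 0) :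
    CF H (indChar K H f) where
  supp := fun x hx => by
    simp only [indChar]
    rw [Finset.sum_eq_zero, mul_zero]
    intro g _
    apply hf
    intro h'
    apply hx
    have := H.mul_mem (H.mul_mem g.2 (h h')) (H.inv_mem g.2)
    simpa [mul_assoc] using this
  conj := fun k hk x => by
    classical
    simp only [indChar]
    congr 1
    refine Fintype.sum_equiv (Equiv.mulLeft (⟨k, hk⟩⁻¹ : H)) _ _ fun g => ?_
    simp [mul_assoc]

theorem frob {K H : Subgroup Γ} (h : K ≤ H) {f g : Γ → ℂ} (hf : ∀ x, x ∉ K → f x = 0)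
    (hg : CF H g) : ip H (indChar K H f) g = ip K f g := by
  classical
  rw [ip_univ H _ _ (ind_CF h hf).supp, ip_univ K _ _ hf]
  simp only [indChar]
  have e : ∀ k : H, ∑ x : Γ, f ((k : Γ)⁻¹ * x * k) * g x⁻¹ = ∑ x : Γ, f x * g x⁻¹ := by
    intro k
    refine Fintype.sum_equiv (MulAut.conj (k : Γ)⁻¹).toEquiv _ _ fun x => ?_
    have := hg.conj (k : Γ)⁻¹ (H.inv_mem k.2) x⁻¹
    simp only [MulEquiv.toEquiv_eq_coe, EquivLike.coe_coe, MulAut.conj_apply, inv_inv]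
    rw [← this]
    simp [mul_assoc]
  calc _ = (Nat.card H : ℂ)⁻¹ * ((Nat.card K : ℂ)⁻¹ * ∑ k : H, ∑ x : Γ, f ((k : Γ)⁻¹ * x * k) * g x⁻¹) := by
        rw [Finset.sum_comm]
        simp only [Finset.mul_sum, Finset.sum_mul, mul_assoc]
    _ = _ := by
        simp only [e, Finset.sum_const, Finset.card_univ, nsmul_eq_mul, Fintype.card_eq_nat_card]
        have := card_ne H
        field_simp

theorem ind_one {K H : Subgroup Γ} (f : Γ → ℂ) :
    (Nat.card K : ℂ) * indChar K H f 1 = Nat.card H * f 1 := by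
  have := card_ne K
  simp [indChar, Fintype.card_eq_nat_card, mul_inv_cancel_left₀ this]

theorem ind_trans {K N G : Subgroup Γ} (h' : N ≤ G) (f : Γ → ℂ) :
    indChar N G (indChar K N f) = indChar K G f := by
  classical
  funext x
  simp only [indChar]
  rw [← Finset.mul_sum, Finset.sum_comm]
  have : ∀ y : N, ∑ g : G, f ((y : Γ)⁻¹ * ((g : Γ)⁻¹ * x * g) * y) = ∑ g : G, f ((g : Γ)⁻¹ * x * g) := by
    intro y
    refine Fintype.sum_equiv (Equiv.mulRight (⟨y, h' y.2⟩ : G)) _ _ fun g => ?_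
    simp [mul_assoc]
  simp only [this, Finset.sum_const, Finset.card_univ, nsmul_eq_mul, Fintype.card_eq_nat_card]
  have := card_ne N
  field_simp

theorem ip_nonneg {H K : Subgroup Γ} (h : K ≤ H) {f g : Γ → ℂ} (hf : f ∈ irr H) (hg : g ∈ irr K) :
    0 ≤ ip K f g := by
  obtain ⟨n, hn⟩ := ip_nat h hf hg
  rw [hn]
  exact_mod_cast Nat.zero_le n

theorem one_le_ip {H K : Subgroup Γ} (h : K ≤ H) {f g : Γ → ℂ} (hf : f ∈ irr H) (hg : g ∈ irr K)
    (hne : ip K f g ≠ 0) : 1 ≤ ip K f g := by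
  obtain ⟨n, hn⟩ := ip_nat h hf hg
  rw [hn] at hne ⊢
  have : n ≠ 0 := by exact_mod_cast hne
  exact_mod_cast Nat.one_le_iff_ne_zero.2 this

theorem irr_pos {H : Subgroup Γ} {f : Γ → ℂ} (hf : f ∈ irr H) : 0 < f 1 := by
  obtain ⟨n, hn, h⟩ := irr_one hf
  rw [h]
  exact_mod_cast hn

theorem ind_ip {K H : Subgroup Γ} (h : K ≤ H) {ρ χ : Γ → ℂ} (hρ : ρ ∈ irr K) (hχ : χ ∈ irr H) :
    ip H (indChar K H ρ) χ = ip K χ ρ := by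
  rw [frob h (irr_CF hρ).supp (irr_CF hχ), ip_comm]

theorem ind_expand {K H : Subgroup Γ} (h : K ≤ H) {ρ : Γ → ℂ} (hρ : ρ ∈ irr K) (x : Γ) :
    indChar K H ρ x = ∑ χ ∈ irrF H, ip K χ ρ * χ x := by
  conv_lhs => rw [CF_expand (ind_CF h (irr_CF hρ).supp)]
  exact Finset.sum_congr rfl fun χ hχ => by rw [ind_ip h hρ (mem_irrF.1 hχ)]

theorem exists_over {K H : Subgroup Γ} (h : K ≤ H) {ρ : Γ → ℂ} (hρ : ρ ∈ irr K) :
    ∃ χ ∈ irr H, ip K χ ρ ≠ 0 := by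
  by_contra! hc
  have h1 := ind_expand h hρ 1
  rw [Finset.sum_eq_zero (fun χ hχ => by rw [hc χ (mem_irrF.1 hχ), zero_mul])] at h1
  have h2 := ind_one (K := K) (H := H) ρ
  rw [h1, mul_zero] at h2
  exact mul_ne_zero (card_ne H) (irr_pos hρ).ne' h2.symm

theorem deg_le {K H : Subgroup Γ} (h : K ≤ H) {ρ χ : Γ → ℂ} (hρ : ρ ∈ irr K) (hχ : χ ∈ irr H)
    (hne : ip K χ ρ ≠ 0) : Nat.card K * χ 1 ≤ Nat.card H * ρ 1 := by
  rw [← ind_one (K := K) (H := H) ρ, ind_expand h hρ 1]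
  refine mul_le_mul_of_nonneg_left ?_ (card_pos' K).le
  have h1 : ∀ ψ ∈ irrF H, 0 ≤ ip K ψ ρ * ψ 1 := fun ψ hψ =>
    mul_nonneg (ip_nonneg h (mem_irrF.1 hψ) hρ) (irr_pos (mem_irrF.1 hψ)).le
  refine le_trans ?_ (Finset.single_le_sum h1 (mem_irrF.2 hχ))
  exact le_mul_of_one_le_left (irr_pos hχ).le (one_le_ip h hχ hρ hne)

theorem ind_eq {K H : Subgroup Γ} (h : K ≤ H) {ρ χ : Γ → ℂ} (hρ : ρ ∈ irr K) (hχ : χ ∈ irr H)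
    (hne : ip K χ ρ ≠ 0) (hle : Nat.card H * ρ 1 ≤ Nat.card K * χ 1) : indChar K H ρ = χ := by
  classical
  have h1 : ∀ ψ ∈ irrF H, 0 ≤ ip K ψ ρ * ψ 1 := fun ψ hψ =>
    mul_nonneg (ip_nonneg h (mem_irrF.1 hψ) hρ) (irr_pos (mem_irrF.1 hψ)).le
  rw [← ind_one (K := K) (H := H) ρ, ind_expand h hρ 1, ← Finset.add_sum_erase _ _ (mem_irrF.2 hχ)] at hle
  have hle := le_of_mul_le_mul_left hle (card_pos' K)
  have h1' : ∀ ψ ∈ (irrF H).erase χ, 0 ≤ ip K ψ ρ * ψ 1 := fun ψ hψ => h1 ψ (Finset.mem_of_mem_erase hψ)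
  have h2 := Finset.sum_nonneg h1'
  have h3 : χ 1 ≤ ip K χ ρ * χ 1 := le_mul_of_one_le_left (irr_pos hχ).le (one_le_ip h hχ hρ hne)
  have h4 : ∑ ψ ∈ (irrF H).erase χ, ip K ψ ρ * ψ 1 = 0 := by
    apply le_antisymm _ h2
    have := le_trans (add_le_add_left h3 _) hle
    simpa using this
  rw [h4, add_zero] at hle
  have h5 : ip K χ ρ = 1 := mul_right_cancel₀ (irr_pos hχ).ne' (by rw [one_mul]; exact le_antisymm hle h3)
  funext x
  rw [ind_expand h hρ x, Finset.sum_eq_single χ, h5, one_mul]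
  · intro ψ hψ hne
    have := (Finset.sum_eq_zero_iff_of_nonneg h1').1 h4 ψ (Finset.mem_erase.2 ⟨hne, hψ⟩)
    rcases mul_eq_zero.1 this with h | h
    · rw [h, zero_mul]
    · exact absurd h (irr_pos (mem_irrF.1 hψ)).ne'
  · intro h; exact absurd (mem_irrF.2 hχ) h

/-- Clifford -/
theorem clifford {M G : Subgroup Γ} (h : M ≤ G) (hn : ∀ g ∈ G, ∀ x, MulAut.conj g x ∈ M ↔ x ∈ M)
    {χ φ φ' : Γ → ℂ} (hχ : χ ∈ irr G) (hφ : φ ∈ irr M) (hφ' : φ' ∈ irr M) (h1 : ip M χ φ ≠ 0)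
    (h2 : ip M χ φ' ≠ 0) : ∃ g ∈ G, φ' = fun x => φ (MulAut.conj g x) := by
  classical
  by_contra! hc
  have e1 : ip M (indChar M G φ) φ' = 0 := by
    have : indChar M G φ = fun x => (Nat.card M : ℂ)⁻¹ * ∑ g : G, (fun (g : G) x => φ (MulAut.conj (g : Γ)⁻¹ x)) g x := by
      funext x
      simp [indChar]
    rw [this, ip_smul_left, ip_sum_left M Finset.univ (fun (g : G) x => φ (MulAut.conj (g : Γ)⁻¹ x)),
      Finset.sum_eq_zero, mul_zero]
    intro g _
    by_contra hne
    refine hc _ (G.inv_mem g.2) (irr_ne (aut_irr _ M M (hn _ (G.inv_mem g.2)) hφ) hφ' hne).symm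
  rw [ip_trans le_rfl h (ind_CF h (irr_CF hφ).supp)] at e1
  have h0 : ∀ ψ ∈ irrF G, 0 ≤ ip G (indChar M G φ) ψ * ip M ψ φ' := fun ψ hψ => by
    rw [ind_ip h hφ (mem_irrF.1 hψ)]
    exact mul_nonneg (ip_nonneg h (mem_irrF.1 hψ) hφ) (ip_nonneg h (mem_irrF.1 hψ) hφ')
  have := (Finset.sum_eq_zero_iff_of_nonneg h0).1 e1 χ (mem_irrF.2 hχ)
  rw [ind_ip h hφ hχ] at this
  exact mul_ne_zero h1 h2 this

theorem homog {U N : Subgroup Γ} (h : U ≤ N) (hn : ∀ g ∈ N, ∀ x, MulAut.conj g x ∈ U ↔ x ∈ U)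
    {η τ : Γ → ℂ} (hη : η ∈ irr N) (hτ : τ ∈ irr U) (hinv : ∀ g ∈ N, ∀ x, τ (MulAut.conj g x) = τ x)
    (hne : ip U η τ ≠ 0) {x : Γ} (hx : x ∈ U) : η x = ip U η τ * τ x := by
  rw [irr_expand h (irr_CF hη) hx]
  apply Finset.sum_eq_single τ
  · intro ψ hψ hne'
    by_cases h0 : ip U η ψ = 0
    · rw [h0, zero_mul]
    · obtain ⟨g, hg, rfl⟩ := clifford h hn hη hτ (mem_irrF.1 hψ) hne h0
      exact absurd (funext (hinv g hg)) hne'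
  · intro h; exact absurd (mem_irrF.2 hτ) h

end PartD


section PartE
open Representation
open scoped ComplexOrder

variable {Γ : Type} [Group Γ] [Fintype Γ]

/-- stabilizer of a pair in a group of automorphisms -/
def stab (A : Subgroup (MulAut Γ)) (U : Subgroup Γ) (τ : Γ → ℂ) : Subgroup (MulAut Γ) where
  carrier := {a | a ∈ A ∧ (∀ x, a x ∈ U ↔ x ∈ U) ∧ ∀ x, τ (a x) = τ x}
  one_mem' := ⟨A.one_mem, by simp, by simp⟩
  mul_mem' := by
    rintro a b ⟨h1, h2, h3⟩ ⟨h1', h2', h3'⟩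
    exact ⟨A.mul_mem h1 h1', fun x => by simp [h2, h2'], fun x => by simp [h3, h3']⟩
  inv_mem' := by
    rintro a ⟨h1, h2, h3⟩
    exact ⟨A.inv_mem h1, fun x => by rw [← h2]; simp, fun x => by rw [← h3]; simp⟩

theorem mem_stab {A : Subgroup (MulAut Γ)} {U : Subgroup Γ} {τ : Γ → ℂ} {a : MulAut Γ} :
    a ∈ stab A U τ ↔ a ∈ A ∧ (∀ x, a x ∈ U ↔ x ∈ U) ∧ ∀ x, τ (a x) = τ x := Iff.rfl

/-- stabilizer of a pair in a group -/
def nst (A : Subgroup (MulAut Γ)) (G U : Subgroup Γ) (τ : Γ → ℂ) : Subgroup Γ :=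
  G ⊓ (stab A U τ).comap MulAut.conj

theorem mem_nst {A : Subgroup (MulAut Γ)} {G U : Subgroup Γ} {τ : Γ → ℂ} {g : Γ} :
    g ∈ nst A G U τ ↔ g ∈ G ∧ MulAut.conj g ∈ stab A U τ := Iff.rfl

structure Red (A : Subgroup (MulAut Γ)) (G M U : Subgroup Γ) (τ φ : Γ → ℂ) : Prop where
  UM : U ≤ M
  MG : M ≤ G
  aG : ∀ a ∈ A, ∀ x, a x ∈ G ↔ x ∈ G
  aM : ∀ a ∈ A, ∀ x, a x ∈ M ↔ x ∈ M
  GA : ∀ g ∈ G, MulAut.conj g ∈ A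
  hτ : τ ∈ irr U
  hφ : φ ∈ irr M
  ind : indChar U M τ = φ
  hconj : ∀ a ∈ A, (∀ x, φ (a x) = φ x) → ∃ m ∈ M, (MulAut.conj m)⁻¹ * a ∈ stab A U τ

variable {A : Subgroup (MulAut Γ)} {G M U : Subgroup Γ} {τ φ : Γ → ℂ}

theorem conj_comm (a : MulAut Γ) (g : Γ) : a * MulAut.conj g = MulAut.conj (a g) * a := by
  ext x
  simp

theorem Red.UG (h : Red A G M U τ φ) : U ≤ G := h.UM.trans h.MG

theorem Red.UN (h : Red A G M U τ φ) : U ≤ nst A G U τ := by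
  intro u hu
  refine mem_nst.2 ⟨h.UG hu, mem_stab.2 ⟨h.GA _ (h.UG hu), fun x => ?_, fun x => ?_⟩⟩
  · rw [MulAut.conj_apply, Subgroup.mul_mem_cancel_right _ (U.inv_mem hu),
      Subgroup.mul_mem_cancel_left _ hu]
  · exact (irr_CF h.hτ).conj u hu x

theorem Red.NG (_h : Red A G M U τ φ) : nst A G U τ ≤ G := inf_le_left

theorem Red.NU (_h : Red A G M U τ φ) : ∀ g ∈ nst A G U τ, ∀ x, MulAut.conj g x ∈ U ↔ x ∈ U :=
  fun _ hg => (mem_nst.1 hg).2.2.1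

theorem Red.Nτ (_h : Red A G M U τ φ) : ∀ g ∈ nst A G U τ, ∀ x, τ (MulAut.conj g x) = τ x :=
  fun _ hg => (mem_nst.1 hg).2.2.2

theorem Red.bN (h : Red A G M U τ φ) (b : MulAut Γ) (hb : b ∈ stab A U τ) (x : Γ) :
    b x ∈ nst A G U τ ↔ x ∈ nst A G U τ := by
  rw [mem_nst, mem_nst, h.aG b hb.1]
  refine and_congr_right fun _ => ?_
  have : MulAut.conj (b x) = b * MulAut.conj x * b⁻¹ := by rw [conj_comm]; simp
  rw [this, Subgroup.mul_mem_cancel_right _ (inv_mem hb), Subgroup.mul_mem_cancel_left _ hb]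

theorem Red.ipτ (h : Red A G M U τ φ) {χ : Γ → ℂ} (hχ : CF G χ) : ip U χ τ = ip M χ φ := by
  rw [← ip_res M, ip_comm M, ← h.ind, frob h.UM (irr_CF h.hτ).supp (res_CF h.MG hχ), ip_comm U τ]
  exact ip_congr_left U τ fun x hx => by simp [res, h.UM hx]

theorem Red.D1 (h : Red A G M U τ φ) : M ⊓ nst A G U τ ≤ U := by
  classical
  set D := M ⊓ nst A G U τ with hD
  have hUD : U ≤ D := le_inf h.UM h.UN
  have hDM : D ≤ M := inf_le_left
  have e1 : ip U φ τ = 1 := by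
    rw [ip_comm, ← frob h.UM (irr_CF h.hτ).supp (irr_CF h.hφ), h.ind, irr_self h.hφ]
  rw [ip_trans hDM hUD (irr_CF h.hφ)] at e1
  obtain ⟨ρ, hρ, hne⟩ := Finset.exists_ne_zero_of_sum_ne_zero (by rw [e1]; exact one_ne_zero)
  have hρ' := mem_irrF.1 hρ
  have h0 : ∀ ψ ∈ irrF D, 0 ≤ ip D φ ψ * ip U ψ τ := fun ψ hψ =>
    mul_nonneg (ip_nonneg hDM h.hφ (mem_irrF.1 hψ)) (ip_nonneg hUD (mem_irrF.1 hψ) h.hτ)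
  have h1 := Finset.single_le_sum h0 hρ
  rw [e1] at h1
  have n1 := left_ne_zero_of_mul hne
  have n2 := right_ne_zero_of_mul hne
  have h2 := one_le_ip hDM h.hφ hρ' n1
  have h3 := one_le_ip hUD hρ' h.hτ n2
  have h4 : ip U ρ τ = 1 := by
    refine le_antisymm (le_trans ?_ h1) h3
    exact le_mul_of_one_le_left (zero_le_one.trans h3) h2
  have h5 := homog hUD (fun g hg => h.NU g hg.2) hρ' h.hτ (fun g hg => h.Nτ g hg.2) n2 U.one_mem
  rw [h4, one_mul] at h5
  have h6 := deg_le hDM hρ' h.hφ n1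
  rw [h5] at h6
  have h7 := ind_one (K := U) (H := M) τ
  rw [h.ind] at h7
  rw [← h7] at h6
  have h8 := le_of_mul_le_mul_right h6 (irr_pos h.hφ)
  have h9 : Nat.card D ≤ Nat.card U := by exact_mod_cast h8
  exact (Subgroup.eq_of_le_of_card_ge hUD h9).ge

theorem Red.D2 (h : Red A G M U τ φ) (g : Γ) (hg : g ∈ G) (hφ : ∀ x, φ (MulAut.conj g x) = φ x) :
    ∃ m ∈ M, m⁻¹ * g ∈ nst A G U τ := by
  obtain ⟨m, hm, h1⟩ := h.hconj _ (h.GA g hg) hφ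
  exact ⟨m, hm, mem_nst.2 ⟨G.mul_mem (G.inv_mem (h.MG hm)) hg, by simpa using h1⟩⟩

open scoped Classical in
/-- orbit -/
noncomputable def orb (G : Subgroup Γ) (φ : Γ → ℂ) : Finset (Γ → ℂ) :=
  Finset.univ.image fun g : G => fun x => φ (MulAut.conj (g : Γ) x)

theorem Red.card (h : Red A G M U τ φ) :
    Nat.card G * Nat.card U ≤ (orb G φ).card * (Nat.card M * Nat.card (nst A G U τ)) := by
  classical
  let S : Finset G := Finset.univ.filter fun g : G => ∀ x, φ (MulAut.conj (g : Γ) x) = φ x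
  have h1 : Nat.card G ≤ S.card * (orb G φ).card := by
    rw [Nat.card_eq_fintype_card, ← Finset.card_univ]
    refine Finset.card_le_mul_card_image _ _ fun f hf => ?_
    obtain ⟨g0, -, hg0⟩ := Finset.mem_image.1 hf
    refine Finset.card_le_card_of_injOn (fun g => g * g0⁻¹) ?_ ?_
    · intro g hg
      have hg : (fun x => φ (MulAut.conj (g : Γ) x)) = f := (Finset.mem_filter.1 hg).2
      refine Finset.mem_filter.2 ⟨Finset.mem_univ _, fun x => ?_⟩
      have h1 := congrFun (hg.trans hg0.symm) (MulAut.conj (g0 : Γ)⁻¹ x)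
      simpa [mul_assoc] using h1
    · intro g _ g' _ hgg
      simpa using hgg
  have h2 : S.card * Nat.card U ≤ Nat.card M * Nat.card (nst A G U τ) := by
    have : ∀ g : S, ∃ m ∈ M, m⁻¹ * (g : Γ) ∈ nst A G U τ := fun g =>
      h.D2 g g.1.2 (Finset.mem_filter.1 g.2).2
    choose m hm hn using this
    rw [← Fintype.card_coe, ← Nat.card_eq_fintype_card, ← Nat.card_prod, ← Nat.card_prod]
    let F : S × U → M × nst A G U τ := fun gu =>
      (⟨m gu.1 * gu.2, M.mul_mem (hm _) (h.UM gu.2.2)⟩,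
        ⟨(gu.2 : Γ)⁻¹ * ((m gu.1)⁻¹ * gu.1), mul_mem (inv_mem (h.UN gu.2.2)) (hn _)⟩)
    refine Nat.card_le_card_of_injective F ?_
    rintro ⟨g, u⟩ ⟨g', u'⟩ hF
    simp only [F, Prod.mk.injEq, Subtype.mk.injEq] at hF
    obtain ⟨e1, e2⟩ := hF
    have e3 : (g : Γ) = g' := by
      have := congrArg₂ (· * ·) e1 e2
      simpa [mul_assoc] using this
    have e4 : g = g' := Subtype.ext (Subtype.ext e3)
    subst e4
    have e5 : (u : Γ) = u' := mul_left_cancel e1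
    rw [Subtype.ext e5]
  calc _ ≤ S.card * (orb G φ).card * Nat.card U := Nat.mul_le_mul_right _ h1
    _ = (orb G φ).card * (S.card * Nat.card U) := by ring
    _ ≤ _ := Nat.mul_le_mul_left _ h2

theorem Red.D3 (h : Red A G M U τ φ) {η : Γ → ℂ} (hη : η ∈ irr (nst A G U τ)) (hne : ip U η τ ≠ 0) :
    indChar (nst A G U τ) G η ∈ irr G ∧ ip M (indChar (nst A G U τ) G η) φ ≠ 0 ∧
    ip (nst A G U τ) (indChar (nst A G U τ) G η) η ≠ 0 ∧
    ∀ η' ∈ irr (nst A G U τ), ip (nst A G U τ) (indChar (nst A G U τ) G η) η' ≠ 0 →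
      ip U η' τ ≠ 0 → η' = η := by
  classical
  have hcard := h.card
  have hNG := h.NG
  have hUN := h.UN
  have hη1 : η 1 = ip U η τ * τ 1 := homog hUN h.NU hη h.hτ h.Nτ hne U.one_mem
  set N := nst A G U τ with hN
  obtain ⟨χ, hχ, hχη⟩ := exists_over hNG hη
  have hf : ip U χ τ = ip M χ φ := h.ipτ (irr_CF hχ)
  have hsum := ip_trans hNG hUN (irr_CF hχ) τ
  have h0 : ∀ ψ ∈ irrF N, 0 ≤ ip N χ ψ * ip U ψ τ := fun ψ hψ =>
    mul_nonneg (ip_nonneg hNG hχ (mem_irrF.1 hψ)) (ip_nonneg hUN (mem_irrF.1 hψ) h.hτ)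
  have he0 : 0 < ip U η τ := lt_of_lt_of_le zero_lt_one (one_le_ip hUN hη h.hτ hne)
  have hle1 : ip U η τ ≤ ip N χ η * ip U η τ :=
    le_mul_of_one_le_left he0.le (one_le_ip hNG hχ hη hχη)
  have hle : ip U η τ ≤ ip U χ τ := by
    rw [hsum]
    exact hle1.trans (Finset.single_le_sum h0 (mem_irrF.2 hη))
  have hMφ : ip M χ φ ≠ 0 := by
    rw [← hf]; exact (lt_of_lt_of_le he0 hle).ne'
  have horb : ((orb G φ).card : ℂ) * (ip U χ τ * φ 1) ≤ χ 1 := by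
    rw [irr_expand h.MG (irr_CF hχ) M.one_mem]
    have hsub : orb G φ ⊆ irrF M := by
      intro f hf
      obtain ⟨g, -, rfl⟩ := Finset.mem_image.1 hf
      exact mem_irrF.2 (aut_irr _ M M (h.aM _ (h.GA _ g.2)) h.hφ)
    refine le_trans ?_ (Finset.sum_le_sum_of_subset_of_nonneg hsub fun ψ hψ _ =>
      mul_nonneg (ip_nonneg h.MG hχ (mem_irrF.1 hψ)) (irr_pos (mem_irrF.1 hψ)).le)
    rw [Finset.sum_congr rfl (g := fun _ => ip U χ τ * φ 1), Finset.sum_const, nsmul_eq_mul]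
    intro f hf'
    obtain ⟨g, -, rfl⟩ := Finset.mem_image.1 hf'
    rw [hf, ← ip_aut _ M M (h.aM _ (h.GA _ g.2)) χ φ]
    simp only [map_one]
    congr 1
    exact ip_congr_left M _ fun x _ => ((irr_CF hχ).conj g g.2 x).symm
  have hφ1 := ind_one (K := U) (H := M) τ
  rw [h.ind] at hφ1
  have hcard' : (Nat.card G : ℂ) * Nat.card U ≤ (orb G φ).card * (Nat.card M * Nat.card N) := by
    exact_mod_cast hcard
  have hτ1 := irr_pos h.hτ
  have cU := card_pos' U
  have cN := card_pos' N
  have cM := card_pos' M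
  have cG := card_pos' G
  have o0 : (0 : ℂ) ≤ (orb G φ).card := by positivity
  have hbig : (Nat.card U : ℂ) * (Nat.card G * η 1) ≤ Nat.card N * (orb G φ).card * (Nat.card M * η 1) := by
    calc _ = (Nat.card G : ℂ) * Nat.card U * η 1 := by ring
      _ ≤ (orb G φ).card * (Nat.card M * Nat.card N) * η 1 :=
        mul_le_mul_of_nonneg_right hcard' (irr_pos hη).le
      _ = _ := by ring
  have hbig2 : (Nat.card N : ℂ) * (orb G φ).card * (Nat.card M * (ip U χ τ * τ 1)) ≤
      Nat.card U * (Nat.card N * χ 1) := by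
    calc _ = (Nat.card U : ℂ) * Nat.card N * ((orb G φ).card * (ip U χ τ * φ 1)) := by
          linear_combination (-(Nat.card N : ℂ) * (orb G φ).card * ip U χ τ) * hφ1
      _ ≤ Nat.card U * Nat.card N * χ 1 := mul_le_mul_of_nonneg_left horb (by positivity)
      _ = _ := by ring
  have hmono : (Nat.card N : ℂ) * (orb G φ).card * (Nat.card M * (ip U η τ * τ 1)) ≤
      (Nat.card N : ℂ) * (orb G φ).card * (Nat.card M * (ip U χ τ * τ 1)) := by
    gcongr
  have hdeg : (Nat.card G : ℂ) * η 1 ≤ Nat.card N * χ 1 := by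
    refine le_of_mul_le_mul_left (hbig.trans ?_) cU
    rw [hη1]
    exact hmono.trans hbig2
  have hindeq : indChar N G η = χ := ind_eq hNG hη hχ hχη hdeg
  have hdeg' := deg_le hNG hη hχ hχη
  have hfe : ip U χ τ = ip U η τ := by
    refine le_antisymm ?_ hle
    have h1 : (Nat.card N : ℂ) * (orb G φ).card * (Nat.card M * (ip U χ τ * τ 1)) ≤
        Nat.card N * (orb G φ).card * (Nat.card M * (ip U η τ * τ 1)) := by
      rw [← hη1]
      exact hbig2.trans ((mul_le_mul_of_nonneg_left hdeg' cU.le).trans hbig)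
    have o1 : (0 : ℂ) < (orb G φ).card := by
      have : (0 : ℕ) < (orb G φ).card := Finset.card_pos.2 (Finset.image_nonempty.2 Finset.univ_nonempty)
      exact_mod_cast this
    exact le_of_mul_le_mul_right (le_of_mul_le_mul_left (le_of_mul_le_mul_left h1 (by positivity)) cM) hτ1
  rw [hindeq]
  refine ⟨hχ, hMφ, hχη, fun η' hη' h1 h2 => ?_⟩
  by_contra hne'
  rw [hfe, ← Finset.add_sum_erase _ _ (mem_irrF.2 hη)] at hsum
  have h3 : ip U η τ + ∑ ψ ∈ (irrF N).erase η, ip N χ ψ * ip U ψ τ ≤ ip U η τ := by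
    conv_rhs => rw [hsum]
    exact add_le_add_left hle1 _
  have h4 : ∑ ψ ∈ (irrF N).erase η, ip N χ ψ * ip U ψ τ ≤ 0 := by simpa using h3
  have h0' : ∀ ψ ∈ (irrF N).erase η, 0 ≤ ip N χ ψ * ip U ψ τ :=
    fun ψ hψ => h0 ψ (Finset.mem_of_mem_erase hψ)
  have h5 := (Finset.sum_eq_zero_iff_of_nonneg h0').1 (le_antisymm h4 (Finset.sum_nonneg h0')) η'
    (Finset.mem_erase.2 ⟨hne', mem_irrF.2 hη'⟩)
  exact mul_ne_zero h1 h2 h5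

theorem Red.D4 (h : Red A G M U τ φ) {η χ : Γ → ℂ} (hη : η ∈ irr (nst A G U τ)) (hne : ip U η τ ≠ 0)
    (hχ : χ = indChar (nst A G U τ) G η) (a : MulAut Γ) (ha : a ∈ A) (hfix : ∀ x, χ (a x) = χ x) :
    ∃ g ∈ G, ∃ b ∈ stab A U τ, a = MulAut.conj g * b ∧ ∀ x, η (b x) = η x := by
  obtain ⟨h1, h2, h3, h4⟩ := h.D3 hη hne
  rw [← hχ] at h1 h2 h3 h4
  have h5 : ip M χ (fun x => φ (a x)) ≠ 0 := by
    rw [← ip_aut a M M (h.aM a ha)] at h2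
    simpa only [hfix] using h2
  have h2 := h2
  obtain ⟨g, hg, hga⟩ := clifford h.MG (fun g hg => h.aM _ (h.GA g hg)) h1 h.hφ
    (aut_irr a M M (h.aM a ha) h.hφ) h2 h5
  obtain ⟨m, hm, hb⟩ := h.hconj (a * (MulAut.conj g)⁻¹) (A.mul_mem ha (A.inv_mem (h.GA g hg))) (fun x => by
    have := congrFun hga ((MulAut.conj g)⁻¹ x)
    simpa [mul_assoc] using this)
  set b := (MulAut.conj m)⁻¹ * (a * (MulAut.conj g)⁻¹) with hbdef
  have hbg : b g ∈ G := (h.aG b hb.1 g).2 hg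
  have e : a = MulAut.conj (m * b g) * b := by
    rw [map_mul, mul_assoc, ← conj_comm, hbdef]
    simp [mul_assoc]
  refine ⟨m * b g, G.mul_mem (h.MG hm) hbg, b, hb, e, ?_⟩
  have hχb : ∀ x, χ (b x) = χ x := fun x => by
    rw [← hfix x]
    conv_rhs => rw [e]
    exact ((irr_CF h1).conj _ (G.mul_mem (h.MG hm) hbg) _).symm
  have := h4 (fun x => η (b x)) (aut_irr b _ _ (h.bN b hb) hη) (by
      rw [← ip_aut b _ _ (h.bN b hb)] at h3
      simpa only [hχb] using h3) (by
      rw [← ip_aut b _ _ hb.2.1] at hne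
      simpa only [hb.2.2] using hne)
  exact congrFun this

end PartE


section PartF

theorem ext_group {H K S E C : Type} [Group H] [Group K] [Group S] [Group E] [CommGroup C]
    (ζ : C →* E) (hζc : ∀ c e, ζ c * e = e * ζ c) (hζi : Function.Injective ζ)
    (ρ : K →* E) (hρ : ∀ e : E, (∀ k, e * ρ k = ρ k * e) → ∃ c, e = ζ c)
    (i : K →* H) (hi : Function.Injective i) (ψ : H →* S) (hψ : Function.Surjective ψ)
    (hker : ∀ x, ψ x = 1 ↔ ∃ k, i k = x) (d : E →* C) (n m : ℕ) (hd : ∀ c, d (ζ c) = c ^ n)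
    (hm : ∀ k, d (ρ k) ^ m = 1)
    (hP : ∀ h, ∃ P, d P = 1 ∧ ∀ k k', h * i k * h⁻¹ = i k' → P * ρ k = ρ k' * P)
    (hco : ∀ f : S × S → C, (∀ a b c : S, f (a, b) * f (a * b, c) = f (b, c) * f (a, b * c)) →
      (∀ a, f a ^ (n * m) = 1) → ∃ g : S → C, ∀ a b : S, f (a, b) = g a * g b * (g (a * b))⁻¹) :
    ∃ θ : H →* E, ∀ k, θ (i k) = ρ k := by
  classical
  have hPS : ∀ a : S, ∃ hP : H × E, ψ hP.1 = a ∧ d hP.2 = 1 ∧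
      (∀ k k', hP.1 * i k * hP.1⁻¹ = i k' → hP.2 * ρ k = ρ k' * hP.2) ∧
      (a = 1 → hP.1 = 1 ∧ hP.2 = 1) := by
    intro a
    by_cases ha : a = 1
    · refine ⟨(1, 1), by simp [ha], by simp, ?_, by simp⟩
      intro k k' h
      have : k = k' := hi (by simpa using h)
      simp [this]
    · obtain ⟨h, rfl⟩ := hψ a
      obtain ⟨P, h1, h2⟩ := hP h
      exact ⟨(h, P), rfl, h1, h2, fun h => absurd h ha⟩
  choose sP hs hdP hPc hP1 using hPS
  let s : S → H := fun a => (sP a).1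
  let P : S → E := fun a => (sP a).2
  have hk : ∀ x : H, ∃ k, i k = (s (ψ x))⁻¹ * x := by
    intro x
    rw [← hker]
    simp [s, hs]
  choose κ hκ using hk
  have hc : ∀ x : H, ∀ k, ∃ k', i k' = x * i k * x⁻¹ := by
    intro x k
    rw [← hker]
    simp [(hker (i k)).2 ⟨k, rfl⟩]
  choose c hc using hc
  let Q : H → E := fun x => P (ψ x) * ρ (κ x)
  have ψi : ∀ k, ψ (i k) = 1 := fun k => (hker _).2 ⟨k, rfl⟩
  have Q1 : ∀ x k, Q (x * i k) = Q x * ρ k := by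
    intro x k
    have e1 : κ (x * i k) = κ x * k := hi (by
      rw [hκ, map_mul i, hκ, map_mul ψ, ψi, mul_one, mul_assoc])
    have e2 : ψ (x * i k) = ψ x := by rw [map_mul, ψi, mul_one]
    simp only [Q]
    rw [e1, e2, map_mul, mul_assoc]
  have Q2 : ∀ x k k', x * i k * x⁻¹ = i k' → Q x * ρ k = ρ k' * Q x := by
    intro x k k' h
    simp only [Q]
    have e : s (ψ x) * i (κ x * k * (κ x)⁻¹) * (s (ψ x))⁻¹ = i k' := by
      rw [← h, map_mul, map_mul, map_inv, hκ]; group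
    have := hPc (ψ x) _ _ e
    rw [map_mul, map_mul, map_inv] at this
    change P (ψ x) * _ = _ * P (ψ x) at this
    rw [← mul_assoc, ← this]
    group
  have Qi : ∀ k, Q (i k) = ρ k := by
    intro k
    have e : Q 1 = 1 := by
      have e1 : κ 1 = 1 := hi (by rw [hκ]; simp [s, (hP1 1 rfl).1])
      simp only [Q]
      rw [e1]
      simp [P, (hP1 1 rfl).2]
    rw [← one_mul (i k), Q1, e, one_mul]
  have dQ : ∀ x, d (Q x) ^ m = 1 := by
    intro x
    simp only [Q, map_mul]
    have : d (P (ψ x)) = 1 := hdP _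
    rw [this, one_mul, hm]
  have hF : ∀ x y, ∃ z : C, Q x * Q y = ζ z * Q (x * y) := by
    intro x y
    obtain ⟨z, hz⟩ := hρ (Q x * Q y * (Q (x * y))⁻¹) (fun k => by
      obtain ⟨k', hk'⟩ : ∃ k', i k' = (x * y)⁻¹ * i k * (x * y) :=
        ⟨c (x * y)⁻¹ k, by rw [hc]; group⟩
      have e1 := Q2 (x * y) k' k (by rw [hk']; group)
      have e2 := Q2 y k' (c y k') (hc _ _).symm
      have e3 := Q2 x (c y k') k (by rw [hc, hk']; group)
      have e4 : (Q (x * y))⁻¹ * ρ k = ρ k' * (Q (x * y))⁻¹ := by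
        rw [inv_mul_eq_iff_eq_mul, ← mul_assoc, e1, mul_inv_cancel_right]
      rw [mul_assoc, e4, ← mul_assoc, mul_assoc (Q x), e2, ← mul_assoc (Q x), e3]
      group)
    exact ⟨z, by rw [← hz]; group⟩
  choose F hF using hF
  have Finj : ∀ {a b : C} {e : E}, ζ a * e = ζ b * e → a = b := fun h => hζi (mul_right_cancel h)
  have F1 : ∀ x y k, F (x * i k) y = F x y := by
    intro x y k
    apply Finj (e := Q (x * i k * y))
    rw [← hF, Q1]
    obtain ⟨k', hk'⟩ : ∃ k', i k' = y⁻¹ * i k * y := ⟨c y⁻¹ k, by rw [hc]; group⟩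
    have e1 := Q2 y k' k (by rw [hk']; group)
    have e2 : x * i k * y = x * y * i k' := by rw [hk']; group
    rw [e2, Q1, mul_assoc, ← e1, ← mul_assoc, hF, mul_assoc]
  have F2 : ∀ x y k, F x (y * i k) = F x y := by
    intro x y k
    apply Finj (e := Q (x * (y * i k)))
    rw [← hF, Q1, ← mul_assoc x, Q1, ← mul_assoc, hF, mul_assoc]
  have F3 : ∀ x y, F x y = F (s (ψ x)) (s (ψ y)) := by
    intro x y
    have ex : x = s (ψ x) * i (κ x) := by rw [hκ]; group
    have ey : y = s (ψ y) * i (κ y) := by rw [hκ]; group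
    conv_lhs => rw [ex, ey, F1, F2]
  have F4 : ∀ x y z, F x y * F (x * y) z = F y z * F x (y * z) := by
    intro x y z
    apply Finj (e := Q (x * y * z))
    have e1 : ζ (F x y * F (x * y) z) * Q (x * y * z) = Q x * Q y * Q z := by
      rw [map_mul, mul_assoc, ← hF, ← mul_assoc, ← hF]
    have e2 : ζ (F y z * F x (y * z)) * Q (x * y * z) = Q x * (Q y * Q z) := by
      rw [hF y z, ← mul_assoc (Q x), ← hζc, mul_assoc (ζ _) (Q x), hF, map_mul, mul_assoc (ζ _), mul_assoc x]
    rw [e1, e2, mul_assoc]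
  have ψs : ∀ a, ψ (s a) = a := hs
  obtain ⟨g, hg⟩ := hco (fun ab => F (s ab.1) (s ab.2)) (fun a b c => by
      have := F4 (s a) (s b) (s c)
      rw [F3 (s a * s b) (s c), F3 (s a) (s b * s c)] at this
      simpa only [map_mul, ψs] using this) (fun ab => by
      have := congrArg (fun e => d e ^ m) (hF (s ab.1) (s ab.2))
      simp only [map_mul, mul_pow, dQ, hd, ← pow_mul] at this
      simpa using this.symm)
  have hg' : ∀ x y, F x y = g (ψ x) * g (ψ y) * (g (ψ (x * y)))⁻¹ := by
    intro x y
    rw [F3, map_mul]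
    exact hg (ψ x) (ψ y)
  have g1 : g 1 = 1 := by
    have e1 := hg' 1 1
    have e2 : F 1 1 = 1 := by
      apply Finj (e := Q (1 * 1))
      have : Q 1 = 1 := by simpa using Qi 1
      rw [← hF]; simp [this]
    rw [e2] at e1
    simpa using e1.symm
  refine ⟨MonoidHom.mk' (fun x => ζ (g (ψ x))⁻¹ * Q x) fun x y => ?_, fun k => ?_⟩
  · symm
    calc ζ (g (ψ x))⁻¹ * Q x * (ζ (g (ψ y))⁻¹ * Q y)
        = ζ (g (ψ x))⁻¹ * (Q x * ζ (g (ψ y))⁻¹) * Q y := by group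
      _ = ζ (g (ψ x))⁻¹ * ζ (g (ψ y))⁻¹ * (Q x * Q y) := by rw [← hζc]; group
      _ = _ := by
        rw [hF, ← mul_assoc, ← map_mul, ← map_mul, hg']
        congr 2
        rw [mul_comm (g (ψ x)) (g (ψ y))]
        group
  · change ζ (g (ψ (i k)))⁻¹ * Q (i k) = ρ k
    rw [ψi, g1, Qi]; simp

theorem ext_adjust {H K E C : Type} [Group H] [Finite H] [Group K] [Group E] [CommGroup C]
    (ζ : C →* E) (hζc : ∀ c e, ζ c * e = e * ζ c) (i : K →* H) (d : E →* C) (p : ℕ) (hp : p.Prime)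
    (n j : ℕ) (hd : ∀ c, d (ζ c) = c ^ (p ^ n)) (θ : H →* E) (hm : ∀ k, d (θ (i k)) ^ (p ^ j) = 1) :
    ∃ θ' : H →* E, (∀ k, θ' (i k) = θ (i k)) ∧ ∃ l : ℕ, ∀ x, d (θ' x) ^ (p ^ l) = 1 := by
  obtain ⟨a, q, hq, hH⟩ := Nat.exists_eq_pow_mul_and_not_dvd (Nat.card_pos (α := H)).ne' p hp.ne_one
  have hcop : (p ^ (j + n)).Coprime q := Nat.Coprime.pow_left _ ((Nat.Prime.coprime_iff_not_dvd hp).2 hq)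
  obtain ⟨u, v, huv⟩ : ∃ u v : ℤ, u * (p ^ (j + n) : ℕ) + v * q = 1 := by
    have := (Nat.isCoprime_iff_coprime.2 hcop)
    obtain ⟨u, v, h⟩ := this
    exact ⟨u, v, h⟩
  let δ : H → C := fun x => d (θ x)
  have δmul : ∀ x y, δ (x * y) = δ x * δ y := fun x y => by simp [δ]
  refine ⟨MonoidHom.mk' (fun x => ζ (δ x ^ (-(u * (p ^ j : ℕ)))) * θ x) fun x y => ?_, fun k => ?_, a, fun x => ?_⟩
  · rw [δmul, mul_zpow, map_mul, map_mul]
    have := hζc (δ y ^ (-(u * (p ^ j : ℕ)))) (θ x)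
    rw [mul_assoc, mul_assoc, ← mul_assoc _ (θ x), this]
    group
  · change ζ (δ (i k) ^ (-(u * (p ^ j : ℕ)))) * θ (i k) = θ (i k)
    have : δ (i k) ^ (-(u * (p ^ j : ℕ))) = 1 := by
      rw [mul_comm, neg_mul_eq_mul_neg, zpow_mul, zpow_natCast]
      have : δ (i k) ^ p ^ j = 1 := hm k
      rw [this, one_zpow]
    rw [this, map_one, one_mul]
  · change d (ζ (δ x ^ (-(u * (p ^ j : ℕ)))) * θ x) ^ p ^ a = 1
    rw [map_mul, hd]
    change ((δ x ^ (-(u * (p ^ j : ℕ)))) ^ p ^ n * δ x) ^ p ^ a = 1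
    have e : (δ x ^ (-(u * (p ^ j : ℕ)))) ^ p ^ n * δ x = δ x ^ (v * q) := by
      rw [← zpow_natCast, ← zpow_mul, ← zpow_add_one]
      congr 1
      push_cast at huv ⊢
      rw [pow_add] at huv
      linear_combination -huv
    rw [e, ← zpow_natCast, ← zpow_mul]
    have h1 : δ x ^ (p ^ a * q) = 1 := by
      rw [← hH]
      simp only [δ]
      rw [← map_pow, ← map_pow, pow_card_eq_one', map_one, map_one]
    have : v * q * (p ^ a : ℕ) = ((p ^ a * q : ℕ) : ℤ) * v := by push_cast; ring
    rw [this, zpow_mul, zpow_natCast, h1, one_zpow]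

theorem ext_unique {H K S E C : Type} [Group H] [Group K] [Group S] [Group E] [CommGroup C]
    (ζ : C →* E) (hζc : ∀ c e, ζ c * e = e * ζ c) (hζi : Function.Injective ζ)
    (ρ : K →* E) (hρ : ∀ e : E, (∀ k, e * ρ k = ρ k * e) → ∃ c, e = ζ c)
    (i : K →* H) (ψ : H →* S) (hψ : Function.Surjective ψ)
    (hker : ∀ x, ψ x = 1 ↔ ∃ k, i k = x) (d : E →* C) (n l : ℕ) (hd : ∀ c, d (ζ c) = c ^ n)
    (θ θ' : H →* E) (h1 : ∀ k, θ (i k) = ρ k) (h2 : ∀ k, θ' (i k) = ρ k)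
    (h3 : ∀ x, d (θ x) ^ l = 1) (h4 : ∀ x, d (θ' x) ^ l = 1)
    (hS : ∀ f : S →* C, (∀ a, f a ^ (n * l) = 1) → f = 1) : θ = θ' := by
  have hF : ∀ x, ∃ c, θ' x = ζ c * θ x := by
    intro x
    obtain ⟨c, hc⟩ := hρ (θ' x * (θ x)⁻¹) (fun k => by
      obtain ⟨k', hk'⟩ : ∃ k', i k' = x⁻¹ * i k * x := by
        rw [← hker]
        simp [(hker (i k)).2 ⟨k, rfl⟩]
      have e1 : θ x * ρ k' = ρ k * θ x := by
        rw [← h1, ← h1, ← map_mul, hk', ← map_mul]; congr 1; group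
      have e2 : θ' x * ρ k' = ρ k * θ' x := by
        rw [← h2, ← h2, ← map_mul, hk', ← map_mul]; congr 1; group
      have e4 : (θ x)⁻¹ * ρ k = ρ k' * (θ x)⁻¹ := by
        rw [inv_mul_eq_iff_eq_mul, ← mul_assoc, e1, mul_inv_cancel_right]
      rw [mul_assoc, e4, ← mul_assoc, e2, mul_assoc])
    exact ⟨c, by rw [← hc]; group⟩
  choose F hF using hF
  have Finj : ∀ {a b : C} {e : E}, ζ a * e = ζ b * e → a = b := fun h => hζi (mul_right_cancel h)
  let F' : H →* C := MonoidHom.mk' F fun x y => by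
    apply Finj (e := θ (x * y))
    rw [← hF, map_mul, map_mul, map_mul, hF, hF]
    have := hζc (F y) (θ x)
    rw [mul_assoc, mul_assoc, ← mul_assoc (θ x), ← this]
    group
  have hFk : ψ.ker ≤ F'.ker := by
    intro x hx
    obtain ⟨k, rfl⟩ := (hker x).1 hx
    change F (i k) = 1
    apply Finj (e := θ (i k))
    rw [← hF, h1, h2, map_one, one_mul]
  let f : S →* C := ψ.liftOfSurjective hψ ⟨F', hFk⟩
  have hf : ∀ x, f (ψ x) = F x := fun x => MonoidHom.liftOfRightInverse_comp_apply _ _ _ ⟨F', hFk⟩ x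
  have f1 := hS f (fun a => by
    obtain ⟨x, rfl⟩ := hψ a
    rw [hf]
    have := congrArg (fun e => d e ^ l) (hF x)
    simp only [map_mul, mul_pow, h3, h4, hd, ← pow_mul] at this
    simpa using this.symm)
  ext x
  have : F x = 1 := by rw [← hf, f1]; rfl
  rw [hF x, this, map_one, one_mul]

end PartF


section PartF2
open Representation

/-- `p`-good groups -/
def Good (p : ℕ) (S : Type) [Group S] : Prop :=
  (∀ f ∈ twoCocycles S, ∀ k : ℕ, (∀ a, f a ^ (p ^ k) = 1) → f ∈ twoCoboundaries S) ∧
    ∀ l : S →* ℂˣ, ∀ k : ℕ, (∀ a, l a ^ (p ^ k) = 1) → l = 1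

theorem irred_of_res {H K : Type} [Group H] [Group K]
    {V : Type} [AddCommGroup V] [Module ℂ V]
      (θ : Representation ℂ H V) (i : K →* H) (ρ : Representation ℂ K V) (hρ : IsIrreducible ρ)
      (h : ∀ k, θ (i k) = ρ k) : IsIrreducible θ := by
  let F : Subrepresentation θ → Subrepresentation ρ := fun X =>
    ⟨X.toSubmodule, fun g v hv => by
      rw [← h]
      exact X.apply_mem_toSubmodule (i g) hv⟩
  have hF : Function.Injective F := by
    intro X Y h
    apply Subrepresentation.toSubmodule_injective
    have := congrArg Subrepresentation.toSubmodule h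
    exact this
  have hF0 : F ⊥ = ⊥ := Subrepresentation.toSubmodule_injective rfl
  have hF1 : F ⊤ = ⊤ := Subrepresentation.toSubmodule_injective rfl
  refine { exists_pair_ne := ⟨⊥, ⊤, fun h => ?_⟩, eq_bot_or_eq_top := fun X => ?_ }
  · have := congrArg F h
    rw [hF0, hF1] at this
    exact bot_ne_top this
  · rcases eq_bot_or_eq_top (F X) with h | h
    · exact Or.inl (hF (h.trans hF0.symm))
    · exact Or.inr (hF (h.trans hF1.symm))

section
variable (V : Type) [AddCommGroup V] [Module ℂ V]

/-- scalars -/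
noncomputable def zet : ℂˣ →* (V →ₗ[ℂ] V)ˣ := Units.map (algebraMap ℂ (V →ₗ[ℂ] V)).toMonoidHom

/-- determinant on units -/
noncomputable def dd : (V →ₗ[ℂ] V)ˣ →* ℂˣ := Units.map (LinearMap.det : (V →ₗ[ℂ] V) →* ℂ)

theorem zet_coe (c : ℂˣ) : ((zet V c : (V →ₗ[ℂ] V)ˣ) : V →ₗ[ℂ] V) = (c : ℂ) • LinearMap.id := rfl

theorem zet_comm (c : ℂˣ) (e : (V →ₗ[ℂ] V)ˣ) : zet V c * e = e * zet V c := by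
  ext v
  simp [zet_coe]

theorem zet_inj [Nontrivial V] : Function.Injective (zet V) := by
  intro a b h
  obtain ⟨v, hv⟩ := exists_ne (0 : V)
  have h1 := congrArg (fun e : (V →ₗ[ℂ] V)ˣ => (e : V →ₗ[ℂ] V) v) h
  simp only [zet_coe, LinearMap.smul_apply, LinearMap.id_apply] at h1
  ext
  exact smul_left_injective ℂ hv h1

theorem dd_zet (c : ℂˣ) : dd V (zet V c) = c ^ Module.finrank ℂ V := by
  ext
  simp [dd, zet_coe]

theorem dd_coe (e : (V →ₗ[ℂ] V)ˣ) : (dd V e : ℂ) = LinearMap.det (e : V →ₗ[ℂ] V) := rfl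

variable {V} in
theorem cent_scalar [FiniteDimensional ℂ V] [Nontrivial V] {K : Type} [Group K] (ρ : Representation ℂ K V)
    (hρ : IsIrreducible ρ) (e : (V →ₗ[ℂ] V)ˣ)
    (h : ∀ k, e * (MonoidHom.toHomUnits ρ) k = (MonoidHom.toHomUnits ρ) k * e) :
    ∃ c, e = zet V c := by
  obtain ⟨c, hc⟩ := schur_scalar ρ hρ e (fun g => by
    have := congrArg (fun e : (V →ₗ[ℂ] V)ˣ => (e : V →ₗ[ℂ] V)) (h g)
    exact this)
  have hc0 : c ≠ 0 := by
    rintro rfl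
    rw [zero_smul] at hc
    exact e.ne_zero hc
  exact ⟨Units.mk0 c hc0, by ext v; rw [hc, zet_coe]; simp⟩

end

theorem nontrivial_of_irred {H V : Type} [Group H] [AddCommGroup V] [Module ℂ V]
    (ρ : Representation ℂ H V) (h : IsIrreducible ρ) : Nontrivial V := by
  by_contra hn
  rw [not_nontrivial_iff_subsingleton] at hn
  obtain ⟨a, b, hab⟩ := h.exists_pair_ne
  apply hab
  apply Subrepresentation.toSubmodule_injective
  exact Subsingleton.elim _ _

theorem rep_ext (p : ℕ) (hp : p.Prime) {H K S V : Type} [Group H] [Finite H] [Group K] [Fintype K] [Group S]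
    [AddCommGroup V] [Module ℂ V] [FiniteDimensional ℂ V]
    (i : K →* H) (hi : Function.Injective i) (ψ : H →* S) (hψ : Function.Surjective ψ)
    (hker : ∀ x, ψ x = 1 ↔ ∃ k, i k = x) (hS : Good p S)
    (ρ : Representation ℂ K V) (hρ : IsIrreducible ρ) (n j : ℕ) (hn : Module.finrank ℂ V = p ^ n)
    (hj : ∀ k, rdet ρ k ^ (p ^ j) = 1)
    (hinv : ∀ h k k', h * i k * h⁻¹ = i k' → ρ.character k' = ρ.character k) :
    ∃ θ : Representation ℂ H V, (∀ k, θ (i k) = ρ k) ∧ ∃ l : ℕ, ∀ x, rdet θ x ^ (p ^ l) = 1 := by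
  have hnt := nontrivial_of_irred ρ hρ
  have hdd : ∀ k, dd V ((MonoidHom.toHomUnits ρ) k) ^ (p ^ j) = 1 := fun k => by
    ext
    exact hj k
  obtain ⟨θ, hθ⟩ := ext_group (zet V) (zet_comm V) (zet_inj V) (MonoidHom.toHomUnits ρ)
    (cent_scalar ρ hρ) i hi ψ hψ hker (dd V) (p ^ n) (p ^ j) (fun c => by rw [dd_zet, hn]) hdd
    (fun h => by
      have hc : ∀ k, ∃ k', i k' = h * i k * h⁻¹ := by
        intro k
        rw [← hker]
        simp [(hker (i k)).2 ⟨k, rfl⟩]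
      choose c hc using hc
      let c' : K →* K := MonoidHom.mk' c fun x y => hi (by
        rw [hc, map_mul, map_mul, hc, hc]; group)
      let ρ' : Representation ℂ K V := ρ.comp c'
      obtain ⟨e⟩ := equiv_of_char_eq ρ ρ' hρ (funext fun k => (hinv h k (c k) (hc k).symm).symm)
      let P : (V →ₗ[ℂ] V)ˣ := LinearMap.GeneralLinearGroup.generalLinearEquiv ℂ V |>.symm e.toLinearEquiv
      have hP : ∀ v, (P : V →ₗ[ℂ] V) v = e.toLinearEquiv v := fun v => rfl
      obtain ⟨z, hz⟩ := IsAlgClosed.exists_pow_nat_eq ((dd V P)⁻¹ : ℂˣ).val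
        (n := p ^ n) (pow_pos hp.pos n)
      have hz0 : z ≠ 0 := by
        rintro rfl
        rw [zero_pow (pow_pos hp.pos n).ne'] at hz
        exact (dd V P)⁻¹.ne_zero hz.symm
      refine ⟨zet V (Units.mk0 z hz0) * P, ?_, ?_⟩
      · rw [map_mul, dd_zet, hn, mul_eq_one_iff_eq_inv]
        ext
        simpa using hz
      · intro k k' hk
        have : k' = c k := hi (by rw [hc, hk])
        subst this
        have key : P * (MonoidHom.toHomUnits ρ) k = (MonoidHom.toHomUnits ρ) (c k) * P := by
          ext v
          have := congrArg (fun t => t v) (e.1.2 k)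
          exact this
        rw [mul_assoc, key, ← mul_assoc, zet_comm, mul_assoc])
    (fun f hf hf1 => hS.1 f hf (n + j) (fun a => by rw [pow_add, hf1]))
  obtain ⟨θ', h1, l, hl⟩ := ext_adjust (zet V) (zet_comm V) i (dd V) p hp n j
    (fun c => by rw [dd_zet, hn]) θ (fun k => by rw [hθ, hdd])
  refine ⟨(Units.coeHom _).comp θ', fun k => ?_, l, fun x => ?_⟩
  · change (θ' (i k) : V →ₗ[ℂ] V) = ρ k
    rw [h1, hθ]
    rfl
  · have := congrArg Units.val (hl x)
    exact this

variable {Γ : Type} [Group Γ] [Fintype Γ]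

theorem pirr_ext (p : ℕ) (hp : p.Prime) {K L : Subgroup Γ} (h : K ≤ L) {S : Type} [Group S]
    (ψ : L →* S) (hψ : Function.Surjective ψ) (hker : ∀ x : L, ψ x = 1 ↔ (x : Γ) ∈ K) (hS : Good p S)
    {σ : Γ → ℂ} (hσ : σ ∈ pirr p K) (hinv : ∀ g ∈ L, ∀ x, σ (MulAut.conj g x) = σ x) :
    ∃ θ ∈ pirr p L, ∀ x ∈ K, θ x = σ x := by
  classical
  obtain ⟨V, hV, rfl, ⟨n, hn⟩, j, hj⟩ := hσ
  obtain ⟨θ, h1, l, hl⟩ := rep_ext p hp (Subgroup.inclusion h) (Subgroup.inclusion_injective h) ψ hψ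
    (fun x => by
      rw [hker]
      exact ⟨fun hx => ⟨⟨x, hx⟩, rfl⟩, by rintro ⟨k, rfl⟩; exact k.2⟩) hS V.ρ ((simple_iff_irred V).1 hV) n j hn hj
    (fun g k k' hg => by
      have := hinv g g.2 k
      have e : MulAut.conj (g : Γ) (k : Γ) = k' := congrArg (fun x : L => (x : Γ)) hg
      rw [e, extChar_mem, extChar_mem] at this
      exact this)
  refine ⟨extChar L (FDRep.of θ), ⟨FDRep.of θ, ?_, rfl, ⟨n, hn⟩, l, hl⟩, fun x hx => ?_⟩
  · exact simple_of_irred _ θ (irred_of_res θ _ V.ρ ((simple_iff_irred V).1 hV) h1)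
  · have e1 := extChar_mem (FDRep.of θ) (Subgroup.inclusion h ⟨x, hx⟩)
    have e2 := extChar_mem V ⟨x, hx⟩
    refine e1.trans (Eq.trans ?_ e2.symm)
    change LinearMap.trace ℂ V (θ _) = LinearMap.trace ℂ V (V.ρ _)
    rw [h1]

theorem pirr_unique (p : ℕ) {K L : Subgroup Γ} (h : K ≤ L) {S : Type} [Group S]
    (ψ : L →* S) (hψ : Function.Surjective ψ) (hker : ∀ x : L, ψ x = 1 ↔ (x : Γ) ∈ K) (hS : Good p S)
    {σ θ θ' : Γ → ℂ} (hσ : σ ∈ pirr p K) (hθ : θ ∈ pirr p L) (hθ' : θ' ∈ pirr p L)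
    (h1 : ∀ x ∈ K, θ x = σ x) (h2 : ∀ x ∈ K, θ' x = σ x) : θ = θ' := by
  classical
  obtain ⟨X, hX, rfl, -⟩ := hσ
  obtain ⟨V, hV, rfl, ⟨n, hn⟩, j, hj⟩ := hθ
  obtain ⟨W, hW, rfl, -, j', hj'⟩ := hθ'
  let i := Subgroup.inclusion h
  let ρ : Representation ℂ K V := V.ρ.comp i
  let ρ' : Representation ℂ K W := W.ρ.comp i
  have c1 : X.character = ρ.character := funext fun k => by
    have := h1 k k.2
    rw [extChar_mem] at this
    exact this.symm.trans (extChar_mem V (i k))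
  have c2 : X.character = ρ'.character := funext fun k => by
    have := h2 k k.2
    rw [extChar_mem] at this
    exact this.symm.trans (extChar_mem W (i k))
  obtain ⟨e1⟩ := equiv_of_char_eq X.ρ ρ ((simple_iff_irred X).1 hX) c1
  have hρ : IsIrreducible ρ := irred_of_equiv _ _ ((simple_iff_irred X).1 hX) e1
  obtain ⟨e⟩ := equiv_of_char_eq ρ ρ' hρ (c1.symm.trans c2)
  have hnt := nontrivial_of_irred ρ hρ
  let W' : Representation ℂ L V := 
    { toFun := fun x => e.toLinearEquiv.symm.conj (W.ρ x)
      map_one' := by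
        ext v
        rw [map_one]
        exact e.toLinearEquiv.symm_apply_apply v
      map_mul' := fun x y => by
        ext v
        change e.toLinearEquiv.symm (W.ρ (x * y) (e.toLinearEquiv v)) =
          e.toLinearEquiv.symm (W.ρ x (e.toLinearEquiv (e.toLinearEquiv.symm (W.ρ y (e.toLinearEquiv v)))))
        rw [LinearEquiv.apply_symm_apply, map_mul]
        rfl }
  have eq := ext_unique (zet V) (zet_comm V) (zet_inj V) (MonoidHom.toHomUnits ρ)
    (cent_scalar ρ hρ) i ψ hψ (fun x => by
      rw [hker]
      exact ⟨fun hx => ⟨⟨x, hx⟩, rfl⟩, by rintro ⟨k, rfl⟩; exact k.2⟩) (dd V) (p ^ n) (p ^ (j + j'))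
      (fun c => by rw [dd_zet, hn]) (MonoidHom.toHomUnits V.ρ) (MonoidHom.toHomUnits W')
      (fun k => by ext; rfl) (fun k => by
        ext v
        change e.toLinearEquiv.symm (ρ' k (e.toLinearEquiv v)) = ρ k v
        have := congrArg (fun t => t v) (e.1.2 k)
        rw [LinearEquiv.symm_apply_eq]
        exact this.symm) (fun x => by
        ext
        rw [pow_add, pow_mul]
        have := hj x
        change (rdet V.ρ x ^ p ^ j) ^ p ^ j' = 1
        rw [hj, one_pow]) (fun x => by
        ext
        rw [pow_add, mul_comm, pow_mul]
        change ((LinearMap.det (e.toLinearEquiv.symm.conj (W.ρ x))) ^ p ^ j') ^ p ^ j = 1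
        have : LinearMap.det (e.toLinearEquiv.symm.conj (W.ρ x)) = rdet W.ρ x :=
          LinearMap.det_conj (W.ρ x) e.toLinearEquiv.symm
        rw [this, hj', one_pow]) (fun f hf => hS.2 f (n + (j + j')) (fun a => by rw [pow_add, hf]))
  funext x
  by_cases hx : x ∈ L
  · have e1 := extChar_mem V ⟨x, hx⟩
    have e2 := extChar_mem W ⟨x, hx⟩
    refine e1.trans (Eq.trans ?_ e2.symm)
    have e3 : V.ρ ⟨x, hx⟩ = W' ⟨x, hx⟩ :=
      congrArg Units.val (congrArg (fun f => f ⟨x, hx⟩) eq)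
    change LinearMap.trace ℂ V (V.ρ _) = LinearMap.trace ℂ W (W.ρ _)
    rw [e3]
    exact LinearMap.trace_conj' (W.ρ ⟨x, hx⟩) e.toLinearEquiv.symm
  · rw [(extChar_CF V).supp x hx, (extChar_CF W).supp x hx]

end PartF2


section PartF3
open Representation
open scoped ComplexOrder

theorem mem_of_coprime_pow {C : Type*} [Group C] (B : Subgroup C) (f : C) (n m : ℕ) (h : n.Coprime m)
    (hn : f ^ n ∈ B) (hm : f ^ m ∈ B) : f ∈ B := by
  obtain ⟨u, v, huv⟩ := Nat.isCoprime_iff_coprime.2 h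
  have : f = (f ^ n) ^ u * (f ^ m) ^ v := by
    rw [← zpow_natCast, ← zpow_natCast, ← zpow_mul, ← zpow_mul, ← zpow_add, mul_comm (n : ℤ),
      mul_comm (m : ℤ), huv, zpow_one]
  rw [this]
  exact B.mul_mem (B.zpow_mem hn _) (B.zpow_mem hm _)

theorem cocycle_pow_card {S : Type} [Group S] [Fintype S] (f : S × S → ℂˣ) (hf : f ∈ twoCocycles S) :
    f ^ Fintype.card S ∈ twoCoboundaries S := by
  refine ⟨fun a => ∏ c, f (a, c), fun a b => ?_⟩
  have h1 : ∏ c, (f (a, b) * f (a * b, c)) = ∏ c, (f (b, c) * f (a, b * c)) :=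
    Finset.prod_congr rfl fun c _ => hf a b c
  rw [Finset.prod_mul_distrib, Finset.prod_mul_distrib, Finset.prod_const, Finset.card_univ] at h1
  have h2 : ∏ c, f (a, b * c) = ∏ c, f (a, c) :=
    Fintype.prod_equiv (Equiv.mulLeft b) _ _ fun c => rfl
  rw [h2] at h1
  simp only [Pi.pow_apply]
  rw [eq_mul_inv_iff_mul_eq, h1, mul_comm]

theorem good_of_coprime (p : ℕ) (hp : p.Prime) (S : Type) [Group S] [Finite S] (h : ¬ p ∣ Nat.card S) :
    Good p S := by
  have := Fintype.ofFinite S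
  have hcop : ∀ k, (Fintype.card S).Coprime (p ^ k) := fun k => by
    rw [← Nat.card_eq_fintype_card]
    exact (Nat.Coprime.pow_left _ ((Nat.Prime.coprime_iff_not_dvd hp).2 h)).symm
  refine ⟨fun f hf k hk => ?_, fun l k hk => ?_⟩
  · exact mem_of_coprime_pow _ f _ _ (hcop k) (cocycle_pow_card f hf) (by
      have : f ^ p ^ k = 1 := funext hk
      rw [this]; exact one_mem _)
  · ext a
    have := mem_of_coprime_pow (⊥ : Subgroup ℂˣ) (l a) _ _ (hcop k) (by
      rw [Subgroup.mem_bot, ← map_pow, pow_card_eq_one, map_one]) (by rw [Subgroup.mem_bot, hk])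
    rw [Subgroup.mem_bot] at this
    simp [this]

theorem good_of_simple (p : ℕ) (hp : p.Prime) (S : Type) [Group S] [IsSimpleGroup S]
    (hnc : ¬ ∀ a b : S, a * b = b * a) (h : ¬ p ∣ Nat.card (schurMultiplier S)) : Good p S := by
  refine ⟨fun f hf k hk => ?_, fun l k hk => ?_⟩
  · have h1 := mem_of_coprime_pow ((twoCoboundaries S).subgroupOf (twoCocycles S)) ⟨f, hf⟩
      (((twoCoboundaries S).subgroupOf (twoCocycles S)).index) (p ^ k)
      (Nat.Coprime.pow_left _ ((Nat.Prime.coprime_iff_not_dvd hp).2 h)).symm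
      (Subgroup.pow_index_mem _ _) (by
        have : (⟨f, hf⟩ : twoCocycles S) ^ p ^ k = 1 := Subtype.ext (funext hk)
        rw [this]; exact one_mem _)
    exact h1
  · rcases (MonoidHom.normal_ker l).eq_bot_or_eq_top with h | h
    · exfalso
      apply hnc
      intro a b
      apply (MonoidHom.ker_eq_bot_iff l).1 h
      rw [map_mul, map_mul, mul_comm]
    · ext a
      have : a ∈ l.ker := by rw [h]; trivial
      rw [MonoidHom.mem_ker] at this
      simp [this]

variable {Γ : Type} [Group Γ] [Fintype Γ]

theorem irr_twist {L : Subgroup Γ} {θ : Γ → ℂ} (hθ : θ ∈ irr L) (l : L →* ℂˣ) :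
    ∃ θ' ∈ irr L, ∀ x : L, θ' x = l x * θ x := by
  classical
  obtain ⟨V, hV, rfl⟩ := hθ
  let ρ : Representation ℂ L V :=
    { toFun := fun x => (l x : ℂ) • V.ρ x
      map_one' := by simp
      map_mul' := fun x y => by
        rw [map_mul, map_mul, Units.val_mul]
        ext v
        simp only [LinearMap.smul_apply, Module.End.mul_apply, map_smul, mul_smul]
        rw [smul_comm] }
  have hc : ∀ x, (FDRep.of ρ).character x = l x * V.character x := by
    intro x
    change LinearMap.trace ℂ V ((l x : ℂ) • V.ρ x) = _
    rw [map_smul]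
    rfl
  refine ⟨extChar L (FDRep.of ρ), ⟨FDRep.of ρ, ?_, rfl⟩, fun x => ?_⟩
  · rw [simple_iff_bip] at hV ⊢
    rw [← hV]
    simp only [bip, hc]
    congr 1
    refine Finset.sum_congr rfl fun x _ => ?_
    have : (l x : ℂ) * (l x⁻¹ : ℂˣ) = 1 := by rw [← Units.val_mul, ← map_mul]; simp
    linear_combination (V.character x * V.character x⁻¹) * this
  · rw [extChar_mem, extChar_mem, hc]

theorem list_pow {ι H : Type*} (p : ℕ) (s : List ι) (f : ι → H → ℂ)
    (h : ∀ W ∈ s, ∃ j : ℕ, ∀ g, f W g ^ (p ^ j) = 1) :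
    ∃ j : ℕ, ∀ W ∈ s, ∀ g, f W g ^ (p ^ j) = 1 := by
  induction s with
  | nil => exact ⟨0, by simp⟩
  | cons a s ih =>
    obtain ⟨j, hj⟩ := ih fun W hW => h W (List.mem_cons_of_mem _ hW)
    obtain ⟨i, hi⟩ := h a List.mem_cons_self
    refine ⟨i + j, fun W hW g => ?_⟩
    rcases List.mem_cons.1 hW with rfl | hW
    · rw [pow_add, pow_mul, hi, one_pow]
    · rw [pow_add, mul_comm, pow_mul, hj W hW, one_pow]

theorem det_step (p : ℕ) {K L : Subgroup Γ} (h : K ≤ L)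
    (hn : ∀ g ∈ L, ∀ x, MulAut.conj g x ∈ K ↔ x ∈ K) (hpow : ∀ x ∈ L, x ^ p ∈ K)
    {σ : Γ → ℂ} (hσ : σ ∈ pirr p K) (V : FDRep ℂ L) (hV : Simple V) (hne : ip K (extChar L V) σ ≠ 0) :
    ∃ j : ℕ, ∀ x, rdet V.ρ x ^ (p ^ j) = 1 := by
  classical
  let V' := repComp V (Subgroup.inclusion h)
  obtain ⟨s, hs, hc, hd⟩ := exists_decomp V' V'.ρ
  have hθ : extChar L V ∈ irr L := ⟨V, hV, rfl⟩
  obtain ⟨j, hj⟩ := list_pow p s (fun W g => rdet W.ρ g) (fun W hW => by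
    have hWi : extChar K W ∈ irr K := ⟨W, (hs W hW).1, rfl⟩
    have h1 : ip K (extChar L V) (extChar K W) ≠ 0 := by
      have e : ip K (extChar L V) (extChar K W) = (s.map fun X => ip K (extChar K X) (extChar K W)).sum := by
        rw [ip_eq_bip]
        simp only [ip_extChar]
        rw [← bip_list_left]
        congr 1
        · funext x
          have := extChar_mem V (Subgroup.inclusion h x)
          exact this.trans (hc x)
        · funext x
          exact extChar_mem W x
      rw [e]
      have h2 : (1 : ℂ) ≤ (s.map fun X => ip K (extChar K X) (extChar K W)).sum := by
        rw [← irr_self hWi]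
        refine List.single_le_sum (l := s.map fun X => ip K (extChar K X) (extChar K W)) ?_
          (ip K (extChar K W) (extChar K W)) (List.mem_map.2 ⟨W, hW, rfl⟩)
        intro x hx
        obtain ⟨X, hX, rfl⟩ := List.mem_map.1 hx
        exact ip_nonneg le_rfl ⟨X, (hs X hX).1, rfl⟩ hWi
      exact (lt_of_lt_of_le zero_lt_one h2).ne'
    obtain ⟨g, hg, hgW⟩ := clifford h hn hθ (pirr_irr hσ) hWi hne h1
    obtain ⟨X, hX, hXe, hXp⟩ := aut_pirr p (MulAut.conj g) K K (hn g hg) hσ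
    exact (PPV_congr p X W hX (extChar_inj (hXe.trans hgW.symm)) hXp).2)
  have hK : ∀ x : K, rdet V'.ρ x ^ (p ^ j) = 1 := by
    intro x
    rw [hd x]
    clear hc hd
    induction s with
    | nil => simp
    | cons a s ih =>
      rw [List.map_cons, List.prod_cons, mul_pow, hj a List.mem_cons_self,
        ih (fun W hW => hs W (List.mem_cons_of_mem _ hW)) (fun W hW => hj W (List.mem_cons_of_mem _ hW)), one_mul]
  refine ⟨j + 1, fun x => ?_⟩
  have := hK ⟨(x : Γ) ^ p, hpow x x.2⟩
  rw [pow_succ, mul_comm, pow_mul, ← map_pow]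
  exact this

theorem p_step (p : ℕ) (hp : p.Prime) {K L : Subgroup Γ} (h : K ≤ L) {S : Type} [Group S]
    (ψ : L →* S) (hψ : Function.Surjective ψ) (hker : ∀ x : L, ψ x = 1 ↔ (x : Γ) ∈ K)
    (hS : Nat.card S = p) {σ θ : Γ → ℂ} (hσ : σ ∈ pirr p K) (hθ : θ ∈ irr L) (hne : ip K θ σ ≠ 0) :
    θ ∈ pirr p L := by
  classical
  have hn : ∀ g ∈ L, ∀ x, MulAut.conj g x ∈ K ↔ x ∈ K := by
    have h1 : ∀ g ∈ L, ∀ x ∈ K, MulAut.conj g x ∈ K := by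
      intro g hg x hx
      have : ψ (⟨g, hg⟩ * ⟨x, h hx⟩ * ⟨g, hg⟩⁻¹) = 1 := by
        rw [map_mul, map_mul, (hker ⟨x, h hx⟩).2 hx]; simp
      exact (hker _).1 this
    intro g hg x
    refine ⟨fun hx => ?_, h1 g hg x⟩
    have := h1 g⁻¹ (L.inv_mem hg) _ hx
    simpa [mul_assoc] using this
  have hpow : ∀ x ∈ L, x ^ p ∈ K := by
    intro x hx
    refine (hker ⟨x ^ p, L.pow_mem hx p⟩).1 ?_
    have : (⟨x ^ p, L.pow_mem hx p⟩ : L) = ⟨x, hx⟩ ^ p := rfl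
    rw [this, map_pow, ← hS, pow_card_eq_one']
  have hσ' := pirr_irr hσ
  have hcard : Nat.card L = p * Nat.card K := by
    have h1 := Subgroup.card_eq_card_quotient_mul_card_subgroup ψ.ker
    rw [Nat.card_congr (QuotientGroup.quotientKerEquivOfSurjective ψ hψ).toEquiv, hS] at h1
    rw [h1]
    congr 1
    exact Nat.card_congr
      { toFun := fun x => ⟨x.1.1, (hker x.1).1 x.2⟩
        invFun := fun x => ⟨⟨x.1, h x.2⟩, (hker _).2 x.2⟩
        left_inv := fun x => rfl
        right_inv := fun x => rfl }
  -- orbit computations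
  set t := (orb L σ).card with ht
  obtain ⟨e, he⟩ := ip_nat h hθ hσ'
  have e0 : e ≠ 0 := by rintro rfl; exact hne (by simpa using he)
  have hsub : orb L σ ⊆ irrF K := by
    intro f hf
    obtain ⟨g, -, rfl⟩ := Finset.mem_image.1 hf
    exact mem_irrF.2 (aut_irr _ K K (hn _ g.2) hσ')
  have horb : ∀ f ∈ orb L σ, ip K θ f = e ∧ f 1 = σ 1 := by
    intro f hf
    obtain ⟨g, -, rfl⟩ := Finset.mem_image.1 hf
    refine ⟨?_, by simp⟩
    rw [← he, ← ip_aut _ K K (hn _ g.2) θ σ]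
    exact ip_congr_left K _ fun x _ => ((irr_CF hθ).conj g g.2 x).symm
  have hnorb : ∀ f ∈ irrF K, f ∉ orb L σ → ip K θ f = 0 := by
    intro f hf hfo
    by_contra h0
    obtain ⟨g, hg, rfl⟩ := clifford h hn hθ hσ' (mem_irrF.1 hf) hne h0
    exact hfo (Finset.mem_image.2 ⟨⟨g, hg⟩, Finset.mem_univ _, rfl⟩)
  have hdeg : θ 1 = t * e * σ 1 := by
    rw [irr_expand h (irr_CF hθ) K.one_mem, ← Finset.sum_subset hsub (fun f hf hfo => by
      rw [hnorb f hf hfo, zero_mul]), Finset.sum_congr rfl (g := fun _ => (e : ℂ) * σ 1)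
      (fun f hf => by rw [(horb f hf).1, (horb f hf).2]), Finset.sum_const, nsmul_eq_mul, mul_assoc]
  have hnorm : ip K θ θ = t * e ^ 2 := by
    rw [ip_trans h le_rfl (irr_CF hθ), ← Finset.sum_subset hsub (fun f hf hfo => by
      rw [hnorb f hf hfo, zero_mul]), Finset.sum_congr rfl (g := fun _ => (e : ℂ) * e)
      (fun f hf => by rw [ip_comm K f θ, (horb f hf).1]), Finset.sum_const, nsmul_eq_mul, sq]
  have key : t * e = 1 ∨ t * e = p := by
    by_cases hv : ∀ x ∈ L, x ∉ K → θ x = 0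
    · right
      have h1 := irr_self hθ
      have hsupp : ∀ x, x ∉ K → θ x = 0 := fun x hx => by
        by_cases hxL : x ∈ L
        · exact hv x hxL hx
        · exact (irr_CF hθ).supp x hxL
      rw [ip_univ L _ _ (irr_CF hθ).supp] at h1
      rw [ip_univ K _ _ hsupp] at hnorm
      have cK := card_ne K
      have cL := card_ne L
      have h2 : ((p * Nat.card K : ℕ) : ℂ) = Nat.card K * (t * e ^ 2) := by
        rw [← hnorm, mul_inv_cancel_left₀ cK, ← hcard]
        rw [inv_mul_eq_one₀ cL] at h1
        exact h1
      have h3 : p = t * e ^ 2 := by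
        have : p * Nat.card K = Nat.card K * (t * e ^ 2) := by exact_mod_cast h2
        rw [mul_comm] at this
        exact Nat.eq_of_mul_eq_mul_left Nat.card_pos this
      have h4 : e = 1 := by
        have h5 : e ∣ p := ⟨t * e, by rw [h3]; ring⟩
        rcases (Nat.dvd_prime hp).1 h5 with h6 | h6
        · exact h6
        · exfalso
          rw [h6] at h3
          have : p * p ∣ p := ⟨t, by rw [← sq, mul_comm]; exact h3⟩
          have := Nat.le_of_dvd hp.pos this
          nlinarith [hp.two_le]
      rw [h4] at h3 ⊢
      simpa using h3.symm
    · left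
      push Not at hv
      obtain ⟨x0, hx0, hx0K, hθx0⟩ := hv
      have hpf : Fact p.Prime := ⟨hp⟩
      have hfin : Finite S := Nat.finite_of_card_ne_zero (by rw [hS]; exact hp.ne_zero)
      have hcyc : IsCyclic S := isCyclic_of_prime_card hS
      letI : CommGroup S := IsCyclic.commGroup
      have hψx : ψ ⟨x0, hx0⟩ ≠ 1 := fun h' => hx0K ((hker _).1 h')
      have : NeZero (Monoid.exponent S) := ⟨Monoid.exponent_ne_zero_of_finite⟩
      obtain ⟨l, hl⟩ := CommGroup.exists_apply_ne_one_of_hasEnoughRootsOfUnity S ℂ hψx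
      have hlp : l (ψ ⟨x0, hx0⟩) ^ p = 1 := by
        rw [← map_pow, ← hS, pow_card_eq_one', map_one]
      have hord : orderOf (l (ψ ⟨x0, hx0⟩)) = p := orderOf_eq_prime hlp hl
      have hθi : ∀ i : ℕ, ∃ θ' ∈ irr L, ∀ x : L, θ' x = ((l.comp ψ) ^ i) x * θ x := fun i => irr_twist hθ _
      choose T hT hTx using hθi
      have hinj : Set.InjOn T (Finset.range p : Set ℕ) := by
        intro i hi j hj hij
        have h1 := congrFun hij x0
        have h2 := hTx i ⟨x0, hx0⟩
        have h3 := hTx j ⟨x0, hx0⟩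
        rw [h2, h3] at h1
        have h4 := Units.ext (mul_right_cancel₀ hθx0 h1)
        change l (ψ ⟨x0, hx0⟩) ^ i = l (ψ ⟨x0, hx0⟩) ^ j at h4
        apply pow_injOn_Iio_orderOf _ _ h4
        · rw [hord]; simpa using hi
        · rw [hord]; simpa using hj
      have hTK : ∀ i, ip K (T i) σ = e := fun i => by
        rw [← he]
        refine ip_congr_left K _ fun x hx => ?_
        have h2 := hTx i ⟨x, h hx⟩
        rw [h2]
        have : ψ ⟨x, h hx⟩ = 1 := (hker _).2 hx
        simp [this]
      have hT1 : ∀ i, T i 1 = θ 1 := fun i => by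
        have h2 := hTx i 1
        simpa using h2
      have h5 := ind_one (K := K) (H := L) σ
      rw [ind_expand h hσ' 1, hcard] at h5
      have hsubT : (Finset.range p).image T ⊆ irrF L := by
        intro f hf
        obtain ⟨i, -, rfl⟩ := Finset.mem_image.1 hf
        exact mem_irrF.2 (hT i)
      have h6 : (p : ℂ) * (e * θ 1) ≤ ∑ χ ∈ irrF L, ip K χ σ * χ 1 := by
        refine le_trans ?_ (Finset.sum_le_sum_of_subset_of_nonneg hsubT fun ψ hψ _ =>
          mul_nonneg (ip_nonneg h (mem_irrF.1 hψ) hσ') (irr_pos (mem_irrF.1 hψ)).le)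
        rw [Finset.sum_image hinj]
        simp [hTK, hT1]
      have h7 : (Nat.card K : ℂ) * (p * (e * θ 1)) ≤ (p * Nat.card K : ℕ) * σ 1 := by
        rw [← h5]
        exact mul_le_mul_of_nonneg_left h6 (card_pos' K).le
      rw [hdeg] at h7
      have h8 : ((p * Nat.card K : ℕ) : ℂ) * σ 1 * (t * e ^ 2 : ℕ) ≤ (p * Nat.card K : ℕ) * σ 1 * (1 : ℕ) := by
        convert h7 using 1
        · push_cast; ring
        · push_cast; ring
      have h9 := le_of_mul_le_mul_left h8 (mul_pos (by exact_mod_cast Nat.mul_pos hp.pos Nat.card_pos) (irr_pos hσ'))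
      have h10 : t * e ^ 2 ≤ 1 := by exact_mod_cast h9
      have ht0 : 0 < t := Finset.card_pos.2 (Finset.image_nonempty.2 Finset.univ_nonempty)
      have : e = 1 := by
        have : 0 < e := Nat.pos_of_ne_zero e0
        nlinarith
      subst this
      omega
  obtain ⟨V, hV, rfl⟩ := hθ
  refine ⟨V, hV, rfl, ?_, det_step p h hn hpow hσ V hV hne⟩
  obtain ⟨X, hX, rfl, ⟨i, hi⟩, -⟩ := hσ
  have d1 : (Module.finrank ℂ V : ℂ) = extChar L V 1 := by
    rw [← FDRep.char_one, ← extChar_mem]; rfl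
  have d2 : (Module.finrank ℂ X : ℂ) = extChar K X 1 := by
    rw [← FDRep.char_one, ← extChar_mem]; rfl
  rw [← d1, ← d2, hi] at hdeg
  have d3 : Module.finrank ℂ V = t * e * p ^ i := by exact_mod_cast hdeg
  rcases key with k | k
  · exact ⟨i, by rw [d3, k, one_mul]⟩
  · exact ⟨i + 1, by rw [d3, k, pow_succ, mul_comm]⟩

end PartF3


section PartG
open scoped ComplexOrder

variable {Γ : Type} [Group Γ] [Fintype Γ]

theorem ip_ne_trans {H K L : Subgroup Γ} (h : K ≤ H) (h' : L ≤ K) {θ σ τ : Γ → ℂ} (hθ : θ ∈ irr H)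
    (hσ : σ ∈ irr K) (hτ : τ ∈ irr L) (h1 : ip K θ σ ≠ 0) (h2 : ip L σ τ ≠ 0) : ip L θ τ ≠ 0 := by
  classical
  rw [ip_trans h h' (irr_CF hθ)]
  have h0 : ∀ ψ ∈ irrF K, 0 ≤ ip K θ ψ * ip L ψ τ := fun ψ hψ =>
    mul_nonneg (ip_nonneg h hθ (mem_irrF.1 hψ)) (ip_nonneg h' (mem_irrF.1 hψ) hτ)
  intro h3
  have := (Finset.sum_eq_zero_iff_of_nonneg h0).1 h3 σ (mem_irrF.2 hσ)
  exact mul_ne_zero h1 h2 this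

/-- intersection of kernels -/
def LL {N S : Type} [Group N] [Group S] : List (N →* S) → Subgroup N
  | [] => ⊤
  | f :: l => LL l ⊓ f.ker

theorem mem_LL {N S : Type} [Group N] [Group S] (l : List (N →* S)) (x : N) :
    x ∈ LL l ↔ ∀ f ∈ l, f x = 1 := by
  induction l with
  | nil => simp [LL]
  | cons f l ih => simp [LL, Subgroup.mem_inf, ih, MonoidHom.mem_ker, and_comm]

theorem LL_normal {N S : Type} [Group N] [Group S] (l : List (N →* S)) : (LL l).Normal := by
  constructor
  intro n hn g
  rw [mem_LL] at hn ⊢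
  intro f hf
  simp [hn f hf]

theorem mem_map_sub {N : Subgroup Γ} (L : Subgroup N) (x : Γ) :
    x ∈ L.map N.subtype ↔ ∃ hx : x ∈ N, (⟨x, hx⟩ : N) ∈ L := by
  constructor
  · rintro ⟨y, hy, rfl⟩
    exact ⟨y.2, hy⟩
  · rintro ⟨hx, h⟩
    exact ⟨_, h, rfl⟩

theorem chain_step (p : ℕ) (hp : p.Prime) {N : Subgroup Γ} {S : Type} [Group S] [IsSimpleGroup S]
    (hS : Nat.card S = p ∨ Good p S) (l : List (N →* S)) (hl : ∀ f ∈ l, Function.Surjective f)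
    (σ : Γ → ℂ) (hσ : σ ∈ pirr p ((LL l).map N.subtype))
    (hinv : Nat.card S ≠ p → ∀ g ∈ N, ∀ x, σ (MulAut.conj g x) = σ x) :
    ∃ θ ∈ pirr p N, ip ((LL l).map N.subtype) θ σ ≠ 0 := by
  induction l generalizing σ with
  | nil =>
    have e : (LL ([] : List (N →* S))).map N.subtype = N := by
      ext x; rw [mem_map_sub]; simp [LL]
    rw [e] at hσ ⊢
    exact ⟨σ, hσ, by rw [irr_self (pirr_irr hσ)]; exact one_ne_zero⟩
  | cons f l ih =>
    have ih := ih fun f' hf' => hl f' (List.mem_cons_of_mem _ hf')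
    have hf := hl f List.mem_cons_self
    have hLN : (LL l).map N.subtype ≤ N := by
      intro x hx
      exact ((mem_map_sub _ _).1 hx).1
    have hLL : (LL (f :: l)).map N.subtype ≤ (LL l).map N.subtype :=
      Subgroup.map_mono inf_le_left
    have hnL := LL_normal l
    have hLn : ∀ g ∈ N, ∀ x, MulAut.conj g x ∈ (LL l).map N.subtype ↔ x ∈ (LL l).map N.subtype := by
      have : ∀ g ∈ N, ∀ x, x ∈ (LL l).map N.subtype → MulAut.conj g x ∈ (LL l).map N.subtype := by
        intro g hg x hx
        obtain ⟨hxN, hx⟩ := (mem_map_sub _ _).1 hx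
        refine (mem_map_sub _ _).2 ⟨N.mul_mem (N.mul_mem hg hxN) (N.inv_mem hg), ?_⟩
        exact hnL.conj_mem _ hx ⟨g, hg⟩
      intro g hg x
      refine ⟨fun hx => ?_, this g hg x⟩
      have := this g⁻¹ (N.inv_mem hg) _ hx
      simpa [mul_assoc] using this
    rcases (hnL.map f hf).eq_bot_or_eq_top with hb | ht
    · have e : LL (f :: l) = LL l := by
        refine le_antisymm inf_le_left (le_inf le_rfl ?_)
        exact (Subgroup.map_eq_bot_iff _).1 hb
      rw [e] at hσ ⊢
      exact ih σ hσ hinv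
    · let ψ : (LL l).map N.subtype →* S := f.comp (Subgroup.inclusion hLN)
      have hψ : Function.Surjective ψ := by
        intro s
        have : s ∈ (LL l).map f := by rw [ht]; trivial
        obtain ⟨y, hy, rfl⟩ := this
        exact ⟨⟨y, ⟨y, hy, rfl⟩⟩, rfl⟩
      have hker : ∀ x : (LL l).map N.subtype, ψ x = 1 ↔ (x : Γ) ∈ (LL (f :: l)).map N.subtype := by
        intro x
        rw [mem_map_sub]
        obtain ⟨hxN, hx⟩ := (mem_map_sub _ _).1 x.2
        constructor
        · intro h
          exact ⟨hxN, ⟨hx, h⟩⟩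
        · rintro ⟨_, h⟩
          exact h.2
      by_cases hc : Nat.card S = p
      · obtain ⟨θ0, hθ0, hne⟩ := exists_over hLL (pirr_irr hσ)
        have hθ0' := p_step p hp hLL ψ hψ hker hc hσ hθ0 hne
        obtain ⟨θ, hθ, hne'⟩ := ih θ0 hθ0' (fun h => absurd hc h)
        exact ⟨θ, hθ, ip_ne_trans hLN hLL (pirr_irr hθ) hθ0 (pirr_irr hσ) hne' hne⟩
      · have hG := hS.resolve_left hc
        have hinv := hinv hc
        obtain ⟨θ0, hθ0, hr⟩ := pirr_ext p hp hLL ψ hψ hker hG hσ (fun g hg => hinv g (hLN hg))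
        obtain ⟨θ, hθ, hne'⟩ := ih θ0 hθ0 (fun _ g hg => by
          have h1 := aut_pirr p (MulAut.conj g) _ _ (hLn g hg) hθ0
          have := pirr_unique p hLL ψ hψ hker hG hσ h1 hθ0 (fun x hx => by
            have hx' : MulAut.conj g x ∈ (LL (f :: l)).map N.subtype := by
              obtain ⟨hxN, hx⟩ := (mem_map_sub _ _).1 hx
              refine (mem_map_sub _ _).2 ⟨N.mul_mem (N.mul_mem hg hxN) (N.inv_mem hg), ?_⟩
              exact (LL_normal (f :: l)).conj_mem _ hx ⟨g, hg⟩
            rw [hr _ hx', hinv g hg]) hr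
          exact congrFun this)
        refine ⟨θ, hθ, ip_ne_trans hLN hLL (pirr_irr hθ) (pirr_irr hθ0) (pirr_irr hσ) hne' ?_⟩
        rw [ip_congr_left _ σ hr, irr_self (pirr_irr hσ)]
        exact one_ne_zero

/-- Simple sections above `M` inside `G` have good multipliers. -/
def HS (p : ℕ) (G M : Subgroup Γ) : Prop :=
  ∀ L : Subgroup Γ, L ≤ G → ∀ (S : Type) [Group S] [IsSimpleGroup S], (¬ ∀ a b : S, a * b = b * a) →
    ∀ ψ : L →* S, Function.Surjective ψ → (∀ x : L, (x : Γ) ∈ M → ψ x = 1) →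
      ¬ p ∣ Nat.card (schurMultiplier S)

theorem core (p : ℕ) (hp : p.Prime) (A : Subgroup (MulAut Γ)) (G M : Subgroup Γ) (MG : M < G)
    (aG : ∀ a ∈ A, ∀ x, a x ∈ G ↔ x ∈ G) (aM : ∀ a ∈ A, ∀ x, a x ∈ M ↔ x ∈ M)
    (GA : ∀ g ∈ G, MulAut.conj g ∈ A) (hS : HS p G M) (τ : Γ → ℂ) (hτ : τ ∈ pirr p M)
    (hinv : ∀ g ∈ G, ∀ x, τ (MulAut.conj g x) = τ x) :
    ∃ N : Subgroup Γ, M < N ∧ N ≤ G ∧ (∀ a ∈ A, ∀ x, a x ∈ N ↔ x ∈ N) ∧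
      ∃ θ ∈ pirr p N, ip M θ τ ≠ 0 := by
  classical
  obtain ⟨N, ⟨hMN, hNG, aN⟩, hmin⟩ := Set.Finite.exists_minimal
    (s := {N : Subgroup Γ | M < N ∧ N ≤ G ∧ ∀ a ∈ A, ∀ x, a x ∈ N ↔ x ∈ N}) (Set.toFinite _)
    ⟨G, MG, le_rfl, aG⟩
  obtain ⟨K, ⟨hMK, hKN, hKn⟩, hmax⟩ := Set.Finite.exists_maximal
    (s := {K : Subgroup Γ | M ≤ K ∧ K < N ∧ ∀ g ∈ N, ∀ x ∈ K, MulAut.conj g x ∈ K}) (Set.toFinite _)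
    ⟨M, le_rfl, hMN, fun g hg x hx => (aM _ (GA g (hNG hg)) x).2 hx⟩
  refine ⟨N, hMN, hNG, aN, ?_⟩
  haveI : (K.subgroupOf N).Normal := ⟨fun x hx g => hKn g g.2 x hx⟩
  let S := N ⧸ K.subgroupOf N
  let ψ : N →* S := QuotientGroup.mk' _
  have hψ : Function.Surjective ψ := QuotientGroup.mk'_surjective _
  have hψk : ∀ x : N, ψ x = 1 ↔ (x : Γ) ∈ K := fun x => by
    change (x : S) = 1 ↔ _
    rw [QuotientGroup.eq_one_iff, Subgroup.mem_subgroupOf]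
  haveI : Nontrivial S := by
    obtain ⟨x, hx, hxK⟩ := SetLike.exists_of_lt hKN
    exact ⟨ψ ⟨x, hx⟩, 1, fun h => hxK ((hψk _).1 h)⟩
  haveI : IsSimpleGroup S := ⟨fun H hH => by
    let K' : Subgroup Γ := (H.comap ψ).map N.subtype
    have hK'N : K' ≤ N := fun x hx => ((mem_map_sub _ _).1 hx).1
    have hKK' : K ≤ K' := fun x hx => (mem_map_sub _ _).2 ⟨hKN.le hx, by
      rw [Subgroup.mem_comap, (hψk _).2 hx]; exact H.one_mem⟩
    have hK'n : ∀ g ∈ N, ∀ x ∈ K', MulAut.conj g x ∈ K' := by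
      intro g hg x hx
      obtain ⟨hxN, hx⟩ := (mem_map_sub _ _).1 hx
      refine (mem_map_sub _ _).2 ⟨N.mul_mem (N.mul_mem hg hxN) (N.inv_mem hg), ?_⟩
      exact (hH.comap ψ).conj_mem _ hx ⟨g, hg⟩
    by_cases hlt : K' < N
    · left
      have hle := hmax ⟨hMK.trans hKK', hlt, hK'n⟩ hKK'
      rw [eq_bot_iff]
      intro s hs
      obtain ⟨x, rfl⟩ := hψ s
      rw [Subgroup.mem_bot, hψk]
      exact hle ((mem_map_sub _ _).2 ⟨x.2, hs⟩)
    · right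
      have he : K' = N := (eq_or_lt_of_le hK'N).resolve_right hlt
      rw [eq_top_iff]
      intro s _
      obtain ⟨x, rfl⟩ := hψ s
      have : (x : Γ) ∈ K' := by rw [he]; exact x.2
      exact ((mem_map_sub _ _).1 this).2⟩
  have hcase : Nat.card S = p ∨ Good p S := by
    by_cases hc : ∀ a b : S, a * b = b * a
    · by_cases hd : p ∣ Nat.card S
      · left
        letI : CommGroup S := { (inferInstance : Group S) with mul_comm := hc }
        exact ((Nat.prime_dvd_prime_iff_eq hp IsSimpleGroup.prime_card).1 hd).symm
      · exact Or.inr (good_of_coprime p hp S hd)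
    · refine Or.inr (good_of_simple p hp S hc (hS N hNG S hc ψ hψ fun x hx => (hψk x).2 (hMK hx)))
  haveI : Finite (MulAut Γ) := Finite.of_injective (fun a : MulAut Γ => (a : Γ → Γ)) DFunLike.coe_injective
  haveI : Fintype A := Fintype.ofFinite A
  let l : List (N →* S) := (Finset.univ : Finset A).toList.map fun a : A =>
    ψ.comp (autRes (a : MulAut Γ) N N (aN a a.2)).toMonoidHom
  have hl : ∀ f ∈ l, Function.Surjective f := by
    intro f hf
    obtain ⟨a, -, rfl⟩ := List.mem_map.1 hf
    exact hψ.comp (autRes (a : MulAut Γ) N N (aN a a.2)).surjective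
  let I : Subgroup Γ := (LL l).map N.subtype
  have hI : ∀ x, x ∈ I ↔ x ∈ N ∧ ∀ a ∈ A, a x ∈ K := by
    intro x
    rw [mem_map_sub]
    constructor
    · rintro ⟨hx, h⟩
      refine ⟨hx, fun a ha => ?_⟩
      rw [mem_LL] at h
      have h1 := h (ψ.comp (autRes a N N (aN a ha)).toMonoidHom)
        (List.mem_map.2 ⟨⟨a, ha⟩, by simp, rfl⟩)
      exact (hψk (autRes a N N (aN a ha) ⟨x, hx⟩)).1 h1
    · rintro ⟨hx, h⟩
      refine ⟨hx, (mem_LL _ _).2 fun f hf => ?_⟩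
      obtain ⟨a, -, rfl⟩ := List.mem_map.1 hf
      exact (hψk _).2 (h a a.2)
  have hMI : M ≤ I := fun x hx => (hI x).2 ⟨hMN.le hx, fun a ha => hMK ((aM a ha x).2 hx)⟩
  have hIK : I ≤ K := fun x hx => ((hI x).1 hx).2 1 A.one_mem
  have hIM : I = M := by
    by_contra hne
    have h1 : M < I := lt_of_le_of_ne hMI (Ne.symm hne)
    have h2 := hmin (y := I) ⟨h1, (hIK.trans hKN.le).trans hNG, fun a ha x => by
      rw [hI, hI, aN a ha]
      refine and_congr_right fun _ => ⟨fun h b hb => ?_, fun h b hb => h (b * a) (A.mul_mem hb ha)⟩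
      have := h (b * a⁻¹) (A.mul_mem hb (A.inv_mem ha))
      simpa using this⟩ (hIK.trans hKN.le)
    exact absurd (h2.trans hIK) (not_le_of_gt hKN)
  obtain ⟨θ, hθ, hne⟩ := chain_step p hp hcase l hl τ (by change τ ∈ pirr p I; rwa [hIM])
    (fun _ g hg => hinv g (hNG hg))
  exact ⟨θ, hθ, by change ip I θ τ ≠ 0 at hne; rwa [hIM] at hne⟩

end PartG


section PartH
open scoped ComplexOrder

variable {Γ : Type} [Group Γ] [Fintype Γ]

/-- the conclusion of the theorem, relative to `A` -/
def Concl (p : ℕ) (A : Subgroup (MulAut Γ)) (G M U : Subgroup Γ) (τ φ : Γ → ℂ) : Prop :=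
  ∃ W : Subgroup Γ, U ≤ W ∧ W ≤ G ∧ ∃ θ ∈ pirr p W, ip U θ τ ≠ 0 ∧ indChar W G θ ∈ irr G ∧
    ip M (indChar W G θ) φ ≠ 0 ∧
    ∀ a ∈ A, (∀ x, indChar W G θ (a x) = indChar W G θ x) →
      ∃ g ∈ G, (MulAut.conj g)⁻¹ * a ∈ stab A W θ

theorem glue (p : ℕ) {A : Subgroup (MulAut Γ)} {G M U : Subgroup Γ} {τ φ : Γ → ℂ}
    (h : Red A G M U τ φ) (hc : Concl p (stab A U τ) (nst A G U τ) U U τ τ) :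
    Concl p A G M U τ φ := by
  obtain ⟨W, hUW, hWN, θ, hθ, hne, hη, hneη, hst⟩ := hc
  have e := ind_trans (K := W) h.NG θ
  obtain ⟨h1, h2, -, -⟩ := h.D3 hη hneη
  rw [e] at h1 h2
  refine ⟨W, hUW, hWN.trans h.NG, θ, hθ, hne, h1, h2, fun a ha hfix => ?_⟩
  obtain ⟨g, hg, b, hb, hab, hbη⟩ := h.D4 hη hneη e.symm a ha hfix
  obtain ⟨g', hg', hs⟩ := hst b hb hbη
  refine ⟨g * g', G.mul_mem hg (h.NG hg'), ?_⟩
  have e2 : (MulAut.conj (g * g'))⁻¹ * a = (MulAut.conj g')⁻¹ * b := by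
    rw [hab, map_mul]; group
  rw [e2]
  exact ⟨hs.1.1, hs.2⟩

theorem ind_self {M : Subgroup Γ} {τ : Γ → ℂ} (h : τ ∈ irr M) : indChar M M τ = τ :=
  ind_eq le_rfl h h (by rw [irr_self h]; exact one_ne_zero) le_rfl

theorem HS.mono {p : ℕ} {G M G' M' : Subgroup Γ} (h : HS p G M) (hG : G' ≤ G)
    (hM : ∀ x ∈ G', x ∈ M → x ∈ M') : HS p G' M' := by
  intro L hL S _ _ hnc ψ hψ hk
  exact h L (hL.trans hG) S hnc ψ hψ fun x hx => hk x (hM x (hL x.2) hx)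

theorem inv_main (p : ℕ) (hp : p.Prime) (n : ℕ) : ∀ (A : Subgroup (MulAut Γ)) (G M : Subgroup Γ) (τ : Γ → ℂ),
    Nat.card G - Nat.card M ≤ n → M ≤ G → (∀ a ∈ A, ∀ x, a x ∈ G ↔ x ∈ G) →
    (∀ a ∈ A, ∀ x, a x ∈ M ↔ x ∈ M) → (∀ g ∈ G, MulAut.conj g ∈ A) → HS p G M → τ ∈ pirr p M →
    (∀ a ∈ A, ∀ x, τ (a x) = τ x) → Concl p A G M M τ τ := by
  induction n with
  | zero =>
    intro A G M τ hn MG aG aM GA hS hτ hinv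
    have e : M = G := Subgroup.eq_of_le_of_card_ge MG (by omega)
    subst e
    have h1 : ip M τ τ ≠ 0 := by rw [irr_self (pirr_irr hτ)]; exact one_ne_zero
    refine ⟨M, le_rfl, le_rfl, τ, hτ, h1, ?_, ?_, fun a ha _ => ⟨1, M.one_mem, ?_⟩⟩
    · rw [ind_self (pirr_irr hτ)]; exact pirr_irr hτ
    · rwa [ind_self (pirr_irr hτ)]
    · simpa using mem_stab.2 ⟨ha, aM a ha, hinv a ha⟩
  | succ n ih =>
    intro A G M τ hn MG aG aM GA hS hτ hinv
    rcases eq_or_lt_of_le MG with e | hlt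
    · exact ih A G M τ (by rw [e]; omega) MG aG aM GA hS hτ hinv
    obtain ⟨N, hMN, hNG, aN, θ, hθ, hne⟩ := core p hp A G M hlt aG aM GA hS τ hτ
      (fun g hg => hinv _ (GA g hg))
    have hR : Red A G N N θ θ :=
      { UM := le_rfl, MG := hNG, aG := aG, aM := aN, GA := GA, hτ := pirr_irr hθ, hφ := pirr_irr hθ,
        ind := ind_self (pirr_irr hθ)
        hconj := fun a ha hf => ⟨1, N.one_mem, by simpa using mem_stab.2 ⟨ha, aN a ha, hf⟩⟩ }
    have hlt1 : Nat.card M < Nat.card N := by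
      by_contra hh
      exact hMN.ne (Subgroup.eq_of_le_of_card_ge hMN.le (not_lt.1 hh))
    have hle2 : Nat.card (nst A G N θ) ≤ Nat.card G := Subgroup.card_le_of_le hR.NG
    have hle3 : Nat.card N ≤ Nat.card (nst A G N θ) := Subgroup.card_le_of_le hR.UN
    have hc := ih (stab A N θ) (nst A G N θ) N θ (by omega) hR.UN hR.bN (fun a ha => ha.2.1)
      (fun g hg => (mem_nst.1 hg).2) (hS.mono hR.NG fun x _ hx => hMN.le hx) hθ (fun a ha => ha.2.2)
    obtain ⟨W, hNW, hWG, θ', hθ', h1, h2, h3, h4⟩ := glue p hR hc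
    exact ⟨W, hMN.le.trans hNW, hWG, θ', hθ',
      ip_ne_trans hNW hMN.le (pirr_irr hθ') (pirr_irr hθ) (pirr_irr hτ) h1 hne, h2,
      ip_ne_trans hNG hMN.le h2 (pirr_irr hθ) (pirr_irr hτ) h3 hne, h4⟩

theorem comp_series {X : Type} [Group X] [Finite X] (n : ℕ) : ∀ (K : Subgroup X), Nat.card K ≤ n →
    ∃ (m : ℕ) (c : ℕ → Subgroup X), c 0 = ⊥ ∧ c m = K ∧
    (∀ i < m, c i ≤ c (i + 1) ∧ ((c i).subgroupOf (c (i + 1))).Normal ∧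
      c i ≠ c (i + 1) ∧
      ∀ J : Subgroup X, c i ≤ J → J ≤ c (i + 1) →
        (J.subgroupOf (c (i + 1))).Normal → J = c i ∨ J = c (i + 1)) := by
  induction n with
  | zero =>
    intro K hK
    have : 0 < Nat.card K := Nat.card_pos
    omega
  | succ n ih =>
    intro K hK
    by_cases hb : K = ⊥
    · exact ⟨0, fun _ => ⊥, rfl, hb.symm, by simp⟩
    obtain ⟨L, ⟨hLK, hLn⟩, hmax⟩ := Set.Finite.exists_maximal
      (s := {L : Subgroup X | L < K ∧ (L.subgroupOf K).Normal}) (Set.toFinite _)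
      ⟨⊥, bot_lt_iff_ne_bot.2 hb, by rw [Subgroup.bot_subgroupOf]; infer_instance⟩
    have hlt : Nat.card L < Nat.card K := by
      by_contra hh
      exact hLK.ne (Subgroup.eq_of_le_of_card_ge hLK.le (not_lt.1 hh))
    obtain ⟨m, c, h0, hm, hc⟩ := ih L (by omega)
    obtain ⟨c', hc'⟩ : ∃ c' : ℕ → Subgroup X, c' = fun i => if i ≤ m then c i else K := ⟨_, rfl⟩
    have c0 : ∀ i ≤ m, c' i = c i := fun i hi => by simp [hc', hi]
    have c1 : c' (m + 1) = K := by simp [hc']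
    refine ⟨m + 1, c', by rw [c0 0 (by omega), h0], c1, fun i hi => ?_⟩
    by_cases him : i < m
    · rw [c0 i him.le, c0 (i + 1) him]
      exact hc i him
    · have e : i = m := by omega
      subst e
      rw [c1, c0 i le_rfl, hm]
      refine ⟨hLK.le, hLn, hLK.ne, fun J h1 h2 h3 => ?_⟩
      rcases eq_or_lt_of_le h2 with h | h
      · exact Or.inr h
      · exact Or.inl (le_antisymm (hmax ⟨h, h3⟩ h1) h1)

theorem comp_factor {X S : Type} [Group X] [Finite X] [Group S] [IsSimpleGroup S] (ψ : X →* S)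
    (hψ : Function.Surjective ψ) : IsCompositionFactorOf S X := by
  obtain ⟨m, c, h0, hm, hc⟩ := comp_series (Nat.card ψ.ker) ψ.ker le_rfl
  have hlt : ψ.ker ≠ ⊤ := by
    intro h
    obtain ⟨s, hs⟩ := exists_ne (1 : S)
    obtain ⟨x, rfl⟩ := hψ s
    exact hs (MonoidHom.mem_ker.1 (by rw [h]; trivial))
  obtain ⟨c', hc'⟩ : ∃ c' : ℕ → Subgroup X, c' = fun i => if i ≤ m then c i else ⊤ := ⟨_, rfl⟩
  have c0 : ∀ i ≤ m, c' i = c i := fun i hi => by simp [hc', hi]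
  have c1 : c' m = ψ.ker := by rw [c0 m le_rfl, hm]
  have c2 : c' (m + 1) = ⊤ := by simp [hc']
  refine ⟨m + 1, c', by rw [c0 0 (by omega), h0], c2, fun i hi => ?_, m, by omega, ψ.comp (c' (m + 1)).subtype, ?_, ?_⟩
  · by_cases him : i < m
    · rw [c0 i him.le, c0 (i + 1) him]
      exact hc i him
    · have e : i = m := by omega
      subst e
      rw [c1, c2]
      refine ⟨le_top, inferInstance, hlt, fun J h1 _ h3 => ?_⟩
      have hJ : J.Normal := ⟨fun x hx g => h3.conj_mem ⟨x, trivial⟩ hx ⟨g, trivial⟩⟩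
      rcases (hJ.map ψ hψ).eq_bot_or_eq_top with h | h
      · exact Or.inl (le_antisymm ((Subgroup.map_eq_bot_iff _).1 h) h1)
      · right
        rw [eq_top_iff]
        intro x _
        have : ψ x ∈ J.map ψ := by rw [h]; trivial
        obtain ⟨y, hy, hxy⟩ := this
        have h5 : y⁻¹ * x ∈ J := h1 (by rw [MonoidHom.mem_ker, map_mul, map_inv, hxy]; simp)
        simpa using J.mul_mem hy h5
  · intro s
    obtain ⟨x, rfl⟩ := hψ s
    exact ⟨⟨x, by rw [c2]; trivial⟩, rfl⟩
  · rw [c1]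
    ext x
    rfl

theorem HS_of (p : ℕ) (M : Subgroup Γ) [M.Normal]
    (hcf : ∀ H : Subgroup Γ, M ≤ H →
      ∀ (S : Type) [Group S], (¬∀ a b : S, a * b = b * a) →
        IsCompositionFactorOf S ↥(H.map (QuotientGroup.mk' M)) →
        ¬ p ∣ Nat.card (schurMultiplier S)) : HS p ⊤ M := by
  intro L _ S _ _ hnc ψ hψ hk
  refine hcf (L ⊔ M) le_sup_right S hnc ?_
  let f : L →* (L ⊔ M).map (QuotientGroup.mk' M) :=
    ((QuotientGroup.mk' M).subgroupMap (L ⊔ M)).comp (Subgroup.inclusion le_sup_left)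
  have hf : Function.Surjective f := by
    rintro ⟨y, hy⟩
    rw [Subgroup.map_sup, QuotientGroup.map_mk'_self, sup_bot_eq] at hy
    obtain ⟨x, hx, rfl⟩ := hy
    exact ⟨⟨x, hx⟩, rfl⟩
  have hker : f.ker ≤ ψ.ker := by
    intro x hx
    have h1 : ((x : Γ) : Γ ⧸ M) = 1 := congrArg Subtype.val hx
    rw [QuotientGroup.eq_one_iff] at h1
    exact hk x h1
  haveI : Finite ((L ⊔ M).map (QuotientGroup.mk' M)) := Finite.of_surjective f hf
  refine comp_factor (MonoidHom.liftOfSurjective f hf ⟨ψ, hker⟩) ?_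
  intro s
  obtain ⟨x, rfl⟩ := hψ s
  exact ⟨f x, MonoidHom.liftOfRightInverse_comp_apply f _ _ ⟨ψ, hker⟩ x⟩

end PartH


section PartI

variable {Γ : Type} [Group Γ] [Fintype Γ]

theorem indTop_eq (W : Subgroup Γ) (f : Γ → ℂ) : indCharTop W f = indChar W ⊤ f := by
  classical
  funext x
  simp only [indCharTop, indChar]
  congr 1
  exact Fintype.sum_equiv Subgroup.topEquiv.symm.toEquiv _ _ fun g => rfl

theorem irr_top {χ : Γ → ℂ} (h : χ ∈ irr (⊤ : Subgroup Γ)) :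
    ∃ V : FDRep ℂ Γ, Simple V ∧ V.character = χ := by
  classical
  obtain ⟨V, hV, rfl⟩ := h
  refine ⟨_, repComp_simple V hV (Subgroup.topEquiv (G := Γ)).symm, ?_⟩
  funext x
  rw [repComp_char]
  exact (extChar_mem V ⟨x, trivial⟩).symm

theorem conj_transfer {W : Subgroup Γ} {θ : Γ → ℂ} {A : Subgroup (MulAut Γ)} {c : MulAut Γ} {g : Γ}
    (h : (MulAut.conj g)⁻¹ * c ∈ stab A W θ) :
    W.map c.toMonoidHom = W.map (MulAut.conj g).toMonoidHom ∧
      ∀ y : Γ, θ (c⁻¹ y) = θ ((MulAut.conj g)⁻¹ y) := by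
  have e : ∀ y, ((MulAut.conj g)⁻¹ * c) (c⁻¹ y) = (MulAut.conj g)⁻¹ y := fun y => by
    rw [← MulAut.mul_apply, mul_assoc, mul_inv_cancel, mul_one]
  have hm : ∀ (d : MulAut Γ) (y : Γ), y ∈ W.map d.toMonoidHom ↔ d⁻¹ y ∈ W := by
    intro d y
    constructor
    · rintro ⟨x, hx, rfl⟩
      have : d⁻¹ (d.toMonoidHom x) = x := by
        change (d⁻¹ * d) x = x
        simp
      rw [this]
      exact hx
    · intro hy
      refine ⟨d⁻¹ y, hy, ?_⟩
      change (d * d⁻¹) y = y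
      simp
  constructor
  · ext y
    rw [hm, hm, ← e y, h.2.1]
  · intro y
    rw [← e y, h.2.2]

end PartI

/-- Clifford-theoretic going-up lemma (Lemma on the existence of characters lying over
a given pair `(U, τ)`): parts (i)–(iii). -/
theorem exists_character_over {G : Type} [Group G] [Fintype G]
    (p : ℕ) (hp : p.Prime) (hpodd : Odd p) (M : Subgroup G) [M.Normal]
    (hcf : ∀ H : Subgroup G, M ≤ H →
      ∀ (S : Type) [Group S], (¬∀ a b : S, a * b = b * a) →
        IsCompositionFactorOf S ↥(H.map (QuotientGroup.mk' M)) →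
        ¬ p ∣ Nat.card (schurMultiplier S))
    (φV : FDRep ℂ ↥M) (hφ : Simple φV)
    (U : Subgroup G) (hUM : U ≤ M) (τV : FDRep ℂ ↥U) (hτ : Simple τV)
    (hind : extChar M φV = indChar U M (extChar U τV))
    (hτp : ∃ k : ℕ, Module.finrank ℂ τV * charDetOrder τV = p ^ k)
    (hconj : ∀ b : MulAut ↥M, (∀ x : ↥M, φV.character (b x) = φV.character x) →
      ∃ m : ↥M, (U.subgroupOf M).map b.toMonoidHom
          = (U.subgroupOf M).map (MulAut.conj m).toMonoidHom ∧
        ∀ y : ↥M, extChar U τV ↑(b⁻¹ y) = extChar U τV ↑((MulAut.conj m)⁻¹ y)) :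
    ∃ W : Subgroup G, U ≤ W ∧ ∃ θV : FDRep ℂ ↥W, Simple θV ∧
      charInner U (extChar W θV) (extChar U τV) ≠ 0 ∧
      ∃ χV : FDRep ℂ G, Simple χV ∧
        (∀ x : G, χV.character x = indCharTop W (extChar W θV) x) ∧
        charInner M χV.character (extChar M φV) ≠ 0 ∧
        (∃ k : ℕ, Module.finrank ℂ θV * charDetOrder θV = p ^ k) ∧
        ∀ c : MulAut G, M.map c.toMonoidHom = M →
          (∀ x : G, χV.character (c x) = χV.character x) →
          ∃ g : G, W.map c.toMonoidHom = W.map (MulAut.conj g).toMonoidHom ∧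
            ∀ y : G, extChar W θV (c⁻¹ y) = extChar W θV ((MulAut.conj g)⁻¹ y) := by
  classical
  have hτi : extChar U τV ∈ irr U := ⟨τV, hτ, rfl⟩
  have hτpi : extChar U τV ∈ pirr p U := ⟨τV, hτ, rfl, (PPV_iff p hp τV).2 hτp⟩
  have hφi : extChar M φV ∈ irr M := ⟨φV, hφ, rfl⟩
  set τ := extChar U τV with hτdef
  -- the automorphisms leaving M invariant
  let A : Subgroup (MulAut G) := stab ⊤ M (fun _ => 0)
  have hA : ∀ a : MulAut G, a ∈ A ↔ ∀ x, a x ∈ M ↔ x ∈ M := fun a =>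
    ⟨fun h => h.2.1, fun h => mem_stab.2 ⟨trivial, h, fun _ => rfl⟩⟩
  have hMn : ∀ (g x : G), MulAut.conj g x ∈ M ↔ x ∈ M := fun g x =>
    ((inferInstance : M.Normal).mem_comm_iff.trans (by simp [MulAut.conj_apply, mul_assoc]))
  have hR : Red A ⊤ M U τ (extChar M φV) :=
    { UM := hUM
      MG := le_top
      aG := fun a _ x => by simp
      aM := fun a ha => (hA a).1 ha
      GA := fun g _ => (hA _).2 (hMn g)
      hτ := hτi
      hφ := hφi
      ind := hind.symm
      hconj := fun a ha hfix => by
        have haM := (hA a).1 ha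
        let b : MulAut M := autRes a M M haM
        obtain ⟨m, h1, h2⟩ := hconj b (fun x => by
          have := hfix x
          rw [extChar_mem φV x, ← extChar_mem φV (b x)] at *
          exact this)
        have hmA : MulAut.conj (m : G) ∈ A := (hA _).2 (hMn m)
        have hdA := A.mul_mem (A.inv_mem hmA) ha
        have hdM := (hA _).1 hdA
        have hval : ∀ x : M, (((MulAut.conj m)⁻¹ (b x) : M) : G) = ((MulAut.conj (m : G))⁻¹ * a) x := by
          intro x
          simp [b, autRes]
        refine ⟨m, m.2, mem_stab.2 ⟨hdA, fun x => ?_, fun x => ?_⟩⟩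
        · by_cases hx : x ∈ M
          · have hv := hval ⟨x, hx⟩
            change _ = ((MulAut.conj (m : G))⁻¹ * a) x at hv
            rw [← hv]
            constructor
            · intro hu
              have : b ⟨x, hx⟩ ∈ (U.subgroupOf M).map (MulAut.conj m).toMonoidHom :=
                ⟨(MulAut.conj m)⁻¹ (b ⟨x, hx⟩), hu, by
                  change (MulAut.conj m * (MulAut.conj m)⁻¹) (b ⟨x, hx⟩) = _
                  simp⟩
              rw [← h1] at this
              obtain ⟨u, hu, he⟩ := this
              have : u = ⟨x, hx⟩ := b.injective he
              rw [this] at hu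
              exact hu
            · intro hu
              have : b ⟨x, hx⟩ ∈ (U.subgroupOf M).map b.toMonoidHom := ⟨⟨x, hx⟩, hu, rfl⟩
              rw [h1] at this
              obtain ⟨u, hu, he⟩ := this
              have : (MulAut.conj m)⁻¹ (b ⟨x, hx⟩) = u := by
                rw [← he]
                change ((MulAut.conj m)⁻¹ * MulAut.conj m) u = u
                simp
              rw [this]
              exact hu
          · exact ⟨fun h => absurd ((hdM x).1 (hUM h)) hx, fun h => absurd (hUM h) hx⟩
        · by_cases hx : x ∈ M
          · have hv := hval ⟨x, hx⟩
            change _ = ((MulAut.conj (m : G))⁻¹ * a) x at hv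
            rw [← hv, ← h2]
            have : b⁻¹ (b ⟨x, hx⟩) = ⟨x, hx⟩ := by
              change (b⁻¹ * b) ⟨x, hx⟩ = _
              simp
            rw [this]
          · rw [(irr_CF hτi).supp _ (fun h => hx (hUM h)),
              (irr_CF hτi).supp _ (fun h => hx ((hdM x).1 (hUM h)))] }
  have hHS := HS_of p M hcf
  have hc := inv_main p hp _ (stab A U τ) (nst A ⊤ U τ) U τ le_rfl hR.UN hR.bN (fun a ha => ha.2.1)
    (fun g hg => (mem_nst.1 hg).2) (hHS.mono le_top fun x hx hxM => hR.D1 ⟨hxM, hx⟩) hτpi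
    (fun a ha => ha.2.2)
  obtain ⟨W, hUW, -, θ, ⟨θV, hθV, rfl, hP⟩, h1, h2, h3, h4⟩ := glue p hR hc
  obtain ⟨χV, hχV, hχ⟩ := irr_top h2
  refine ⟨W, hUW, θV, hθV, ?_, χV, hχV, fun x => ?_, ?_, (PPV_iff p hp θV).1 hP, fun c hcM hfix => ?_⟩
  · rw [hτdef, charInner_eq_ip]
    exact h1
  · rw [indTop_eq, hχ]
  · rw [charInner_eq_ip, hχ]
    exact h3
  · rw [hχ] at hfix
    obtain ⟨g, -, hg⟩ := h4 c ((hA c).2 fun x => by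
      constructor
      · intro h
        rw [← hcM] at h
        obtain ⟨y, hy, he⟩ := h
        have : y = x := c.injective he
        rwa [← this]
      · intro h
        rw [← hcM]
        exact ⟨x, h, rfl⟩) hfix
    exact ⟨g, conj_transfer hg⟩
end

section
/- Let G be a finite group, N ⊴ G, and p a prime. If G/N has a rational element of order p, then G has a rational element of order p. -/
/-- An element `x` of a finite group is *rational* if it is conjugate to every
generator of the cyclic group `⟨x⟩`. -/
def IsRationalElement {G : Type*} [Group G] (x : G) : Prop :=
  ∀ y : G, Subgroup.zpowers y = Subgroup.zpowers x → IsConj x y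

open scoped Pointwise

theorem aux_center {P : Type*} [Group P] [Finite P] {p : ℕ} [Fact p.Prime] (hP : IsPGroup p P)
    (H : Subgroup P) [H.Normal] (h : H ≠ ⊥) : ∃ k ∈ H, k ∈ Subgroup.center P ∧ k ≠ 1 := by
  have hP' : IsPGroup p (ConjAct P) := hP
  have hH : IsPGroup p H := hP.to_subgroup H
  have hd : p ∣ Nat.card H := by
    rcases hH.card_eq_or_dvd with h1 | h1
    · exact absurd (Subgroup.card_eq_one.mp h1) h
    · exact h1
  have h1 : (1 : H) ∈ MulAction.fixedPoints (ConjAct P) H := by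
    intro g
    simp
  obtain ⟨b, hb, hne⟩ := hP'.exists_fixed_point_of_prime_dvd_card_of_fixed_point H hd h1
  refine ⟨b, b.2, ?_, ?_⟩
  · rw [Subgroup.mem_center_iff]
    intro g
    have := congrArg Subtype.val (hb (ConjAct.toConjAct g))
    rw [ConjAct.Subgroup.val_conj_smul, ConjAct.smul_def, ConjAct.ofConjAct_toConjAct] at this
    exact mul_inv_eq_iff_eq_mul.mp this
  · intro hb1
    exact hne (Subtype.ext hb1.symm)

theorem aux_eigen {P : Type*} [Group P] [Finite P] (K : Subgroup P)
    (hKc : K ≤ Subgroup.center P) (ψ : P →* P) (hψ : ∀ k ∈ K, ψ k ∈ K) (m : ℕ) (y : P)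
    (hy : y ∉ K) (hym : ψ y * (y ^ m)⁻¹ ∈ K) : ∃ w, w ≠ 1 ∧ ψ w = w ^ m := by
  have hcomm : ∀ k ∈ K, ∀ g, Commute k g := fun k hk g =>
    ((Subgroup.mem_center_iff.mp (hKc hk)) g).symm
  have hKn : K.Normal := ⟨fun k hk g => by
    rw [← (hcomm k hk g).eq, mul_assoc, mul_inv_cancel, mul_one]; exact hk⟩
  let P1 := K ⊔ Subgroup.zpowers y
  have hmem : ∀ w ∈ P1, ∃ k ∈ K, ∃ i : ℕ, w = k * y ^ i := by
    intro w hw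
    obtain ⟨k, hk, z, hz, rfl⟩ := Subgroup.mem_sup_of_normal_left.mp hw
    obtain ⟨i, rfl⟩ := mem_powers_iff_mem_zpowers.mpr hz
    exact ⟨k, hk, i, rfl⟩
  have hf : ∀ w ∈ P1, ψ w * (w ^ m)⁻¹ ∈ K := by
    intro w hw
    obtain ⟨k, hk, i, rfl⟩ := hmem w hw
    rw [← QuotientGroup.eq_one_iff] at hym ⊢
    have e1 : ((ψ k : P) : P ⧸ K) = 1 := (QuotientGroup.eq_one_iff _).mpr (hψ k hk)
    have e2 : ((k : P) : P ⧸ K) = 1 := (QuotientGroup.eq_one_iff _).mpr hk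
    have e3 : ((ψ y : P) : P ⧸ K) = (y : P ⧸ K) ^ m := by
      rw [← mul_inv_eq_one]; simpa using hym
    simp only [map_mul, map_pow, QuotientGroup.mk_mul, QuotientGroup.mk_inv, QuotientGroup.mk_pow,
      e1, e2, e3, one_mul]
    rw [← pow_mul, ← pow_mul, mul_comm, mul_inv_cancel]
  let f : P1 → K := fun w => ⟨ψ w * ((w : P) ^ m)⁻¹, hf w w.2⟩
  have hni : ¬ Function.Injective f := by
    intro hinj
    have hc := Nat.card_le_card_of_injective f hinj
    have hle : K ≤ P1 := le_sup_left
    have := Subgroup.eq_of_le_of_card_ge hle hc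
    apply hy
    rw [this]
    exact Subgroup.mem_sup_right (Subgroup.mem_zpowers y)
  simp only [Function.Injective, not_forall] at hni
  obtain ⟨⟨a, ha⟩, ⟨b, hb⟩, hab, hne⟩ := hni
  have hab' : ψ a * (a ^ m)⁻¹ = ψ b * (b ^ m)⁻¹ := congrArg Subtype.val hab
  have hcab : Commute a b := by
    obtain ⟨k, hk, i, rfl⟩ := hmem a ha
    obtain ⟨l, hl, j, rfl⟩ := hmem b hb
    exact (hcomm k hk _).mul_left (((hcomm l hl _).symm).mul_right (Commute.pow_pow_self y i j))
  refine ⟨a * b⁻¹, fun h => hne (Subtype.ext (mul_inv_eq_one.mp h)), ?_⟩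
  have hk := hf b hb
  set c := ψ b * (b ^ m)⁻¹ with hc
  have ea : ψ a = c * a ^ m := by rw [← hab']; group
  have eb : ψ b = c * b ^ m := by rw [hc]; group
  rw [map_mul, map_inv, ea, eb, hcab.inv_right.mul_pow, (hcomm c hk (a ^ m)).eq, inv_pow,
    (hcomm c hk (b ^ m)).eq, mul_inv_rev]
  group

theorem aux_pgroup {p : ℕ} [Fact p.Prime] {A : Type*} [Group A] (hA : ∀ a : A, a ^ p = 1)
    (m : ℕ) (n : ℕ) : ∀ (P : Type*) [Group P] [Finite P], Nat.card P ≤ n → IsPGroup p P →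
    ∀ (φ : P →* P), Function.Surjective φ → ∀ χ : P →* A, (∀ w, χ (φ w) = χ w ^ m) →
    ∀ z, χ z ≠ 1 → ∃ y u : P, orderOf y = p ∧ φ y = u * y ^ m * u⁻¹ := by
  induction n with
  | zero =>
    intro P _ _ h
    exact absurd h (by have := Nat.card_pos (α := P); omega)
  | succ n ih =>
    intro P _ _ hn hP φ hφ χ hχ z hz
    by_cases hker : χ.ker = ⊥
    · have hinj := (MonoidHom.ker_eq_bot_iff χ).mp hker
      refine ⟨z, 1, ?_, ?_⟩
      · apply orderOf_eq_prime
        · apply hinj; rw [map_pow, hA, map_one]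
        · rintro rfl; exact hz (map_one χ)
      · apply hinj; simp [hχ]
    obtain ⟨k, hk, hkc, hk1⟩ := aux_center hP χ.ker hker
    let K := Subgroup.center P ⊓ χ.ker
    have hKc : K ≤ Subgroup.center P := inf_le_left
    have hφK : ∀ k ∈ K, φ k ∈ K := by
      rintro k ⟨h1, h2⟩
      refine ⟨?_, ?_⟩
      · refine Subgroup.mem_center_iff.mpr fun g => ?_
        obtain ⟨g, rfl⟩ := hφ g
        rw [← map_mul, ← map_mul, Subgroup.mem_center_iff.mp h1 g]
      · have h2' : χ k = 1 := h2
        change χ (φ k) = 1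
        rw [hχ, h2', one_pow]
    have hcard : Nat.card (P ⧸ K) ≤ n := by
      have h1 := Subgroup.card_eq_card_quotient_mul_card_subgroup K
      have h2 : 1 < Nat.card K := by
        rw [Finite.one_lt_card_iff_nontrivial]
        exact ⟨⟨⟨k, hkc, hk⟩, 1, fun h => hk1 (congrArg Subtype.val h)⟩⟩
      have h3 := Nat.card_pos (α := P ⧸ K)
      nlinarith
    have hmapsurj : Function.Surjective (QuotientGroup.map K K φ hφK) := by
      intro q
      induction q using QuotientGroup.induction_on with
      | H g =>
        obtain ⟨g, rfl⟩ := hφ g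
        exact ⟨(g : P ⧸ K), rfl⟩
    obtain ⟨y, u, hy, hyu⟩ := ih (P ⧸ K) hcard (hP.to_quotient K) (QuotientGroup.map K K φ hφK)
      hmapsurj (QuotientGroup.lift K χ inf_le_right) (by
        intro w
        induction w using QuotientGroup.induction_on with
        | H g => exact hχ g) (z : P ⧸ K) hz
    induction y using QuotientGroup.induction_on with
    | H y =>
    induction u using QuotientGroup.induction_on with
    | H u =>
    let ψ : P →* P := (MulAut.conj u⁻¹).toMonoidHom.comp φ
    have hψ : ∀ w, ψ w = u⁻¹ * φ w * u := fun w => by simp [ψ]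
    have hyu' : ((φ y : P) : P ⧸ K) = u * (y : P ⧸ K) ^ m * (u : P ⧸ K)⁻¹ := hyu
    obtain ⟨w, hw1, hw⟩ := aux_eigen K hKc ψ (by
      intro k hk
      rw [hψ, mul_assoc, ← Subgroup.mem_center_iff.mp (hKc (hφK k hk)) u, inv_mul_cancel_left]
      exact hφK k hk) m y (by
      intro h
      rw [(QuotientGroup.eq_one_iff y).mpr h, orderOf_one] at hy
      exact (Fact.out : p.Prime).one_lt.ne hy) (by
      rw [← QuotientGroup.eq_one_iff, hψ]
      simp only [QuotientGroup.mk_mul, QuotientGroup.mk_inv, QuotientGroup.mk_pow, hyu']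
      group)
    have hd := hP.dvd_orderOf hw1
    refine ⟨w ^ (orderOf w / p), u, orderOf_pow_orderOf_div (orderOf_pos w).ne' hd, ?_⟩
    have hw2 : φ w = u * w ^ m * u⁻¹ := by rw [← hw, hψ]; group
    rw [map_pow, hw2, conj_pow, ← pow_mul, ← pow_mul, mul_comm m]

theorem aux_group {p : ℕ} [Fact p.Prime] {A : Type*} [Group A]
    (hcA : ∀ a b : A, a * b = b * a) (hA : ∀ a : A, a ^ p = 1)
    (m : ℕ) {M : Type*} [Group M] [Finite M] (φ : MulAut M) (χ : M →* A)
    (hχ : ∀ w, χ (φ w) = χ w ^ m) (z : M) (hz : χ z ≠ 1) :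
    ∃ y u : M, orderOf y = p ∧ φ y = u * y ^ m * u⁻¹ := by
  have hp : p.Prime := Fact.out
  obtain ⟨e, r, hr, her⟩ := Nat.exists_eq_pow_mul_and_not_dvd (orderOf_pos z).ne' p hp.ne_one
  have hzr : χ (z ^ r) ≠ 1 := by
    rw [map_pow]
    intro h
    have h1 := orderOf_dvd_of_pow_eq_one h
    rw [orderOf_eq_prime (hA _) hz] at h1
    exact hr h1
  have hpg : IsPGroup p (Subgroup.zpowers (z ^ r)) := by
    apply IsPGroup.of_card_dvd_pow (n := e)
    rw [Nat.card_zpowers]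
    apply orderOf_dvd_of_pow_eq_one
    rw [← pow_mul, mul_comm, ← her, pow_orderOf_eq_one]
  obtain ⟨S, hS⟩ := hpg.exists_le_sylow
  obtain ⟨h, hh⟩ := MulAction.exists_smul_eq M (φ • S) S
  have hh' : (MulAut.conj h * φ) • (S : Subgroup M) = S := by
    rw [mul_smul, ← Sylow.pointwise_smul_def, ← Sylow.coe_subgroup_smul, hh]
  have hmem : ∀ s ∈ (S : Subgroup M), h * φ s * h⁻¹ ∈ (S : Subgroup M) := by
    intro s hs
    have := Subgroup.smul_mem_pointwise_smul s (MulAut.conj h * φ) _ hs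
    rw [hh'] at this
    simpa using this
  let φ' : S →* S := ((MulAut.conj h * φ : MulAut M).toMonoidHom.comp (S : Subgroup M).subtype).codRestrict
    (S : Subgroup M) (fun s => hmem s s.2)
  have hφ' : ∀ s : S, ((φ' s : S) : M) = h * φ s * h⁻¹ := fun s => rfl
  have hinj : Function.Injective φ' := by
    intro a b hab
    have := congrArg Subtype.val hab
    rw [hφ', hφ'] at this
    exact Subtype.ext (φ.injective (mul_left_cancel (mul_right_cancel this)))
  obtain ⟨y, u, hy, hyu⟩ := aux_pgroup hA m (Nat.card S) S le_rfl S.isPGroup' φ'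
    (Finite.surjective_of_injective hinj) (χ.comp (S : Subgroup M).subtype) (by
      intro w
      change χ (φ' w : S) = χ w ^ m
      rw [hφ', map_mul, map_mul, hχ, map_inv]
      rw [hcA, inv_mul_cancel_left])
    ⟨z ^ r, hS (Subgroup.mem_zpowers _)⟩ hzr
  refine ⟨y, h⁻¹ * u, by rwa [Subgroup.orderOf_coe], ?_⟩
  have := congrArg Subtype.val hyu
  rw [hφ'] at this
  simp only [Subgroup.coe_mul, Subgroup.coe_pow, Subgroup.coe_inv] at this
  have e : φ (y : M) = h⁻¹ * (h * φ y * h⁻¹) * h := by group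
  rw [e, this]
  group

theorem aux_rational {G : Type*} [Group G] [Finite G] {p : ℕ} [Fact p.Prime] (x : G)
    (hx : orderOf x = p) (μ : (ZMod p)ˣ) (hμ : ∀ v, v ∈ Subgroup.zpowers μ)
    (h : IsConj x (x ^ (μ : ZMod p).val)) : IsRationalElement x := by
  intro y hy
  have hyo : orderOf y = p := by rw [← Nat.card_zpowers, hy, Nat.card_zpowers, hx]
  have hyx : y ∈ Subgroup.zpowers x := hy ▸ Subgroup.mem_zpowers y
  obtain ⟨j, rfl⟩ := mem_powers_iff_mem_zpowers.mpr hyx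
  simp only at hyo hy hyx ⊢
  have hj : (j : ZMod p) ≠ 0 := by
    intro h0
    rw [ZMod.natCast_eq_zero_iff] at h0
    rw [orderOf_dvd_iff_pow_eq_one.mp (hx ▸ h0), orderOf_one] at hyo
    exact (Fact.out : p.Prime).one_lt.ne hyo
  obtain ⟨k, hk⟩ := mem_powers_iff_mem_zpowers.mpr (hμ (Units.mk0 _ hj))
  have hpow : ∀ k : ℕ, IsConj x (x ^ ((μ : ZMod p).val ^ k)) := by
    intro k
    induction k with
    | zero => rw [pow_zero, pow_one]
    | succ k ih =>
      refine h.trans ?_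
      have h2 : IsConj (x ^ (μ : ZMod p).val) ((x ^ ((μ : ZMod p).val ^ k)) ^ (μ : ZMod p).val) := by
        obtain ⟨c, hc⟩ := isConj_iff.mp ih
        refine isConj_iff.mpr ⟨c, ?_⟩
        rw [← hc, conj_pow]
      rwa [← pow_mul, ← pow_succ] at h2
  have e : x ^ j = x ^ ((μ : ZMod p).val ^ k) := by
    rw [pow_eq_pow_iff_modEq, hx, ← ZMod.natCast_eq_natCast_iff]
    have := congrArg Units.val hk
    simp only [Units.val_pow_eq_pow_val, Units.val_mk0] at this
    rw [← this]
    simp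
  rw [e]
  exact hpow k

/-- If `G/N` has a rational element of prime order `p`, then so does `G`. -/
theorem rational_element_of_quotient_prime {G : Type*} [Group G] [Finite G]
    (N : Subgroup G) [N.Normal] (p : ℕ) (hp : p.Prime)
    (h : ∃ y : G ⧸ N, orderOf y = p ∧ IsRationalElement y) :
    ∃ x : G, orderOf x = p ∧ IsRationalElement x := by
  have : Fact p.Prime := ⟨hp⟩
  obtain ⟨y, hy, hrat⟩ := h
  obtain ⟨μ, hμ⟩ := IsCyclic.exists_generator (α := (ZMod p)ˣ)
  set m := (μ : ZMod p).val with hm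
  have hcop : Nat.Coprime p m := by
    rw [Nat.coprime_comm]
    exact ZMod.val_coe_unit_coprime μ
  have hym : orderOf (y ^ m) = p := by
    rw [Nat.Coprime.orderOf_pow (by rwa [hy]), hy]
  have hz : Subgroup.zpowers (y ^ m) = Subgroup.zpowers y := by
    apply Subgroup.eq_of_le_of_card_ge
    · exact Subgroup.zpowers_le.mpr (Subgroup.pow_mem _ (Subgroup.mem_zpowers y) m)
    · rw [Nat.card_zpowers, Nat.card_zpowers, hy, hym]
  obtain ⟨g', hg'⟩ := isConj_iff.mp (hrat _ hz)
  obtain ⟨g, rfl⟩ := QuotientGroup.mk'_surjective N g'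
  have key : ∀ w ∈ Subgroup.zpowers y,
      QuotientGroup.mk' N g * w * (QuotientGroup.mk' N g)⁻¹ = w ^ m := by
    intro w hw
    obtain ⟨i, rfl⟩ := mem_powers_iff_mem_zpowers.mpr hw
    simp only
    rw [← conj_pow, hg', ← pow_mul, ← pow_mul, mul_comm m]
  let M : Subgroup G := (Subgroup.zpowers y).comap (QuotientGroup.mk' N)
  have hM : ∀ w ∈ M, g * w * g⁻¹ ∈ M := by
    intro w hw
    change QuotientGroup.mk' N (g * w * g⁻¹) ∈ Subgroup.zpowers y
    rw [map_mul, map_mul, map_inv, key _ hw]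
    exact Subgroup.pow_mem _ hw m
  let φ₀ : M →* M := ((MulAut.conj g).toMonoidHom.comp M.subtype).codRestrict M
    (fun w => hM w w.2)
  have hφ₀ : ∀ w : M, ((φ₀ w : M) : G) = g * w * g⁻¹ := fun w => rfl
  have hinj : Function.Injective φ₀ := by
    intro a b hab
    have := congrArg Subtype.val hab
    rw [hφ₀, hφ₀] at this
    exact Subtype.ext (mul_left_cancel (mul_right_cancel this))
  let φ : MulAut M := MulEquiv.ofBijective φ₀ ⟨hinj, Finite.surjective_of_injective hinj⟩
  have hφ : ∀ w : M, ((φ w : M) : G) = g * w * g⁻¹ := fun w => rfl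
  let χ : M →* Subgroup.zpowers y := ((QuotientGroup.mk' N).comp M.subtype).codRestrict _
    (fun w => w.2)
  have hχ : ∀ w : M, ((χ w : Subgroup.zpowers y) : G ⧸ N) = QuotientGroup.mk' N w := fun w => rfl
  obtain ⟨x, hx⟩ := QuotientGroup.mk'_surjective N y
  obtain ⟨v, u, hv, hvu⟩ := aux_group (p := p) (A := Subgroup.zpowers y) (by
      rintro ⟨a, ha⟩ ⟨b, hb⟩
      obtain ⟨i, rfl⟩ := mem_powers_iff_mem_zpowers.mpr ha
      obtain ⟨j, rfl⟩ := mem_powers_iff_mem_zpowers.mpr hb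
      exact Subtype.ext (Commute.pow_pow_self y i j).eq) (by
      rintro ⟨a, ha⟩
      obtain ⟨i, rfl⟩ := mem_powers_iff_mem_zpowers.mpr ha
      apply Subtype.ext
      change (y ^ i) ^ p = 1
      rw [← pow_mul, mul_comm, pow_mul, ← hy, pow_orderOf_eq_one, one_pow]) m φ χ (by
      intro w
      apply Subtype.ext
      rw [hχ, hφ, Subgroup.coe_pow, hχ, map_mul, map_mul, map_inv]
      exact key _ w.2) ⟨x, by
        change QuotientGroup.mk' N x ∈ Subgroup.zpowers y
        rw [hx]; exact Subgroup.mem_zpowers y⟩ (by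
      intro h1
      have h2 := congrArg Subtype.val h1
      rw [hχ] at h2
      change QuotientGroup.mk' N x = 1 at h2
      rw [← hx, h2, orderOf_one] at hy
      exact hp.one_lt.ne hy)
  refine ⟨v, by rwa [Subgroup.orderOf_coe], ?_⟩
  apply aux_rational (p := p) (v : G) (by rwa [Subgroup.orderOf_coe]) μ hμ
  refine isConj_iff.mpr ⟨(u : G)⁻¹ * g, ?_⟩
  have := congrArg Subtype.val hvu
  rw [hφ] at this
  simp only [Subgroup.coe_mul, Subgroup.coe_pow, Subgroup.coe_inv] at this
  have e : (u : G)⁻¹ * g * v * ((u : G)⁻¹ * g)⁻¹ = (u : G)⁻¹ * (g * v * g⁻¹) * u := by group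
  rw [e, this, ← hm]
  group
end
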